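/- Let S = ℂ[x_{1,0},…,x_{1,n_1},…,x_{s,0},…,x_{s,n_s}] and for each i let S^{[i]} = ℂ[x_{i,0},…,x_{i,n_i}]. Let F_i ∈ S^{[i]} be nonzero homogeneous of the same degree d ≥ 3 for i = 1,…,s, and F = F_1 + ⋯ + F_s. Suppose each F_i is one of the following: (1) a monomial x_0^{d_0}⋯x_n^{d_n} with all exponents d_j ≥ 2; (2) a binary form of less than maximal rank (i.e., not of the form L·M^{d−1} for linear forms L, M); (3) x_0^a(x_1^b + ⋯ + x_n^b) with b, n ≥ 2 and a+1 ≥ b; (4) x_0^a(x_0^b + x_1^b + ⋯ + x_n^b) with b, n ≥ 2 and a+1 ≥ b; (5) x_0^a·G(x_1,…,x_n) with a ≥ 2 such that the apolar ideal G^⊥ in ℂ[X_1,…,X_n] is a complete intersection generated by forms of degree at least a+1. Then the Waring locus of F is the union of the Waring loci of the F_i: a nonzero linear form L ∈ S_1 lies in W_F if and only if there is an index i such that L involves only the variables x_{i,0},…,x_{i,n_i} and L lies in W_{F_i}. -/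

import Mathlib

open MvPolynomial

noncomputable section

/-- The linear form `c₀x₀ + ⋯ + cₙxₙ` with coefficient vector `c`. -/
def lin {σ : Type*} [Fintype σ] (c : σ → ℂ) : MvPolynomial σ ℂ :=
  ∑ i, C (c i) * X i

/-- `F` admits a Waring decomposition `F = L₁^d + ⋯ + L_r^d`. -/
def HasWaringDecomp {σ : Type*} [Fintype σ] (d : ℕ) (F : MvPolynomial σ ℂ) (r : ℕ) : Prop :=
  ∃ L : Fin r → σ → ℂ, F = ∑ j, lin (L j) ^ d

/-- The Waring rank of `F` (as a form of degree `d`). -/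
def waringRank {σ : Type*} [Fintype σ] (d : ℕ) (F : MvPolynomial σ ℂ) : ℕ :=
  sInf {r | HasWaringDecomp d F r}

/-- The linear form with coefficient vector `a` lies in the Waring locus of `F`:
there are linear forms `L₂, …, L_r` with `r = rk F` such that `F` lies in the
`ℂ`-linear span of `L^d, L₂^d, …, L_r^d`. -/
def InWaringLocus {σ : Type*} [Fintype σ] (d : ℕ) (F : MvPolynomial σ ℂ) (a : σ → ℂ) : Prop :=
  ∃ (c : Fin (waringRank d F) → ℂ) (L : Fin (waringRank d F) → σ → ℂ)
    (j₀ : Fin (waringRank d F)), L j₀ = a ∧ F = ∑ j, c j • lin (L j) ^ d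

/-- The iterated partial derivative operator `∂^m = ∏ᵢ ∂ᵢ^{mᵢ}` attached to a
multi-exponent `m`. -/
def mderiv {σ : Type*} [Fintype σ] (m : σ →₀ ℕ) :
    Module.End ℂ (MvPolynomial σ ℂ) :=
  (Finset.univ.toList.map fun i : σ =>
    ((pderiv i).toLinearMap : Module.End ℂ (MvPolynomial σ ℂ)) ^ m i).prod

/-- The apolarity action `g ∘ F` of the dual polynomial ring on `S`:
each dual variable acts as the corresponding partial derivative. -/
def contract {σ : Type*} [Fintype σ] (g F : MvPolynomial σ ℂ) : MvPolynomial σ ℂ :=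
  ∑ m ∈ g.support, coeff m g • mderiv m F

/-- The five families of forms (in `N+1` variables) appearing in Theorem 3.14:
(1) monomials with all exponents `≥ 2`;
(2) binary forms of less than maximal rank;
(3) `x₀^a(x₁^b + ⋯ + xₙ^b)` with `b, n ≥ 2`, `a + 1 ≥ b`;
(4) `x₀^a(x₀^b + x₁^b + ⋯ + xₙ^b)` with `b, n ≥ 2`, `a + 1 ≥ b`;
(5) `x₀^a · G(x₁, …, xₙ)` with `a ≥ 2` whose apolar ideal `G^⊥ ⊂ ℂ[X₁,…,Xₙ]` is a
complete intersection generated by `n` forms of degree `≥ a + 1`. -/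
def IsGoodForm (d : ℕ) {N : ℕ} (G : MvPolynomial (Fin (N + 1)) ℂ) : Prop :=
  (∃ ex : Fin (N + 1) → ℕ, (∀ j, 2 ≤ ex j) ∧ G = ∏ j, X j ^ ex j) ∨
  (N = 1 ∧ ¬ ∃ L M : Fin (N + 1) → ℂ, G = lin L * lin M ^ (d - 1)) ∨
  (∃ a b : ℕ, 2 ≤ b ∧ 2 ≤ N ∧ b ≤ a + 1 ∧
    G = X 0 ^ a * ∑ j ∈ Finset.univ.erase (0 : Fin (N + 1)), X j ^ b) ∨
  (∃ a b : ℕ, 2 ≤ b ∧ 2 ≤ N ∧ b ≤ a + 1 ∧ G = X 0 ^ a * ∑ j : Fin (N + 1), X j ^ b) ∨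
  (∃ a : ℕ, 2 ≤ a ∧ ∃ G' : MvPolynomial (Fin N) ℂ,
    G = X 0 ^ a * rename Fin.succ G' ∧
    ∃ gens : Fin N → MvPolynomial (Fin N) ℂ,
      (∀ k, ∃ e : ℕ, a + 1 ≤ e ∧ (gens k).IsHomogeneous e) ∧
      ∀ h : MvPolynomial (Fin N) ℂ,
        (contract h G' = 0 ↔ h ∈ Ideal.span (Set.range gens)))

set_option linter.unusedSectionVars false
set_option linter.unusedSimpArgs false

/-- factorial of a multi-exponent -/
def mfac {σ : Type*} [Fintype σ] (m : σ →₀ ℕ) : ℂ := ∏ i, ((m i).factorial : ℂ)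

lemma mfac_ne {σ : Type*} [Fintype σ] (m : σ →₀ ℕ) : mfac m ≠ 0 := by
  unfold mfac
  exact Finset.prod_ne_zero_iff.2 fun i _ => by exact_mod_cast (Nat.factorial_ne_zero _)

/-- the apolar pairing -/
def pair {σ : Type*} [Fintype σ] (F : MvPolynomial σ ℂ) : MvPolynomial σ ℂ →ₗ[ℂ] ℂ :=
  (basisMonomials σ ℂ).constr ℂ (fun m => mfac m * coeff m F)

section pairing
variable {σ : Type*} [Fintype σ]

lemma pair_monomial (F : MvPolynomial σ ℂ) (m : σ →₀ ℕ) :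
    pair F (monomial m 1) = mfac m * coeff m F := by
  have := (basisMonomials σ ℂ).constr_basis ℂ (fun m => mfac m * coeff m F) m
  simpa [pair] using this

lemma pair_monomial' (F : MvPolynomial σ ℂ) (m : σ →₀ ℕ) (c : ℂ) :
    pair F (monomial m c) = c * (mfac m * coeff m F) := by
  rw [← pair_monomial, ← smul_eq_mul, ← map_smul, smul_monomial, smul_eq_mul, mul_one]

lemma pair_ext {A B : MvPolynomial σ ℂ →ₗ[ℂ] ℂ} (h : ∀ m, A (monomial m 1) = B (monomial m 1)) :
    A = B := by
  apply (basisMonomials σ ℂ).ext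
  intro m; simpa using h m

lemma pair_add (F G : MvPolynomial σ ℂ) : pair (F + G) = pair F + pair G := by
  apply pair_ext; intro m; simp [pair_monomial, mul_add]

lemma pair_smul (c : ℂ) (F : MvPolynomial σ ℂ) : pair (c • F) = c • pair F := by
  apply pair_ext; intro m; simp [pair_monomial]; ring

lemma pair_zero : pair (0 : MvPolynomial σ ℂ) = 0 := by
  apply pair_ext; intro m; simp [pair_monomial]

/-- linear in the first argument -/
def pairL : MvPolynomial σ ℂ →ₗ[ℂ] MvPolynomial σ ℂ →ₗ[ℂ] ℂ where
  toFun := pair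
  map_add' := pair_add
  map_smul' := pair_smul

lemma pair_sum {ι : Type*} (s : Finset ι) (F : ι → MvPolynomial σ ℂ) :
    pair (∑ i ∈ s, F i) = ∑ i ∈ s, pair (F i) := map_sum pairL F s

lemma pair_sum_apply {ι : Type*} (s : Finset ι) (F : ι → MvPolynomial σ ℂ) (f) :
    pair (∑ i ∈ s, F i) f = ∑ i ∈ s, pair (F i) f := by
  rw [pair_sum, LinearMap.sum_apply]

lemma pair_inj {F G : MvPolynomial σ ℂ} (h : ∀ f, pair F f = pair G f) : F = G := by
  ext m
  have := h (monomial m 1)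
  rw [pair_monomial, pair_monomial] at this
  exact mul_left_cancel₀ (mfac_ne m) this

lemma mfac_add_single [DecidableEq σ] (m : σ →₀ ℕ) (i : σ) :
    mfac (m + Finsupp.single i 1) = mfac m * (m i + 1) := by
  unfold mfac
  rw [← Finset.mul_prod_erase _ _ (Finset.mem_univ i),
    ← Finset.mul_prod_erase _ (fun j => ((m j).factorial : ℂ)) (Finset.mem_univ i)]
  have : ∏ x ∈ Finset.univ.erase i, ((((m + Finsupp.single i 1 : σ →₀ ℕ) x).factorial : ℕ) : ℂ)
      = ∏ x ∈ Finset.univ.erase i, ((m x).factorial : ℂ) := by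
    apply Finset.prod_congr rfl
    intro x hx
    have : x ≠ i := Finset.ne_of_mem_erase hx
    simp [Finsupp.single_apply, this.symm]
  rw [this]
  simp [Nat.factorial_succ]
  ring

lemma pair_X_mul (F : MvPolynomial σ ℂ) (i : σ) (f : MvPolynomial σ ℂ) :
    pair F (X i * f) = pair (pderiv i F) f := by
  classical
  have : pair F ∘ₗ LinearMap.mulLeft ℂ (X i) = pair (pderiv i F) := by
    apply pair_ext; intro m
    have hm : (X i : MvPolynomial σ ℂ) * monomial m 1 = monomial (m + Finsupp.single i 1) 1 := by
      rw [X, monomial_mul, add_comm]; simp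
    simp only [LinearMap.comp_apply, LinearMap.mulLeft_apply]
    rw [hm, pair_monomial, pair_monomial, coeff_pderiv, mfac_add_single]
    ring
  exact LinearMap.congr_fun this f

lemma pair_one (F : MvPolynomial σ ℂ) : pair F 1 = coeff 0 F := by
  have := pair_monomial F 0
  simpa [mfac] using this

lemma pderiv_lin (i : σ) (p : σ → ℂ) : pderiv i (lin p) = C (p i) := by
  classical
  unfold lin
  rw [map_sum, Finset.sum_eq_single i]
  · simp
  · intro b _ hb
    simp [pderiv_X_of_ne hb]
  · simp

lemma lin_isHomogeneous (p : σ → ℂ) : (lin p).IsHomogeneous 1 := by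
  unfold lin
  exact IsHomogeneous.sum _ _ _ fun i _ => by
    simpa using (isHomogeneous_C σ (p i)).mul (isHomogeneous_X ℂ i)

lemma lin_add (p q : σ → ℂ) : lin (p + q) = lin p + lin q := by
  simp [lin, add_mul, Finset.sum_add_distrib]

lemma lin_smul (c : ℂ) (p : σ → ℂ) : lin (c • p) = c • lin p := by
  simp [lin, Finset.smul_sum, smul_eq_C_mul, mul_assoc]

lemma lin_single [DecidableEq σ] (i : σ) : lin (Pi.single i 1) = X i := by
  unfold lin
  rw [Finset.sum_eq_single i]
  · simp
  · intro b _ hb; simp [hb]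
  · simp

lemma lin_zero : lin (0 : σ → ℂ) = 0 := by simp [lin]

lemma lin_sum {ι : Type*} (s : Finset ι) (v : ι → σ → ℂ) :
    lin (∑ i ∈ s, v i) = ∑ i ∈ s, lin (v i) := by
  classical
  induction s using Finset.induction with
  | empty => simp [lin_zero]
  | insert a s ha ih => rw [Finset.sum_insert ha, Finset.sum_insert ha, lin_add, ih]

lemma eval_lin (p q : σ → ℂ) : eval q (lin p) = ∑ i, p i * q i := by
  simp [lin]

lemma coeff_lin [DecidableEq σ] (p : σ → ℂ) (i : σ) :
    coeff (Finsupp.single i 1) (lin p) = p i := by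
  unfold lin
  rw [coeff_sum, Finset.sum_eq_single i]
  · simp
  · intro b _ hb
    rw [coeff_C_mul, coeff_X, if_neg]
    · simp
    · intro h
      exact hb (Finsupp.single_left_injective one_ne_zero h)
  · simp

lemma lin_eq_zero {p : σ → ℂ} (h : lin p = 0) : p = 0 := by
  classical
  ext i
  rw [← coeff_lin p i, h]; simp

lemma exists_single_of_degree_one {m : σ →₀ ℕ} (h : m.degree = 1) :
    ∃ i, m = Finsupp.single i 1 := by
  classical
  have hne : m ≠ 0 := by rintro rfl; simp at h
  obtain ⟨i, hi⟩ := Finsupp.ne_iff.1 hne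
  have hi' : m i ≠ 0 := by simpa using hi
  refine ⟨i, ?_⟩
  have hle : Finsupp.single i 1 ≤ m := by
    rw [Finsupp.single_le_iff]; omega
  obtain ⟨m', rfl⟩ := exists_add_of_le hle
  rw [map_add, Finsupp.degree_single] at h
  have : m' = 0 := (Finsupp.degree_eq_zero_iff m').1 (by omega)
  simp [this]

lemma homog_degree {f : MvPolynomial σ ℂ} {d : ℕ} (hf : f.IsHomogeneous d) {m : σ →₀ ℕ}
    (hm : coeff m f ≠ 0) : m.degree = d := by
  by_contra h
  exact hm (hf.coeff_eq_zero h)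

lemma homog_one_eq_lin {f : MvPolynomial σ ℂ} (hf : f.IsHomogeneous 1) :
    ∃ p, f = lin p := by
  classical
  refine ⟨fun i => coeff (Finsupp.single i 1) f, ?_⟩
  ext m
  by_cases hm : m.degree = 1
  · obtain ⟨i, rfl⟩ := exists_single_of_degree_one hm
    rw [coeff_lin]
  · rw [hf.coeff_eq_zero hm, (lin_isHomogeneous _).coeff_eq_zero hm]

lemma pair_of_degree_ne {F f : MvPolynomial σ ℂ} {d e : ℕ} (hF : F.IsHomogeneous d)
    (hf : f.IsHomogeneous e) (h : e ≠ d) : pair F f = 0 := by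
  rw [f.as_sum, map_sum]
  apply Finset.sum_eq_zero
  intro m hm
  rw [pair_monomial', hF.coeff_eq_zero]
  · simp
  · intro h'
    have h2 := homog_degree hf (mem_support_iff.1 hm)
    exact h (h2.symm.trans h')

lemma pair_homComp {F : MvPolynomial σ ℂ} {d : ℕ} (hF : F.IsHomogeneous d)
    (f : MvPolynomial σ ℂ) : pair F f = pair F (homogeneousComponent d f) := by
  conv_lhs => rw [← sum_homogeneousComponent f]
  rw [map_sum]
  by_cases hd : d ∈ Finset.range (f.totalDegree + 1)
  · rw [Finset.sum_eq_single_of_mem d hd]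
    intro e _ he
    exact pair_of_degree_ne hF (homogeneousComponent_isHomogeneous e f) he
  · rw [homogeneousComponent_eq_zero, map_zero]
    · apply Finset.sum_eq_zero
      intro e he
      exact pair_of_degree_ne hF (homogeneousComponent_isHomogeneous e f) (by rintro rfl; exact hd he)
    · simp at hd; omega

lemma pair_lin_pow_monomial (p : σ → ℂ) (m : σ →₀ ℕ) : ∀ d, m.degree = d →
    pair (lin p ^ d) (monomial m 1) = d.factorial * eval p (monomial m 1) := by
  classical
  intro d
  induction d generalizing m with
  | zero =>
    intro h
    have : m = 0 := (Finsupp.degree_eq_zero_iff m).1 h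
    subst this
    have := pair_one (σ := σ) 1
    simpa using this
  | succ d ih =>
    intro h
    have hne : m ≠ 0 := by rintro rfl; simp at h
    obtain ⟨i, hi⟩ := Finsupp.ne_iff.1 hne
    have hi' : m i ≠ 0 := by simpa using hi
    set m' := m - Finsupp.single i 1 with hm'
    have hmm : m = Finsupp.single i 1 + m' := by
      ext j
      simp only [hm', Finsupp.coe_add, Pi.add_apply, Finsupp.coe_tsub, Pi.sub_apply, Finsupp.single_apply]
      split_ifs with hj
      · subst hj; omega
      · omega
    have hdeg : m'.degree = d := by
      rw [hmm, map_add, Finsupp.degree_single] at h; omega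
    have hX : (monomial m (1:ℂ)) = X i * monomial m' 1 := by
      rw [X, monomial_mul, ← hmm]; simp
    rw [hX, pair_X_mul, Derivation.leibniz_pow, pderiv_lin]
    simp only [Nat.add_sub_cancel, smul_eq_mul, map_mul, eval_X]
    have : ((d + 1) • (lin p ^ d * C (p i)) : MvPolynomial σ ℂ) = ((d+1 : ℂ) * p i) • lin p ^ d := by
      rw [nsmul_eq_mul, smul_eq_C_mul]; simp; ring
    rw [this, pair_smul, LinearMap.smul_apply, ih m' hdeg, Nat.factorial_succ]
    push_cast
    simp only [smul_eq_mul]; ring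

lemma pair_lin_pow (p : σ → ℂ) {d : ℕ} {f : MvPolynomial σ ℂ} (hf : f.IsHomogeneous d) :
    pair (lin p ^ d) f = d.factorial * eval p f := by
  rw [f.as_sum, map_sum, map_sum, Finset.mul_sum]
  apply Finset.sum_congr rfl
  intro m hm
  have h2 := homog_degree hf (mem_support_iff.1 hm)
  have := pair_lin_pow_monomial p m d h2
  have e : monomial m (coeff m f) = coeff m f • monomial m (1:ℂ) := by
    rw [smul_monomial]; simp
  rw [e, map_smul, smul_eq_mul, this, smul_eval]
  ring

/-- annihilator of `F` -/
def Perp (F f : MvPolynomial σ ℂ) : Prop := ∀ q, pair F (f * q) = 0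

lemma Perp.add {F f g : MvPolynomial σ ℂ} (hf : Perp F f) (hg : Perp F g) : Perp F (f + g) := by
  intro q; rw [add_mul, map_add, hf, hg, add_zero]
lemma Perp.mul_right {F f : MvPolynomial σ ℂ} (hf : Perp F f) (g) : Perp F (f * g) := by
  intro q; rw [mul_assoc]; exact hf _
lemma Perp.mul_left {F f : MvPolynomial σ ℂ} (hf : Perp F f) (g) : Perp F (g * f) := by
  rw [mul_comm]; exact hf.mul_right g
lemma Perp.neg {F f : MvPolynomial σ ℂ} (hf : Perp F f) : Perp F (-f) := by
  intro q; rw [neg_mul, map_neg, hf, neg_zero]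
lemma Perp.sub {F f g : MvPolynomial σ ℂ} (hf : Perp F f) (hg : Perp F g) : Perp F (f - g) := by
  intro q; rw [sub_mul, map_sub, hf, hg, sub_zero]
lemma Perp.zero {F : MvPolynomial σ ℂ} : Perp F 0 := by intro q; simp
lemma Perp.smul {F f : MvPolynomial σ ℂ} (c : ℂ) (hf : Perp F f) : Perp F (c • f) := by
  intro q; rw [smul_mul_assoc, map_smul, hf, smul_zero]
lemma Perp.sum {ι : Type*} {F : MvPolynomial σ ℂ} {s : Finset ι} {f : ι → MvPolynomial σ ℂ}
    (hf : ∀ i ∈ s, Perp F (f i)) : Perp F (∑ i ∈ s, f i) := by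
  intro q; rw [Finset.sum_mul, map_sum]; exact Finset.sum_eq_zero fun i hi => hf i hi q

/-- the annihilator as an ideal -/
def perpIdeal (F : MvPolynomial σ ℂ) : Ideal (MvPolynomial σ ℂ) where
  carrier := {f | Perp F f}
  add_mem' := Perp.add
  zero_mem' := Perp.zero
  smul_mem' := fun c _ h => h.mul_left c

lemma mem_perpIdeal {F f : MvPolynomial σ ℂ} : f ∈ perpIdeal F ↔ Perp F f := Iff.rfl

/-- enough to test with homogeneous `q` of complementary degree -/
lemma perp_of_homog {F f : MvPolynomial σ ℂ} {d e : ℕ} (hF : F.IsHomogeneous d)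
    (hf : f.IsHomogeneous e)
    (h : ∀ q k, q.IsHomogeneous k → e + k = d → pair F (f * q) = 0) : Perp F f := by
  intro q
  rw [← sum_homogeneousComponent q, Finset.mul_sum, map_sum]
  apply Finset.sum_eq_zero
  intro k _
  have hq := homogeneousComponent_isHomogeneous k q
  by_cases hk : e + k = d
  · exact h _ k hq hk
  · exact pair_of_degree_ne hF (hf.mul hq) hk

lemma pair_decomp {ι : Type*} [Fintype ι] {d : ℕ} (c : ι → ℂ) (p : ι → σ → ℂ)
    {f : MvPolynomial σ ℂ} (hf : f.IsHomogeneous d) :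
    pair (∑ j, c j • lin (p j) ^ d) f = ∑ j, c j * (d.factorial * eval (p j) f) := by
  rw [pair_sum_apply]
  refine Finset.sum_congr rfl fun j _ => ?_
  rw [pair_smul, LinearMap.smul_apply, pair_lin_pow _ hf, smul_eq_mul]

lemma decomp_homog {ι : Type*} [Fintype ι] {d : ℕ} (c : ι → ℂ) (p : ι → σ → ℂ) :
    (∑ j, c j • lin (p j) ^ d).IsHomogeneous d := by
  refine IsHomogeneous.sum _ _ _ fun j _ => ?_
  rw [smul_eq_C_mul]
  simpa using (isHomogeneous_C σ (c j)).mul ((lin_isHomogeneous (p j)).pow d)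

lemma perp_of_vanish {ι : Type*} [Fintype ι] {d : ℕ} {F : MvPolynomial σ ℂ} {c : ι → ℂ}
    {p : ι → σ → ℂ} (hF : F = ∑ j, c j • lin (p j) ^ d) {f : MvPolynomial σ ℂ} {e : ℕ}
    (hf : f.IsHomogeneous e) (hv : ∀ j, eval (p j) f = 0) : Perp F f := by
  subst hF
  refine perp_of_homog (decomp_homog c p) hf ?_
  intro q k hq hk
  have : (f * q).IsHomogeneous d := hk ▸ hf.mul hq
  rw [pair_decomp c p this]
  exact Finset.sum_eq_zero fun j _ => by simp [hv j]

lemma eval_smul_homog {f : MvPolynomial σ ℂ} {e : ℕ} (hf : f.IsHomogeneous e) (c : ℂ) (p : σ → ℂ) :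
    eval (c • p) f = c ^ e * eval p f := by
  rw [f.as_sum, map_sum, map_sum, Finset.mul_sum]
  apply Finset.sum_congr rfl
  intro m hm
  have h2 := homog_degree hf (mem_support_iff.1 hm)
  rw [eval_monomial, eval_monomial]
  simp only [Pi.smul_apply, smul_eq_mul, mul_pow, Finsupp.prod_mul]
  have : (m.prod fun a b => c ^ b) = c ^ e := by
    rw [← h2]; rw [Finsupp.degree_apply]; simp [Finsupp.prod, Finset.prod_pow_eq_pow_sum]
  rw [this]; ring

/-- apolarity lemma -/
lemma hasWaring_of_span {d r : ℕ} (hd : 1 ≤ d) {F : MvPolynomial σ ℂ} (hF : F.IsHomogeneous d)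
    (p : Fin r → σ → ℂ)
    (h : ∀ f : MvPolynomial σ ℂ, f.IsHomogeneous d → (∀ j, eval (p j) f = 0) → pair F f = 0) :
    HasWaringDecomp d F r := by
  have key : pair F ∈ Submodule.span ℂ (Set.range fun j => pair (lin (p j) ^ d)) := by
    apply mem_span_of_iInf_ker_le_ker
    intro f hf
    simp only [Submodule.mem_iInf, LinearMap.mem_ker] at hf ⊢
    rw [pair_homComp hF]
    have hh := homogeneousComponent_isHomogeneous d f
    apply h _ hh
    intro j
    have h1 := hf j
    have hl : (lin (p j) ^ d).IsHomogeneous d := by simpa using (lin_isHomogeneous (p j)).pow d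
    rw [pair_homComp hl, pair_lin_pow _ hh] at h1
    exact (mul_eq_zero.1 h1).resolve_left (by exact_mod_cast Nat.factorial_ne_zero d)
  rw [Submodule.mem_span_range_iff_exists_fun] at key
  obtain ⟨c, hc⟩ := key
  choose z hz using fun j => IsAlgClosed.exists_pow_nat_eq (c j) (n := d) (by omega)
  refine ⟨fun j => z j • p j, ?_⟩
  apply pair_inj
  intro f
  rw [← hc, pair_sum_apply, LinearMap.sum_apply]
  refine Finset.sum_congr rfl fun j _ => ?_
  rw [lin_smul, smul_pow, hz, pair_smul]

lemma absorb {d : ℕ} (hd : 1 ≤ d) {ι : Type*} [Fintype ι] {F : MvPolynomial σ ℂ} (c : ι → ℂ)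
    (p : ι → σ → ℂ) (hF : F = ∑ j, c j • lin (p j) ^ d) :
    HasWaringDecomp d F (Fintype.card ι) := by
  choose z hz using fun j => IsAlgClosed.exists_pow_nat_eq (c j) (n := d) (by omega)
  refine ⟨fun j => z ((Fintype.equivFin ι).symm j) • p ((Fintype.equivFin ι).symm j), ?_⟩
  rw [hF, ← (Fintype.equivFin ι).symm.sum_comp]
  refine Finset.sum_congr rfl fun j _ => ?_
  rw [lin_smul, smul_pow, hz]

lemma HasWaringDecomp.mono {d r r' : ℕ} (hd : 1 ≤ d) (h : r ≤ r') {F : MvPolynomial σ ℂ}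
    (hF : HasWaringDecomp d F r) : HasWaringDecomp d F r' := by
  obtain ⟨L, rfl⟩ := hF
  obtain ⟨k, rfl⟩ := Nat.exists_eq_add_of_le h
  refine ⟨Fin.append L (fun _ => 0), ?_⟩
  rw [Fin.sum_univ_add]
  simp [lin_zero, zero_pow (show d ≠ 0 by omega)]

end pairing

/-! restriction -/
section restr
variable {σ τ : Type*} [Fintype σ] [Fintype τ]

open Classical in
/-- restriction of the dual variables along an injection -/
def res (ι : τ → σ) : MvPolynomial σ ℂ →ₐ[ℂ] MvPolynomial τ ℂ :=
  aeval fun x => if h : ∃ j, ι j = x then X h.choose else 0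

lemma res_X {ι : τ → σ} (hι : Function.Injective ι) (j : τ) : res ι (X (ι j)) = X j := by
  have h : ∃ k, ι k = ι j := ⟨j, rfl⟩
  simp only [res, aeval_X, h, dif_pos]
  rw [hι h.choose_spec]

lemma res_X_of_notMem {ι : τ → σ} {x : σ} (h : ∀ j, ι j ≠ x) : res ι (X x) = 0 := by
  have h' : ¬ ∃ k, ι k = x := by push Not; exact h
  simp only [res, aeval_X, h', dif_neg, not_false_iff]

lemma res_rename {ι : τ → σ} (hι : Function.Injective ι) (f : MvPolynomial τ ℂ) :
    res ι (rename ι f) = f := by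
  have : (res ι).comp (rename ι) = AlgHom.id ℂ _ := by
    ext j; simp [res_X hι]
  exact congrArg (fun g => g f) this

lemma res_homog (ι : τ → σ) {f : MvPolynomial σ ℂ} {e : ℕ} (hf : f.IsHomogeneous e) :
    (res ι f).IsHomogeneous e := by
  have := hf.aeval (fun x => (res ι (X x) : MvPolynomial τ ℂ)) (n := 1) (fun x => by
    by_cases h : ∃ j, ι j = x
    · simp only [res, aeval_X, h, dif_pos]; exact isHomogeneous_X _ _
    · simp only [res, aeval_X, h, dif_neg, not_false_iff]; exact isHomogeneous_zero _ _ _)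
  simpa [res] using this

lemma pair_rename {ι : τ → σ} (hι : Function.Injective ι) (F : MvPolynomial τ ℂ)
    (f : MvPolynomial σ ℂ) : pair (rename ι F) f = pair F (res ι f) := by
  classical
  induction f using MvPolynomial.induction_on generalizing F with
  | C a =>
    rw [← mul_one (C a), ← smul_eq_C_mul, map_smul, map_smul, map_smul, map_one (res ι), pair_one, pair_one]
    rw [← constantCoeff_eq, ← constantCoeff_eq, constantCoeff_rename]
  | add p q hp hq => rw [map_add, map_add, map_add, hp, hq]
  | mul_X p x hp =>
    rw [mul_comm, pair_X_mul, map_mul]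
    by_cases h : ∃ j, ι j = x
    · obtain ⟨j, rfl⟩ := h
      rw [pderiv_rename hι, hp, res_X hι, pair_X_mul]
    · push Not at h
      rw [res_X_of_notMem h, zero_mul, map_zero, pderiv_eq_zero_of_notMem_vars, pair_zero]
      · rfl
      · intro hx
        have := vars_rename ι F hx
        simp at this
        obtain ⟨j, _, hj⟩ := this
        exact h j hj

lemma res_surj {ι : τ → σ} (hι : Function.Injective ι) : Function.Surjective (res ι) :=
  fun f => ⟨rename ι f, res_rename hι f⟩

lemma perp_rename {ι : τ → σ} (hι : Function.Injective ι) (F : MvPolynomial τ ℂ)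
    (f : MvPolynomial σ ℂ) : Perp (rename ι F) f ↔ Perp F (res ι f) := by
  constructor
  · intro h q
    have := h (rename ι q)
    rwa [pair_rename hι, map_mul, res_rename hι] at this
  · intro h q
    rw [pair_rename hι, map_mul]
    exact h _

lemma rename_lin {ι : τ → σ} (p : τ → ℂ) (q : σ → ℂ) (h : ∀ j, q (ι j) = p j)
    (hι : Function.Injective ι) (h0 : ∀ x, (∀ j, ι j ≠ x) → q x = 0) :
    rename ι (lin p) = lin q := by
  classical
  unfold lin
  rw [map_sum, ← Finset.sum_subset (Finset.subset_univ (Finset.univ.image ι))]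
  · rw [Finset.sum_image (fun _ _ _ _ h => hι h)]
    simp [h]
  · intro x _ hx
    rw [h0, C_0, zero_mul]
    intro j hj; exact hx (by simp [← hj])

lemma res_lin {ι : τ → σ} (hι : Function.Injective ι) (p : σ → ℂ) :
    res ι (lin p) = lin (p ∘ ι) := by
  classical
  unfold lin
  rw [map_sum]
  simp only [map_mul, algHom_C, algebraMap_eq]
  rw [← Finset.sum_subset (Finset.subset_univ (Finset.univ.image ι))]
  · rw [Finset.sum_image (fun _ _ _ _ h => hι h)]
    simp [res_X hι]
  · intro x _ hx
    rw [res_X_of_notMem, mul_zero]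
    intro j hj; exact hx (by simp [← hj])

lemma pair_comm (F f : MvPolynomial σ ℂ) : pair F f = pair f F := by
  have : (pairL : MvPolynomial σ ℂ →ₗ[ℂ] MvPolynomial σ ℂ →ₗ[ℂ] ℂ) = pairL.flip := by
    apply (basisMonomials σ ℂ).ext
    intro m
    apply pair_ext
    intro n
    classical
    simp only [coe_basisMonomials, LinearMap.flip_apply]
    change pair _ _ = pair _ _
    rw [pair_monomial, pair_monomial, coeff_monomial, coeff_monomial]
    by_cases h : m = n
    · simp [h]
    · simp [h, Ne.symm h]
  exact congrArg (fun g => g F f) this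

lemma monomial_pair (f : MvPolynomial σ ℂ) (m : σ →₀ ℕ) :
    pair (monomial m 1) f = mfac m * coeff m f := by
  rw [pair_comm, pair_monomial]

lemma pair_mderiv_list (m : σ →₀ ℕ) (l : List σ) (F q : MvPolynomial σ ℂ) :
    pair ((l.map fun i : σ =>
      ((pderiv i).toLinearMap : Module.End ℂ (MvPolynomial σ ℂ)) ^ m i).prod F) q =
    pair F ((l.map fun i : σ => (X i : MvPolynomial σ ℂ) ^ m i).prod * q) := by
  induction l generalizing q with
  | nil => simp
  | cons i l ih =>
    rw [List.map_cons, List.prod_cons, Module.End.mul_apply, List.map_cons, List.prod_cons]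
    have : ∀ (k : ℕ) (H : MvPolynomial σ ℂ) (q), pair ((((pderiv i).toLinearMap :
        Module.End ℂ (MvPolynomial σ ℂ)) ^ k) H) q = pair H (X i ^ k * q) := by
      intro k
      induction k with
      | zero => simp
      | succ k ihk =>
        intro H q
        rw [pow_succ, Module.End.mul_apply, ihk]
        change pair (pderiv i H) _ = _
        rw [← pair_X_mul]; congr 1; ring
    rw [this, ih]; congr 1; ring

lemma pair_mderiv (m : σ →₀ ℕ) (F q : MvPolynomial σ ℂ) :
    pair (mderiv m F) q = pair F (monomial m 1 * q) := by
  unfold mderiv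
  rw [pair_mderiv_list]
  congr 2
  rw [Finset.prod_map_toList, monomial_eq, Finsupp.prod_fintype _ _ (by simp)]
  simp

lemma pair_contract (h F q : MvPolynomial σ ℂ) : pair (contract h F) q = pair F (h * q) := by
  unfold contract
  rw [pair_sum_apply]
  conv_rhs => rw [h.as_sum, Finset.sum_mul, map_sum]
  refine Finset.sum_congr rfl fun m _ => ?_
  rw [pair_smul, LinearMap.smul_apply, pair_mderiv, ← map_smul, ← smul_mul_assoc, smul_monomial]
  simp

lemma contract_eq_zero_iff (h F : MvPolynomial σ ℂ) : contract h F = 0 ↔ Perp F h := by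
  constructor
  · intro hh q
    rw [← pair_contract, hh, pair_zero]; rfl
  · intro hh
    apply pair_inj
    intro f
    rw [pair_contract, hh, pair_zero]; rfl

end restr

/-- certificate for a form -/
structure Cert {σ : Type} [Fintype σ] (d : ℕ) (F : MvPolynomial σ ℂ) where
  B : Type
  fB : Fintype B
  U : Type
  fU : Fintype U
  b : B → MvPolynomial σ ℂ
  deg : B → ℕ
  two_le : ∀ β, 2 ≤ deg β
  hom : ∀ β, (b β).IsHomogeneous (deg β)
  u : U → σ → ℂ
  Lam : Set σ
  upper : HasWaringDecomp d F (Fintype.card σ + Fintype.card B)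
  indep : ∀ α : U → ℂ, (∀ j, α j ≠ 0) → ∀ (D : ℕ) (c : B → ℂ) (h k : MvPolynomial σ ℂ),
    (∑ β, (if deg β = D then c β • b β else 0)) = h + lin (∑ j, α j • u j) * k →
    (∀ j, Perp F (lin (u j) * h)) → ∀ β, deg β = D → c β = 0
  K1 : ∀ w, (∀ j, Perp F (lin (u j) * lin w)) → w = 0
  R1 : ∀ α : U → ℂ, (∀ j, α j ≠ 0) → ∀ w, Perp F (lin (∑ j, α j • u j) * lin w) →
    ∀ x, x ∉ Lam → w x = 0
  R2 : ∀ l ∈ Lam, ∀ m ∈ Lam, l ≠ m → Perp F (X l * X m)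
  R3 : ∀ α : U → ℂ, (∀ j, α j ≠ 0) → ∀ l ∈ Lam, ∀ x, (∑ j, α j • u j) x ≠ 0 ↔ x ∈ Lam

attribute [instance] Cert.fB Cert.fU

lemma exists_eval_ne {σ : Type*} {f : MvPolynomial σ ℂ} (hf : f ≠ 0) : ∃ p, eval p f ≠ 0 := by
  by_contra h
  push Not at h
  exact hf (MvPolynomial.funext fun p => by rw [h p, map_zero])

lemma generic_vec {A κ : Type*} [Fintype A] [Fintype κ] (v : κ → A → ℂ) :
    ∃ α : A → ℂ, (∀ a, α a ≠ 0) ∧ ∀ k, v k ≠ 0 → ∑ a, α a * v k a ≠ 0 := by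
  classical
  have h1 : (∏ a : A, (X a : MvPolynomial A ℂ)) * ∏ k, (if v k = 0 then 1 else lin (v k)) ≠ 0 := by
    refine mul_ne_zero (Finset.prod_ne_zero_iff.2 fun a _ => X_ne_zero a)
      (Finset.prod_ne_zero_iff.2 fun k _ => ?_)
    split_ifs with h
    · exact one_ne_zero
    · exact fun h' => h (lin_eq_zero h')
  obtain ⟨p, hp⟩ := exists_eval_ne h1
  rw [map_mul, map_prod, map_prod] at hp
  obtain ⟨hp1, hp2⟩ := mul_ne_zero_iff.1 hp
  refine ⟨p, fun a => by simpa using Finset.prod_ne_zero_iff.1 hp1 a (Finset.mem_univ a), ?_⟩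
  intro k hk
  have := Finset.prod_ne_zero_iff.1 hp2 k (Finset.mem_univ k)
  rw [if_neg hk, eval_lin] at this
  convert this using 2
  ring_nf

lemma hcast {σ : Type*} {f : MvPolynomial σ ℂ} {a b : ℕ} (h : f.IsHomogeneous a) (e : a = b) :
    f.IsHomogeneous b := e ▸ h

section core
variable {I : Type} [Fintype I] [DecidableEq I] {σ : I → Type} [∀ i, Fintype (σ i)]

/-- block inclusion -/
abbrev blk (σ : I → Type) (i : I) : σ i → (Σ i, σ i) := Sigma.mk i

lemma blk_inj (i : I) : Function.Injective (blk σ i) := sigma_mk_injective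

lemma blk_ne {i k : I} (h : k ≠ i) (x : σ k) : ∀ j, blk σ i j ≠ ⟨k, x⟩ := by
  intro j hj
  exact h (congrArg Sigma.fst hj).symm

lemma res_blk_ne_homog {i k : I} (h : k ≠ i) {f : MvPolynomial (σ k) ℂ} {e : ℕ}
    (hf : f.IsHomogeneous e) (he : e ≠ 0) : res (blk σ i) (rename (blk σ k) f) = 0 := by
  rw [f.as_sum, map_sum, map_sum]
  refine Finset.sum_eq_zero fun m hm => ?_
  have hd := homog_degree hf (mem_support_iff.1 hm)
  have hne : m ≠ 0 := by rintro rfl; simp at hd; omega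
  obtain ⟨x, hx⟩ := Finsupp.ne_iff.1 hne
  have hx' : m x ≠ 0 := by simpa using hx
  rw [monomial_eq, map_mul, map_mul, Finsupp.prod, map_prod, map_prod,
    Finset.prod_eq_zero (Finsupp.mem_support_iff.2 hx'), mul_zero]
  rw [map_pow, map_pow, rename_X, res_X_of_notMem (blk_ne h x), zero_pow hx']

variable (F : ∀ i, MvPolynomial (σ i) ℂ)

/-- total form -/
def tot : MvPolynomial (Σ i, σ i) ℂ := ∑ i, rename (blk σ i) (F i)

lemma pair_tot (f : MvPolynomial (Σ i, σ i) ℂ) :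
    pair (tot F) f = ∑ i, pair (F i) (res (blk σ i) f) := by
  rw [tot, pair_sum_apply]
  exact Finset.sum_congr rfl fun i _ => pair_rename (blk_inj i) _ _

lemma perp_tot_of {f : MvPolynomial (Σ i, σ i) ℂ} (h : ∀ i, Perp (F i) (res (blk σ i) f)) :
    Perp (tot F) f := by
  intro q
  rw [pair_tot]
  exact Finset.sum_eq_zero fun i _ => by rw [map_mul]; exact h i _

lemma perp_of_tot {d e : ℕ} (hF : ∀ i, (F i).IsHomogeneous d)
    {f : MvPolynomial (Σ i, σ i) ℂ} (hf : f.IsHomogeneous e) (hed : e < d)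
    (h : Perp (tot F) f) (i : I) : Perp (F i) (res (blk σ i) f) := by
  refine perp_of_homog (hF i) (res_homog _ hf) fun q k hq hk => ?_
  have := h (rename (blk σ i) q)
  rw [pair_tot, Finset.sum_eq_single i] at this
  · rwa [map_mul, res_rename (blk_inj i)] at this
  · intro j _ hj
    rw [map_mul, res_blk_ne_homog hj.symm hq (by omega), mul_zero, map_zero]
  · simp

lemma perp_of_tot_mul (i : I) {w : σ i → ℂ}
    {f : MvPolynomial (Σ i, σ i) ℂ} 
    (h : Perp (tot F) (rename (blk σ i) (lin w) * f)) : Perp (F i) (lin w * res (blk σ i) f) := by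
  intro q
  have := h (rename (blk σ i) q)
  rw [pair_tot, Finset.sum_eq_single i] at this
  · rwa [map_mul (res _), map_mul (res _), res_rename (blk_inj i), res_rename (blk_inj i)] at this
  · intro j _ hj
    rw [map_mul (res _), map_mul (res _), res_blk_ne_homog hj.symm (lin_isHomogeneous w) one_ne_zero]
    simp
  · simp

variable {F} {d : ℕ} (hd : 3 ≤ d) (hF : ∀ i, (F i).IsHomogeneous d) (C : ∀ i, Cert d (F i))

/-- the total number -/
def Rtot : ℕ := ∑ i, (Fintype.card (σ i) + Fintype.card (C i).B)

/-- tau -/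
def tauv (α : ∀ i, (C i).U → ℂ) (i : I) : σ i → ℂ := ∑ j, α i j • (C i).u j

/-- the form t -/
def tform (α : ∀ i, (C i).U → ℂ) : MvPolynomial (Σ i, σ i) ℂ :=
  ∑ i, rename (blk σ i) (lin (tauv C α i))

lemma tform_eq_lin (α : ∀ i, (C i).U → ℂ) :
    tform C α = lin (fun x : Σ i, σ i => tauv C α x.1 x.2) := by
  unfold tform lin
  simp only [map_sum, map_mul, rename_C, rename_X]
  rw [Fintype.sum_sigma]

lemma res_tform (α : ∀ i, (C i).U → ℂ) (i : I) :
    res (blk σ i) (tform C α) = lin (tauv C α i) := by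
  rw [tform_eq_lin, res_lin (blk_inj i)]; rfl

lemma tform_homog (α : ∀ i, (C i).U → ℂ) : (tform C α).IsHomogeneous 1 := by
  rw [tform_eq_lin]; exact lin_isHomogeneous _

section norm
variable {J : Type} [Fintype J] {c : J → ℂ} {p : J → (Σ i, σ i) → ℂ}
  (hdec : tot F = ∑ j, c j • lin (p j) ^ d)
  {α : ∀ i, (C i).U → ℂ} (hα : ∀ i j, α i j ≠ 0)
  (hnorm : ∀ j, eval (p j) (tform C α) = 1 ∨
    ∀ i u, eval (p j) (rename (blk σ i) (lin ((C i).u u))) = 0)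

include hdec hnorm in
lemma perp_u_mul {H : MvPolynomial (Σ i, σ i) ℂ} {D : ℕ} (hH : H.IsHomogeneous D)
    (hv : ∀ j, eval (p j) (tform C α) = 1 → eval (p j) H = 0) (i : I) (u : (C i).U) :
    Perp (F i) (lin ((C i).u u) * res (blk σ i) H) := by
  apply perp_of_tot_mul
  refine perp_of_vanish hdec ((((lin_isHomogeneous _).rename_isHomogeneous).mul hH)) ?_
  intro j
  rw [map_mul]
  rcases hnorm j with h | h
  · rw [hv j h, mul_zero]
  · rw [h, zero_mul]

include hd hF hdec hα hnorm in
lemma lemmaA (γ : (Σ i, (C i).B) → ℂ) (l : (Σ i, σ i) → ℂ) {f : MvPolynomial (Σ i, σ i) ℂ}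
    (hf : f.IsHomogeneous 2) (hpf : Perp (tot F) f)
    (h : ∀ j, eval (p j) (tform C α) = 1 →
      ∑ x : Σ i, (C i).B, γ x * eval (p j) (rename (blk σ x.1) ((C x.1).b x.2)) + eval (p j) (lin l)
        = eval (p j) f) : γ = 0 := by
  classical
  let M := ∑ x : Σ i, (C i).B, (C x.1).deg x.2
  have hM : ∀ x : Σ i, (C i).B, (C x.1).deg x.2 ≤ M := fun x =>
    Finset.single_le_sum (f := fun x : Σ i, (C i).B => (C x.1).deg x.2) (fun _ _ => Nat.zero_le _)
      (Finset.mem_univ x)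
  have claim : ∀ n, ∀ x : Σ i, (C i).B, M < (C x.1).deg x.2 + n → γ x = 0 := by
    intro n
    induction n with
    | zero => intro x hx; have := hM x; omega
    | succ n ih =>
      rintro ⟨i, β⟩ hx
      by_cases hx' : M < (C i).deg β + n
      · exact ih _ hx'
      simp only at hx
      set D := (C i).deg β with hD
      have hMD : M = D + n := by omega
      have h2 : 2 ≤ D := (C i).two_le β
      set t := tform C α with ht
      set H : MvPolynomial (Σ i, σ i) ℂ :=
        ∑ x : Σ i, (C i).B, γ x • (rename (blk σ x.1) ((C x.1).b x.2) * t ^ (D - (C x.1).deg x.2))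
          + lin l * t ^ (D - 1) - f * t ^ (D - 2) with hH
      have htp : ∀ k, (t ^ k).IsHomogeneous k := fun k => by
        simpa using (tform_homog C α).pow k
      have hHh : H.IsHomogeneous D := by
        refine IsHomogeneous.sub (IsHomogeneous.add (IsHomogeneous.sum _ _ _ fun x _ => ?_) ?_) ?_
        · by_cases hγ : γ x = 0
          · rw [hγ, zero_smul]; exact isHomogeneous_zero _ _ _
          · have hle : (C x.1).deg x.2 ≤ D := by
              by_contra hcon
              exact hγ (ih x (by omega))
            rw [smul_eq_C_mul]
            have := (isHomogeneous_C (Σ i, σ i) (γ x)).mul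
              ((((C x.1).hom x.2).rename_isHomogeneous (f := blk σ x.1)).mul (htp (D - (C x.1).deg x.2)))
            exact hcast this (by omega)
        · exact hcast ((lin_isHomogeneous l).mul (htp (D - 1))) (by omega)
        · exact hcast (hf.mul (htp (D - 2))) (by omega)
      have hHv : ∀ j, eval (p j) t = 1 → eval (p j) H = 0 := by
        intro j hj
        simp only [hH, map_sub, map_add, map_sum, smul_eval, map_mul, map_pow, hj, one_pow, mul_one]
        rw [h j hj, sub_self]
      have hperp := perp_u_mul C hdec hnorm hHh hHv i
      have hpf' := perp_of_tot F hF hf (by omega) hpf i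
      set τ := lin (tauv C α i) with hτ
      have hres : res (blk σ i) H = ∑ β : (C i).B, γ ⟨i, β⟩ • ((C i).b β * τ ^ (D - (C i).deg β))
          + res (blk σ i) (lin l) * τ ^ (D - 1) - res (blk σ i) f * τ ^ (D - 2) := by
        rw [hH]
        simp only [map_sub, map_add, map_sum, map_smul, map_mul, map_pow, ht, res_tform]
        rw [Fintype.sum_sigma, Finset.sum_eq_single i]
        · simp only [res_rename (blk_inj i)]; rfl
        · intro k _ hk
          refine Finset.sum_eq_zero fun β _ => ?_
          rw [res_blk_ne_homog hk ((C k).hom β) (by have := (C k).two_le β; omega)]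
          simp
        · simp
      have hk : ∀ β : (C i).B, ∃ k, γ ⟨i, β⟩ • ((C i).b β * τ ^ (D - (C i).deg β)) =
          (if (C i).deg β = D then γ ⟨i, β⟩ • (C i).b β else 0) + τ * k := by
        intro β
        rcases lt_trichotomy ((C i).deg β) D with hlt | heq | hgt
        · rw [if_neg hlt.ne]
          refine ⟨γ ⟨i, β⟩ • ((C i).b β * τ ^ (D - (C i).deg β - 1)), ?_⟩
          obtain ⟨e, he⟩ : ∃ e, D - (C i).deg β = e + 1 := ⟨D - (C i).deg β - 1, by omega⟩
          rw [he, Nat.add_sub_cancel, pow_succ, zero_add, mul_smul_comm]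
          congr 1; ring
        · rw [if_pos heq]
          exact ⟨0, by rw [heq]; simp⟩
        · rw [if_neg hgt.ne', ih ⟨i, β⟩ (by simp only; omega)]
          exact ⟨0, by simp⟩
      choose k hk using hk
      have := (C i).indep (α i) (hα i) D (fun β => γ ⟨i, β⟩)
        (res (blk σ i) H + res (blk σ i) f * τ ^ (D - 2))
        (-(∑ β, k β) - res (blk σ i) (lin l) * τ ^ (D - 2)) ?_ ?_ β rfl
      · exact this
      · have e1 : τ ^ (D - 1) = τ * τ ^ (D - 2) := by rw [← pow_succ']; congr 1; omega
        have e2 : lin (∑ j, α i j • (C i).u j) = τ := rfl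
        rw [hres, Finset.sum_congr rfl (fun β _ => hk β), Finset.sum_add_distrib, ← Finset.mul_sum,
          e1, e2]
        ring
      · intro j
        rw [mul_add]
        refine (hperp j).add ?_
        have := (hpf'.mul_left (lin ((C i).u j))).mul_right (τ ^ (D - 2))
        rwa [mul_assoc] at this
  ext x
  exact claim (M + 1) x (by omega)

include hdec hnorm in
lemma lin_zero_of_vanish (l : (Σ i, σ i) → ℂ)
    (h : ∀ j, eval (p j) (tform C α) = 1 → eval (p j) (lin l) = 0) : l = 0 := by
  ext ⟨i, x⟩
  have := (C i).K1 (l ∘ blk σ i) (fun u => by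
    rw [← res_lin (blk_inj i)]
    exact perp_u_mul C hdec hnorm (lin_isHomogeneous l) h i u)
  exact congrFun this x

/-- evaluation map -/
def PhiMap (X' : Set J) (p : J → (Σ i, σ i) → ℂ) :
    (((Σ i, (C i).B) → ℂ) × ((Σ i, σ i) → ℂ)) →ₗ[ℂ] (X' → ℂ) where
  toFun z j := ∑ x : Σ i, (C i).B, z.1 x * eval (p j) (rename (blk σ x.1) ((C x.1).b x.2))
    + eval (p j) (lin z.2)
  map_add' y z := by
    ext j
    simp only [Prod.fst_add, Prod.snd_add, Pi.add_apply, add_mul, Finset.sum_add_distrib, lin_add,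
      map_add]
    ring
  map_smul' r z := by
    ext j
    simp only [Prod.smul_fst, Prod.smul_snd, Pi.smul_apply, smul_eq_mul, lin_smul, smul_eval,
      RingHom.id_apply, mul_add, Finset.mul_sum, mul_assoc]

include hd hF hdec hα hnorm in
lemma phi_inj : Function.Injective (PhiMap C {j | eval (p j) (tform C α) = 1} p) := by
  rw [← LinearMap.ker_eq_bot, LinearMap.ker_eq_bot']
  rintro ⟨γ, l⟩ h
  have h' : ∀ j, eval (p j) (tform C α) = 1 →
      ∑ x : Σ i, (C i).B, γ x * eval (p j) (rename (blk σ x.1) ((C x.1).b x.2)) + eval (p j) (lin l)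
        = 0 := fun j hj => congrFun h ⟨j, hj⟩
  have hγ := lemmaA hd hF C hdec hα hnorm γ l (isHomogeneous_zero _ _ _) Perp.zero
    (by simpa using h')
  have hl := lin_zero_of_vanish C hdec hnorm l (fun j hj => by simpa [hγ] using h' j hj)
  rw [hγ, hl]; rfl

include hd hF hdec hα hnorm in
lemma all_norm (hJ : Fintype.card J ≤ Rtot C) :
    Fintype.card J = Rtot C ∧ (∀ j, eval (p j) (tform C α) = 1) ∧
    Function.Surjective (PhiMap C {j | eval (p j) (tform C α) = 1} p) := by
  classical
  have hinj := phi_inj hd hF C hdec hα hnorm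
  have h1 := LinearMap.finrank_le_finrank_of_injective hinj
  have h2 : Module.finrank ℂ (((Σ i, (C i).B) → ℂ) × ((Σ i, σ i) → ℂ)) = Rtot C := by
    rw [Module.finrank_prod, Module.finrank_fintype_fun_eq_card, Module.finrank_fintype_fun_eq_card,
      Fintype.card_sigma, Fintype.card_sigma, Rtot, Finset.sum_add_distrib, add_comm]
  rw [h2, Module.finrank_fintype_fun_eq_card] at h1
  have h3 := Fintype.card_subtype_le (fun j => eval (p j) (tform C α) = 1)
  have h4 : Fintype.card {j | eval (p j) (tform C α) = 1} ≤ Fintype.card J := h3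
  refine ⟨by omega, ?_, ?_⟩
  · intro j
    by_contra hj
    have := Fintype.card_subtype_lt (p := fun j => eval (p j) (tform C α) = 1) hj
    have h5 : Fintype.card {j | eval (p j) (tform C α) = 1} < Fintype.card J := this
    omega
  · refine (LinearMap.injective_iff_surjective_of_finrank_eq_finrank ?_).1 hinj
    rw [h2, Module.finrank_fintype_fun_eq_card]
    omega

end norm
end core

section core2
variable {I : Type} [Fintype I] [DecidableEq I] {σ : I → Type} [∀ i, Fintype (σ i)]
variable {F : ∀ i, MvPolynomial (σ i) ℂ} {d : ℕ} (hd : 3 ≤ d) (hF : ∀ i, (F i).IsHomogeneous d)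
  (C : ∀ i, Cert d (F i))

/-- functions given by linear forms supported on Lam -/
def WLin {J : Type} (p : J → (Σ i, σ i) → ℂ) : Submodule ℂ (J → ℂ) where
  carrier := {g | ∃ l : (Σ i, σ i) → ℂ, (∀ x, x.2 ∉ (C x.1).Lam → l x = 0) ∧
    ∀ j, g j = eval (p j) (lin l)}
  add_mem' := by
    rintro a b ⟨l, hl, ha⟩ ⟨m, hm, hb⟩
    exact ⟨l + m, fun x hx => by simp [hl x hx, hm x hx], fun j => by simp [lin_add, ha, hb]⟩
  zero_mem' := ⟨0, by simp, by simp [lin_zero]⟩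
  smul_mem' := by
    rintro r a ⟨l, hl, ha⟩
    exact ⟨r • l, fun x hx => by simp [hl x hx], fun j => by simp [lin_smul, smul_eval, ha]⟩

section norm
variable {J : Type} [Fintype J] {c : J → ℂ} {p : J → (Σ i, σ i) → ℂ}
  (hdec : tot F = ∑ j, c j • lin (p j) ^ d)
  {α : ∀ i, (C i).U → ℂ} (hα : ∀ i j, α i j ≠ 0)
  (hone : ∀ j, eval (p j) (tform C α) = 1)
  (hsurj : Function.Surjective (PhiMap C {j | eval (p j) (tform C α) = 1} p))

include hd hF hdec hα hone hsurj in
lemma key_mem {f : MvPolynomial (Σ i, σ i) ℂ}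
    (hf : f.IsHomogeneous 2) (hpf : Perp (tot F) f) :
    (fun j => eval (p j) f) ∈ WLin C p := by
  obtain ⟨⟨γ, l⟩, h⟩ := hsurj (fun j => eval (p j) f)
  have h' : ∀ j, eval (p j) (tform C α) = 1 →
      ∑ x : Σ i, (C i).B, γ x * eval (p j) (rename (blk σ x.1) ((C x.1).b x.2)) + eval (p j) (lin l)
        = eval (p j) f := fun j hj => congrFun h ⟨j, hj⟩
  have hγ := lemmaA hd hF C hdec hα (fun j => Or.inl (hone j)) γ l hf hpf h'
  have h2 : ∀ j, eval (p j) f = eval (p j) (lin l) := fun j => by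
    rw [← h' j (hone j)]; simp [hγ]
  refine ⟨l, ?_, h2⟩
  have htl := (tform_homog C α).mul (lin_isHomogeneous l)
  have h3 : Perp (tot F) (f - tform C α * lin l) := by
    refine perp_of_vanish hdec (hf.sub htl) ?_
    intro j
    rw [map_sub, map_mul, hone, h2]; ring
  have h4 : Perp (tot F) (tform C α * lin l) := by
    have := hpf.sub h3
    rwa [sub_sub_cancel] at this
  rintro ⟨i, x⟩ hx
  have h5 := perp_of_tot F hF htl (by omega) h4 i
  rw [map_mul, res_tform, res_lin (blk_inj i)] at h5
  exact (C i).R1 (α i) (hα i) _ h5 x hx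

lemma perp_cross {x y : Σ i, σ i} (hxy : x.1 ≠ y.1) : Perp (tot F) (X x * X y) := by
  apply perp_tot_of
  intro i
  rw [map_mul]
  by_cases h : x.1 = i
  · have : res (blk σ i) (X y) = 0 := by
      obtain ⟨k, y⟩ := y
      exact res_X_of_notMem (blk_ne (fun h' => hxy (h.trans h'.symm)) y)
    rw [this, mul_zero]; exact Perp.zero
  · have : res (blk σ i) (X x) = 0 := by
      obtain ⟨k, x⟩ := x
      exact res_X_of_notMem (blk_ne h x)
    rw [this, zero_mul]; exact Perp.zero

lemma perp_lam {x y : Σ i, σ i} (hx : x.2 ∈ (C x.1).Lam) (hy : y.2 ∈ (C y.1).Lam) (hxy : x ≠ y) :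
    Perp (tot F) (X x * X y) := by
  by_cases h : x.1 = y.1
  · obtain ⟨i, x⟩ := x
    obtain ⟨k, y⟩ := y
    obtain rfl : i = k := h
    apply perp_tot_of
    intro k
    rw [map_mul]
    by_cases hk : i = k
    · subst hk
      rw [show X (⟨i, x⟩ : Σ i, σ i) = (X (blk σ i x) : MvPolynomial _ ℂ) from rfl, res_X (blk_inj i),
        show X (⟨i, y⟩ : Σ i, σ i) = (X (blk σ i y) : MvPolynomial _ ℂ) from rfl, res_X (blk_inj i)]
      exact (C i).R2 x hx y hy (fun h => hxy (by rw [h]))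
    · rw [res_X_of_notMem (blk_ne hk x), zero_mul]; exact Perp.zero
  · exact perp_cross h

lemma XX_homog {σ : Type*} (x y : σ) : (X x * X y : MvPolynomial σ ℂ).IsHomogeneous 2 :=
  (isHomogeneous_X ℂ x).mul (isHomogeneous_X ℂ y)

include hd hF hdec hα hone hsurj in
lemma mem_cross {x y : Σ i, σ i} (hxy : x.1 ≠ y.1) : (fun j => p j x * p j y) ∈ WLin C p := by
  have := key_mem hd hF C hdec hα hone hsurj (XX_homog x y) (perp_cross hxy)
  simpa using this

include hone in
lemma mem_coord {x : Σ i, σ i} (hx : x.2 ∈ (C x.1).Lam) : (fun j => p j x) ∈ WLin C p := by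
  classical
  refine ⟨Pi.single x 1, ?_, fun j => by rw [lin_single, eval_X]⟩
  intro y hy
  rw [Pi.single_apply, if_neg]
  rintro rfl; exact hy hx

include hd hF hdec hα hone hsurj in
lemma mem_lam {x y : Σ i, σ i} (hx : x.2 ∈ (C x.1).Lam) (hy : y.2 ∈ (C y.1).Lam) :
    (fun j => p j x * p j y) ∈ WLin C p := by
  classical
  by_cases hxy : x = y
  · subst hxy
    set τ : (Σ i, σ i) → ℂ := fun x => tauv C α x.1 x.2 with hτ
    have hsum : ∀ j, ∑ y, τ y * p j y = 1 := fun j => by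
      rw [← hone j, tform_eq_lin, eval_lin]
    have e : (fun j => p j x) = τ x • (fun j => p j x * p j x) +
        ∑ y ∈ Finset.univ.erase x, τ y • (fun j => p j x * p j y) := by
      ext j
      simp only [Pi.add_apply, Pi.smul_apply, Finset.sum_apply, smul_eq_mul]
      rw [Finset.add_sum_erase _ (fun y => τ y * (p j x * p j y)) (Finset.mem_univ x)]
      have : ∑ y, τ y * (p j x * p j y) = p j x * ∑ y, τ y * p j y := by
        rw [Finset.mul_sum]; exact Finset.sum_congr rfl fun y _ => by ring
      rw [this, hsum, mul_one]
    have h1 : ∑ y ∈ Finset.univ.erase x, τ y • (fun j => p j x * p j y) ∈ WLin C p := by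
      refine Submodule.sum_mem _ fun y hy => ?_
      have hne := Finset.ne_of_mem_erase hy
      by_cases hb : x.1 = y.1
      · by_cases hyl : y.2 ∈ (C y.1).Lam
        · refine Submodule.smul_mem _ _ ?_
          have := key_mem hd hF C hdec hα hone hsurj (XX_homog x y) (perp_lam C hx hyl hne.symm)
          simpa using this
        · have : τ y = 0 := by
            obtain ⟨i, x⟩ := x
            obtain ⟨k, y⟩ := y
            obtain rfl : i = k := hb
            by_contra hcon
            exact hyl (((C i).R3 (α i) (hα i) x hx y).1 hcon)
          rw [this, zero_smul]; exact Submodule.zero_mem _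
      · exact Submodule.smul_mem _ _ (mem_cross hd hF C hdec hα hone hsurj hb)
    have hτx : τ x ≠ 0 := ((C x.1).R3 (α x.1) (hα x.1) x.2 hx x.2).2 hx
    have h2 : τ x • (fun j => p j x * p j x) ∈ WLin C p := by
      have := Submodule.sub_mem _ (mem_coord C hone hx) h1
      rw [e] at this
      simpa using this
    have := Submodule.smul_mem _ (τ x)⁻¹ h2
    rwa [smul_smul, inv_mul_cancel₀ hτx, one_smul] at this
  · have := key_mem hd hF C hdec hα hone hsurj (XX_homog x y) (perp_lam C hx hy hxy)
    simpa using this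

include hd hF hdec hα hone hsurj in
lemma mul_mem_W {x : Σ i, σ i} (hx : x.2 ∈ (C x.1).Lam) {g : J → ℂ} (hg : g ∈ WLin C p) (r : ℂ) :
    (fun j => (p j x - r) * g j) ∈ WLin C p := by
  obtain ⟨l, hl, hgl⟩ := hg
  have e : (fun j => (p j x - r) * g j) =
      ∑ y, l y • (fun j => p j x * p j y) - r • g := by
    ext j
    simp only [Pi.sub_apply, Pi.smul_apply, Finset.sum_apply, smul_eq_mul]
    rw [sub_mul]
    congr 1
    rw [hgl, eval_lin, Finset.mul_sum]
    exact Finset.sum_congr rfl fun y _ => by ring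
  rw [e]
  refine Submodule.sub_mem _ (Submodule.sum_mem _ fun y _ => ?_)
    (Submodule.smul_mem _ _ ⟨l, hl, hgl⟩)
  by_cases hy : y.2 ∈ (C y.1).Lam
  · exact Submodule.smul_mem _ _ (mem_lam hd hF C hdec hα hone hsurj hx hy)
  · rw [hl y hy, zero_smul]; exact Submodule.zero_mem _

lemma W_const {g : J → ℂ} (hg : g ∈ WLin C p) {j j' : J}
    (h : ∀ x : Σ i, σ i, x.2 ∈ (C x.1).Lam → p j x = p j' x) : g j = g j' := by
  obtain ⟨l, hl, hgl⟩ := hg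
  rw [hgl, hgl, eval_lin, eval_lin]
  refine Finset.sum_congr rfl fun x _ => ?_
  by_cases hx : x.2 ∈ (C x.1).Lam
  · rw [h x hx]
  · rw [hl x hx, zero_mul, zero_mul]

include hd hF hdec hα hone hsurj in
lemma exists_indicator (j₀ : J) {l : Σ i, σ i} (hl : l.2 ∈ (C l.1).Lam) (hne : p j₀ l ≠ 0) :
    ∃ g ∈ WLin C p, g j₀ = 1 ∧
      ∀ j, ¬ (∀ x : Σ i, σ i, x.2 ∈ (C x.1).Lam → p j x = p j₀ x) → g j = 0 := by
  classical
  have : ∀ s : Finset J, ∃ g ∈ WLin C p, g j₀ = 1 ∧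
      ∀ j ∈ s, ¬ (∀ x : Σ i, σ i, x.2 ∈ (C x.1).Lam → p j x = p j₀ x) → g j = 0 := by
    intro s
    induction s using Finset.induction with
    | empty =>
      exact ⟨_, Submodule.smul_mem _ (p j₀ l)⁻¹ (mem_coord C hone hl), by simp [hne], by simp⟩
    | insert a s ha ih =>
      obtain ⟨g, hg, h1, h2⟩ := ih
      by_cases hh : ∀ x : Σ i, σ i, x.2 ∈ (C x.1).Lam → p a x = p j₀ x
      · refine ⟨g, hg, h1, fun j hj hj' => ?_⟩
        rcases Finset.mem_insert.1 hj with rfl | hj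
        · exact absurd hh hj'
        · exact h2 j hj hj'
      · have hh' := hh
        push Not at hh'
        obtain ⟨x, hx, hxa⟩ := hh'
        have hne' : p j₀ x - p a x ≠ 0 := sub_ne_zero.2 (Ne.symm hxa)
        refine ⟨_, Submodule.smul_mem _ (p j₀ x - p a x)⁻¹
          (mul_mem_W hd hF C hdec hα hone hsurj hx hg (p a x)), ?_, ?_⟩
        · simp [h1, hne']
        · intro j hj hj'
          rcases Finset.mem_insert.1 hj with rfl | hj
          · simp
          · simp [h2 j hj hj']
  obtain ⟨g, hg, h1, h2⟩ := this Finset.univ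
  exact ⟨g, hg, h1, fun j => h2 j (Finset.mem_univ j)⟩

include hd hF hdec hα hone hsurj in
lemma one_block (j₀ : J) (x y : Σ i, σ i) (hxy : x.1 ≠ y.1) (hx : p j₀ x ≠ 0) : p j₀ y = 0 := by
  classical
  by_contra hy
  -- some Lam coordinate is nonzero
  obtain ⟨l, hl, hlne⟩ : ∃ l : Σ i, σ i, l.2 ∈ (C l.1).Lam ∧ p j₀ l ≠ 0 := by
    obtain ⟨w, hw, hgw⟩ := mem_cross hd hF C hdec hα hone hsurj hxy
    by_contra hcon
    push Not at hcon
    have := hgw j₀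
    simp only [eval_lin] at this
    rw [Finset.sum_eq_zero] at this
    · exact mul_ne_zero hx hy this
    · intro l _
      by_cases h : l.2 ∈ (C l.1).Lam
      · rw [hcon l h, mul_zero]
      · rw [hw l h, zero_mul]
  obtain ⟨z, hz, hzne⟩ : ∃ z : Σ i, σ i, z.1 ≠ l.1 ∧ p j₀ z ≠ 0 := by
    by_cases h : x.1 = l.1
    · exact ⟨y, fun h' => hxy (h.trans h'.symm), hy⟩
    · exact ⟨x, h, hx⟩
  set S : J → Prop := fun j => ∀ x : Σ i, σ i, x.2 ∈ (C x.1).Lam → p j x = p j₀ x with hS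
  have hother : ∀ j, S j → ∀ w : Σ i, σ i, w.1 ≠ l.1 → p j w = p j₀ w := by
    intro j hj w hw
    have := W_const C (mem_cross hd hF C hdec hα hone hsurj hw) hj
    simp only [hj l hl] at this
    exact mul_right_cancel₀ hlne this
  have hsingle : ∀ j, S j → p j = p j₀ := by
    intro j hj
    ext w
    by_cases hw : w.1 = l.1
    · have := W_const C (mem_cross hd hF C hdec hα hone hsurj (x := w) (y := z)
        (fun h => hz (h.symm.trans hw))) hj
      simp only [hother j hj z hz] at this
      exact mul_right_cancel₀ hzne this
    · exact hother j hj w hw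
  obtain ⟨g, ⟨ε, hε, hgε⟩, hg1, hg0⟩ := exists_indicator hd hF C hdec hα hone hsurj j₀ hl hlne
  have hcomp : ∀ q : MvPolynomial (Σ i, σ i) ℂ, q.IsHomogeneous (d - 1) →
      pair (tot F) (lin ε * q) = (∑ j, if S j then c j else 0) * (d.factorial * eval (p j₀) q) := by
    intro q hq
    have hh : (lin ε * q).IsHomogeneous d := hcast ((lin_isHomogeneous ε).mul hq) (by omega)
    rw [hdec, pair_decomp c p hh, Finset.sum_mul]
    refine Finset.sum_congr rfl fun j _ => ?_
    rw [map_mul, ← hgε]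
    split_ifs with h
    · have : g j = 1 := by rw [← hg1]; exact W_const C ⟨ε, hε, hgε⟩ h
      rw [this, hsingle j h]; ring
    · rw [hg0 j h]; ring
  have hzero : (∑ j, if S j then c j else 0) = 0 := by
    have hq : (X z * X l * tform C α ^ (d - 3)).IsHomogeneous (d - 1) :=
      hcast ((XX_homog z l).mul ((tform_homog C α).pow (d - 3))) (by omega)
    have h1 := hcomp _ hq
    have h2 : pair (tot F) (lin ε * (X z * X l * tform C α ^ (d - 3))) = 0 := by
      have := perp_cross (F := F) hz (tform C α ^ (d - 3) * lin ε)
      rw [← this]; congr 1; ring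
    rw [h2] at h1
    simp only [map_mul, map_pow, hone, one_pow, mul_one, eval_X] at h1
    refine (mul_eq_zero.1 h1.symm).resolve_right ?_
    refine mul_ne_zero (by exact_mod_cast Nat.factorial_ne_zero d) (mul_ne_zero hzne hlne)
  have hperp : Perp (tot F) (lin ε) := by
    have hFh : (tot F).IsHomogeneous d := by rw [hdec]; exact decomp_homog c p
    refine perp_of_homog hFh (lin_isHomogeneous ε) fun q k hq hk => ?_
    rw [hcomp q (hcast hq (by omega)), hzero, zero_mul]
  have hε0 : ε = 0 := by
    ext ⟨i, x⟩
    have := (C i).K1 (ε ∘ blk σ i) (fun u => by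
      rw [← res_lin (blk_inj i)]
      exact (perp_of_tot F hF (lin_isHomogeneous ε) (by omega) hperp i).mul_left _)
    exact congrFun this x
  have := hgε j₀
  rw [hg1, hε0, lin_zero, map_zero] at this
  exact one_ne_zero this

end norm

include hd hF in
theorem core_thm {J : Type} [Fintype J] {c : J → ℂ} {p : J → (Σ i, σ i) → ℂ}
    (hdec : tot F = ∑ j, c j • lin (p j) ^ d) (hJ : Fintype.card J ≤ Rtot C) :
    Fintype.card J = Rtot C ∧ ∀ j, ∃ i, (∃ x : σ i, p j ⟨i, x⟩ ≠ 0) ∧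
      ∀ x : Σ i, σ i, x.1 ≠ i → p j x = 0 := by
  classical
  obtain ⟨α', hα', hgen⟩ := generic_vec (A := Σ i, (C i).U) (κ := J)
    (fun j x => eval (p j) (rename (blk σ x.1) (lin ((C x.1).u x.2))))
  set α : ∀ i, (C i).U → ℂ := fun i u => α' ⟨i, u⟩ with hαdef
  have hα : ∀ i j, α i j ≠ 0 := fun i j => hα' _
  have heval : ∀ q, eval q (tform C α) = ∑ x : Σ i, (C i).U, α' x *
      eval q (rename (blk σ x.1) (lin ((C x.1).u x.2))) := by
    intro q
    rw [tform, map_sum, Fintype.sum_sigma]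
    refine Finset.sum_congr rfl fun i _ => ?_
    rw [tauv, lin_sum, map_sum, map_sum]
    refine Finset.sum_congr rfl fun u _ => ?_
    rw [lin_smul, map_smul, smul_eval]
  set t : J → ℂ := fun j => if eval (p j) (tform C α) = 0 then 1 else eval (p j) (tform C α) with ht
  have htne : ∀ j, t j ≠ 0 := fun j => by
    simp only [ht]; split_ifs with h
    · exact one_ne_zero
    · exact h
  have hdec' : tot F = ∑ j, (c j * t j ^ d) • lin ((t j)⁻¹ • p j) ^ d := by
    rw [hdec]
    refine Finset.sum_congr rfl fun j _ => ?_
    rw [lin_smul, smul_pow, smul_smul, mul_assoc, ← mul_pow, mul_inv_cancel₀ (htne j), one_pow, mul_one]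
  have hnorm : ∀ j, eval ((t j)⁻¹ • p j) (tform C α) = 1 ∨
      ∀ i u, eval ((t j)⁻¹ • p j) (rename (blk σ i) (lin ((C i).u u))) = 0 := by
    intro j
    by_cases h : eval (p j) (tform C α) = 0
    · right
      intro i u
      have h1 : t j = 1 := by simp [ht, h]
      rw [h1, inv_one, one_smul]
      by_contra hcon
      have := hgen j (fun h0 => hcon (congrFun h0 ⟨i, u⟩))
      exact this (by rw [← heval]; exact h)
    · left
      have h1 : t j = eval (p j) (tform C α) := by simp [ht, h]
      rw [eval_smul_homog (tform_homog C α), pow_one, h1, inv_mul_cancel₀ h]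
  obtain ⟨h1, h2, h3⟩ := all_norm hd hF C hdec' hα hnorm hJ
  refine ⟨h1, fun j => ?_⟩
  have hb := one_block hd hF C hdec' hα h2 h3 j
  have hne : ∃ x, p j x ≠ 0 := by
    by_contra hcon
    push Not at hcon
    have : p j = 0 := funext hcon
    have h := h2 j
    rw [this, smul_zero, tform_eq_lin, eval_lin] at h
    simp at h
  obtain ⟨⟨i, x⟩, hx⟩ := hne
  refine ⟨i, ⟨x, hx⟩, fun y hy => ?_⟩
  have := hb ⟨i, x⟩ y hy.symm (by simp [htne j, hx])
  simpa [htne j] using this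

include hd hF C in
theorem main_of_cert (a : (Σ i, σ i) → ℂ) :
    InWaringLocus d (tot F) a ↔ ∃ i, (∀ x : Σ i, σ i, x.1 ≠ i → a x = 0) ∧
      InWaringLocus d (rename (blk σ i) (F i)) a := by
  classical
  set rk : I → ℕ := fun i => waringRank d (rename (blk σ i) (F i)) with hrk
  have hup : ∀ i, HasWaringDecomp d (rename (blk σ i) (F i))
      (Fintype.card (σ i) + Fintype.card (C i).B) := by
    intro i
    obtain ⟨L, hL⟩ := (C i).upper
    refine ⟨fun j x => if h : x.1 = i then L j (h ▸ x.2) else 0, ?_⟩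
    refine (congrArg (rename (blk σ i)) hL).trans ?_
    rw [map_sum]
    refine Finset.sum_congr rfl fun j _ => ?_
    rw [map_pow]
    congr 1
    refine rename_lin _ _ (fun j => by simp) (blk_inj i) ?_
    rintro ⟨k, x⟩ hx
    have : k ≠ i := by rintro rfl; exact hx x rfl
    simp [this]
  have hmin : ∀ i, HasWaringDecomp d (rename (blk σ i) (F i)) (rk i) := fun i =>
    Nat.sInf_mem (s := {r | HasWaringDecomp d (rename (blk σ i) (F i)) r}) ⟨_, hup i⟩
  have hle : ∀ i, rk i ≤ Fintype.card (σ i) + Fintype.card (C i).B := fun i => Nat.sInf_le (hup i)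
  choose L hL using hmin
  have htotdec : tot F = ∑ x : Σ i, Fin (rk i), (1:ℂ) • lin (L x.1 x.2) ^ d := by
    rw [Fintype.sum_sigma, tot]
    refine Finset.sum_congr rfl fun i _ => ?_
    rw [hL]; simp
  have hW : HasWaringDecomp d (tot F) (∑ i, rk i) := by
    have := absorb (by omega) _ _ htotdec
    rwa [Fintype.card_sigma, Finset.sum_congr rfl (fun i _ => Fintype.card_fin _)] at this
  set rF := waringRank d (tot F) with hrF
  have h1 : rF ≤ ∑ i, rk i := Nat.sInf_le hW
  have h2 : ∑ i, rk i ≤ Rtot C := Finset.sum_le_sum fun i _ => hle i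
  have hWmin : HasWaringDecomp d (tot F) rF :=
    Nat.sInf_mem (s := {r | HasWaringDecomp d (tot F) r}) ⟨_, hW⟩
  have h3 : rF = Rtot C := by
    obtain ⟨L', hL'⟩ := hWmin
    have := core_thm hd hF C (J := Fin rF) (c := fun _ => 1) (p := L') (by simpa using hL')
      (by rw [Fintype.card_fin]; omega)
    rw [← this.1, Fintype.card_fin]
  have hsum : rF = ∑ i, rk i := by omega
  constructor
  · rintro ⟨c, L, j₀, hj₀, hdec⟩
    obtain ⟨-, hb⟩ := core_thm hd hF C (J := Fin rF) hdec (by rw [Fintype.card_fin]; omega)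
    choose β hβ1 hβ2 using hb
    have hpart : ∀ i, rename (blk σ i) (F i) =
        ∑ j : {j : Fin rF // β j = i}, c j • lin (L j) ^ d := by
      intro i
      have e := congrArg (fun f => rename (blk σ i) (res (blk σ i) f)) hdec
      simp only [map_sum, map_smul, map_pow, tot] at e
      rw [Finset.sum_eq_single i, res_rename (blk_inj i)] at e
      · rw [e]
        have h0 : ∀ j, β j ≠ i → rename (blk σ i) (res (blk σ i) (lin (L j))) = 0 := by
          intro j hj
          rw [res_lin (blk_inj i)]
          have : L j ∘ blk σ i = 0 := by
            ext x
            exact hβ2 j ⟨i, x⟩ (Ne.symm hj)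
          rw [this, lin_zero, map_zero]
        have h1' : ∀ j, β j = i → rename (blk σ i) (res (blk σ i) (lin (L j))) = lin (L j) := by
          intro j hj
          rw [res_lin (blk_inj i)]
          refine rename_lin _ _ (fun _ => rfl) (blk_inj i) ?_
          rintro ⟨k, x⟩ hx
          refine hβ2 j _ ?_
          rw [hj]
          rintro rfl
          exact hx x rfl
        rw [← Finset.sum_subtype (Finset.univ.filter fun j => β j = i) (by simp)
          (fun j => c j • lin (L j) ^ d), Finset.sum_filter]
        refine Finset.sum_congr rfl fun j _ => ?_
        split_ifs with h
        · rw [h1' j h]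
        · rw [h0 j h, zero_pow (by omega), smul_zero]
      · intro k _ hk
        rw [res_blk_ne_homog hk (hF k) (by omega), map_zero]
      · simp
    have hcount : ∀ i, rk i ≤ Fintype.card {j : Fin rF // β j = i} := fun i =>
      Nat.sInf_le (absorb (by omega) _ _ (hpart i))
    have hcs : ∑ i, Fintype.card {j : Fin rF // β j = i} = ∑ i, rk i := by
      rw [← hsum, ← Fintype.card_sigma, Fintype.card_congr (Equiv.sigmaFiberEquiv β), Fintype.card_fin]
    have hceq : ∀ i, rk i = Fintype.card {j : Fin rF // β j = i} := fun i =>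
      (Finset.sum_eq_sum_iff_of_le (fun i _ => hcount i)).1 hcs.symm i (Finset.mem_univ i)
    refine ⟨β j₀, fun x hx => by rw [← hj₀]; exact hβ2 j₀ x hx, ?_⟩
    let e : Fin (rk (β j₀)) ≃ {j : Fin rF // β j = β j₀} :=
      (Fintype.equivFinOfCardEq (hceq (β j₀)).symm).symm
    refine ⟨fun j => c (e j), fun j => L (e j), e.symm ⟨j₀, rfl⟩, by simp [hj₀], ?_⟩
    refine (hpart _).trans ?_
    exact (e.sum_comp (fun j : {j : Fin rF // β j = β j₀} => c j • lin (L j) ^ d)).symm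
  · rintro ⟨i, hi, c, M, j₀, hj₀, hdec⟩
    have hc : Fintype.card (Σ i, Fin (rk i)) = rF := by
      rw [Fintype.card_sigma, Finset.sum_congr rfl (fun i _ => Fintype.card_fin _), hsum]
    let e : Fin rF ≃ Σ i, Fin (rk i) := (Fintype.equivFinOfCardEq hc).symm
    let c' : (Σ i, Fin (rk i)) → ℂ := fun x => if h : x.1 = i then c (h ▸ x.2) else 1
    let M' : (Σ i, Fin (rk i)) → (Σ i, σ i) → ℂ := fun x =>
      if h : x.1 = i then M (h ▸ x.2) else L x.1 x.2
    refine ⟨fun j => c' (e j), fun j => M' (e j), e.symm ⟨i, j₀⟩, by simp [M', hj₀], ?_⟩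
    rw [e.sum_comp (fun x => c' x • lin (M' x) ^ d), Fintype.sum_sigma, tot]
    refine Finset.sum_congr rfl fun k _ => ?_
    by_cases hk : k = i
    · subst hk
      refine hdec.trans (Finset.sum_congr rfl fun j _ => ?_)
      simp [c', M']
    · rw [hL k]
      simp [c', M', hk]
end core2

lemma HasWaringDecomp.rename' {σ τ : Type*} [Fintype σ] [Fintype τ] {d r : ℕ} {F : MvPolynomial τ ℂ}
    (h : HasWaringDecomp d F r) {ι : τ → σ} (hι : Function.Injective ι) :
    HasWaringDecomp d (rename ι F) r := by
  classical
  obtain ⟨L, rfl⟩ := h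
  refine ⟨fun j x => if h : ∃ k, ι k = x then L j h.choose else 0, ?_⟩
  rw [map_sum]
  refine Finset.sum_congr rfl fun j _ => ?_
  rw [map_pow]
  congr 1
  refine rename_lin _ _ (fun k => ?_) hι ?_
  · have h : ∃ k', ι k' = ι k := ⟨k, rfl⟩
    simp only
    rw [dif_pos h, hι h.choose_spec]
  · intro x hx
    simp only
    rw [dif_neg]; push Not; exact hx

lemma HasWaringDecomp.sum' {σ : Type*} [Fintype σ] {κ : Type*} [Fintype κ] {d : ℕ} (hd : 1 ≤ d)
    {r : κ → ℕ} {F : κ → MvPolynomial σ ℂ} (h : ∀ k, HasWaringDecomp d (F k) (r k)) :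
    HasWaringDecomp d (∑ k, F k) (∑ k, r k) := by
  choose L hL using h
  have : ∑ k, F k = ∑ x : Σ k, Fin (r k), (1:ℂ) • lin (L x.1 x.2) ^ d := by
    rw [Fintype.sum_sigma]
    exact Finset.sum_congr rfl fun k _ => by rw [hL k]; simp
  have := absorb hd _ _ this
  rwa [Fintype.card_sigma, Finset.sum_congr rfl (fun i _ => Fintype.card_fin _)] at this

/-- transport of certificates along an equivalence -/
def Cert.transport {σ τ : Type} [Fintype σ] [Fintype τ] {d : ℕ} {F : MvPolynomial σ ℂ}
    (C : Cert d F) (e : σ ≃ τ) : Cert d (rename e F) where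
  B := C.B
  fB := C.fB
  U := C.U
  fU := C.fU
  b β := rename e (C.b β)
  deg := C.deg
  two_le := C.two_le
  hom β := (C.hom β).rename_isHomogeneous
  u j := C.u j ∘ e.symm
  Lam := {x | e.symm x ∈ C.Lam}
  upper := by
    rw [← Fintype.card_congr e]
    exact C.upper.rename' e.injective
  indep := by
    intro α hα D c h k hk hp
    refine C.indep α hα D c (res e h) (res e k) ?_ ?_
    · have := congrArg (res e) hk
      simp only [map_add, map_mul, map_sum, apply_ite (res e), map_smul, map_zero,
        res_rename e.injective, res_lin e.injective] at this
      rw [this]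
      congr 3
      ext x; simp
    · intro j
      have := (perp_rename e.injective F _).1 (hp j)
      rw [map_mul, res_lin e.injective] at this
      convert this using 3
      ext x; simp
  K1 := by
    intro w hw
    have := C.K1 (w ∘ e) (fun j => by
      have := (perp_rename e.injective F _).1 (hw j)
      rw [map_mul, res_lin e.injective, res_lin e.injective] at this
      convert this using 3
      ext x; simp)
    ext x
    simpa using congrFun this (e.symm x)
  R1 := by
    intro α hα w hw x hx
    have := (perp_rename e.injective F _).1 hw
    rw [map_mul, res_lin e.injective, res_lin e.injective] at this
    have h2 := C.R1 α hα (w ∘ e) (by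
      convert this using 3
      ext x; simp) (e.symm x) hx
    simpa using h2
  R2 := by
    intro l hl m hm hlm
    rw [perp_rename e.injective, map_mul]
    have := C.R2 _ hl _ hm (fun h => hlm (e.symm.injective h))
    rw [← res_X e.injective, ← res_X e.injective] at this
    simpa using this
  R3 := by
    intro α hα l hl x
    have := C.R3 α hα _ hl (e.symm x)
    rw [Set.mem_ofPred_eq, ← this]
    simp

/-! binary forms and univariate polynomials -/
section binary
open Polynomial in
/-- dehomogenization -/
def dehom : MvPolynomial (Fin 2) ℂ →ₐ[ℂ] Polynomial ℂ := aeval ![Polynomial.X, 1]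

/-- exponent of a binary monomial -/
def bex (i j : ℕ) : Fin 2 →₀ ℕ := Finsupp.single 0 i + Finsupp.single 1 j

@[simp] lemma bex_zero (i j : ℕ) : bex i j 0 = i := by simp [bex]
@[simp] lemma bex_one (i j : ℕ) : bex i j 1 = j := by simp [bex]
lemma bex_degree (i j : ℕ) : (bex i j).degree = i + j := by
  rw [bex, map_add, Finsupp.degree_single, Finsupp.degree_single]
lemma bex_eta (m : Fin 2 →₀ ℕ) : m = bex (m 0) (m 1) := by
  ext x; fin_cases x <;> simp
lemma bex_monomial (i j : ℕ) : (monomial (bex i j) (1:ℂ)) = X 0 ^ i * X 1 ^ j := by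
  rw [bex, X_pow_eq_monomial, X_pow_eq_monomial, monomial_mul, mul_one]

lemma degree_fin2 (m : Fin 2 →₀ ℕ) : m.degree = m 0 + m 1 := by
  rw [Finsupp.degree_eq_sum]; simp [Fin.sum_univ_two]

lemma dehom_monomial (m : Fin 2 →₀ ℕ) (c : ℂ) :
    dehom (monomial m c) = Polynomial.monomial (m 0) c := by
  rw [dehom, aeval_monomial, Finsupp.prod_fintype _ _ (by simp)]
  simp [Fin.prod_univ_two, Polynomial.C_mul_X_pow_eq_monomial, Polynomial.algebraMap_eq]

lemma dehom_coeff {f : MvPolynomial (Fin 2) ℂ} {d : ℕ} (hf : f.IsHomogeneous d) {i : ℕ}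
    (hi : i ≤ d) : (dehom f).coeff i = coeff (bex i (d - i)) f := by
  conv_lhs => rw [f.as_sum, map_sum, Polynomial.finsetSum_coeff]
  simp only [dehom_monomial, Polynomial.coeff_monomial]
  by_cases h : coeff (bex i (d - i)) f = 0
  · rw [h]
    refine Finset.sum_eq_zero fun m hm => ?_
    split_ifs with h'
    · have h2 := homog_degree hf (mem_support_iff.1 hm)
      rw [degree_fin2] at h2
      have : m = bex i (d - i) := by rw [bex_eta m]; congr 1; omega
      rw [this, h]
    · rfl
  · rw [Finset.sum_eq_single (bex i (d - i))]
    · simp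
    · intro m hm hne
      rw [if_neg]
      intro h'
      apply hne
      have h2 := homog_degree hf (mem_support_iff.1 hm)
      rw [degree_fin2] at h2
      rw [bex_eta m]; congr 1; omega
    · intro h'; exact absurd (notMem_support_iff.1 h') h

lemma dehom_natDegree {f : MvPolynomial (Fin 2) ℂ} {d : ℕ} (hf : f.IsHomogeneous d) :
    (dehom f).natDegree ≤ d := by
  rw [f.as_sum, map_sum]
  refine Polynomial.natDegree_sum_le_of_forall_le _ _ fun m hm => ?_
  rw [dehom_monomial]
  have h2 := homog_degree hf (mem_support_iff.1 hm)
  rw [degree_fin2] at h2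
  exact (Polynomial.natDegree_monomial_le _).trans (by omega)

lemma eval_dehom (f : MvPolynomial (Fin 2) ℂ) (ρ : ℂ) :
    (dehom f).eval ρ = eval ![ρ, 1] f := by
  have : (Polynomial.aeval ρ).comp dehom = aeval (R := ℂ) ![ρ, 1] := by
    ext x; fin_cases x <;> simp [dehom]
  have := congrArg (fun g => g f) this
  simpa [Polynomial.coe_aeval_eq_eval] using this

lemma pair_bex (i j : ℕ) (f : MvPolynomial (Fin 2) ℂ) :
    pair (X 0 ^ i * X 1 ^ j) f = i.factorial * j.factorial * coeff (bex i j) f := by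
  rw [← bex_monomial, monomial_pair, mfac]
  simp [Fin.prod_univ_two]

lemma natDegree_lt_card_roots {P : Polynomial ℂ} (hP : P ≠ 0) (hs : P.Separable) :
    P.roots.toFinset.card = P.natDegree := by
  classical
  rw [Multiset.toFinset_card_of_nodup (Polynomial.nodup_roots hs)]
  exact (Polynomial.splits_iff_card_roots.1 (IsAlgClosed.splits P))

lemma dvd_of_roots {P Q : Polynomial ℂ} (hs : P.Separable)
    (h : ∀ ρ ∈ P.roots, Q.eval ρ = 0) : P ∣ Q := by
  classical
  by_cases hQ : Q = 0
  · rw [hQ]; exact dvd_zero _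
  refine (Polynomial.Splits.dvd_iff_roots_le_roots (IsAlgClosed.splits P) hs.ne_zero hQ).2 ?_
  rw [Multiset.le_iff_subset (Polynomial.nodup_roots hs)]
  intro ρ hρ
  rw [Polynomial.mem_roots hQ]
  exact h ρ hρ

/-- a polynomial family with a separable member -/
lemma exists_separable_add_C (P : Polynomial ℂ) (hP : 0 < P.natDegree) :
    ∃ e : ℂ, (P + Polynomial.C e).Separable := by
  classical
  have hP' : Polynomial.derivative P ≠ 0 := fun h => by
    have := Polynomial.derivative_eq_zero.1 h
    omega
  obtain ⟨e, he⟩ := Infinite.exists_notMem_finset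
    ((Polynomial.derivative P).roots.toFinset.image fun ρ => - P.eval ρ)
  refine ⟨e, ?_⟩
  rw [Polynomial.separable_def]
  rw [Polynomial.derivative_add, Polynomial.derivative_C, add_zero]
  rw [Polynomial.isCoprime_iff_aeval_ne_zero_of_isAlgClosed ℂ ℂ]
  intro ρ
  by_contra hcon
  push Not at hcon
  obtain ⟨hz1, hz2⟩ := hcon
  rw [Polynomial.coe_aeval_eq_eval] at hz1 hz2
  apply he
  rw [Finset.mem_image]
  refine ⟨ρ, ?_, ?_⟩
  · rw [Multiset.mem_toFinset, Polynomial.mem_roots hP']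
    exact hz2
  · have := hz1
    rw [Polynomial.eval_add, Polynomial.eval_C] at this
    linear_combination -this

/-- points from the roots of a separable polynomial -/
lemma binary_waring_of_sep {d : ℕ} (hd : 1 ≤ d) {F : MvPolynomial (Fin 2) ℂ} (hF : F.IsHomogeneous d)
    {P : Polynomial ℂ} (hP : P.Separable) 
    (h : ∀ f : MvPolynomial (Fin 2) ℂ, f.IsHomogeneous d → P ∣ dehom f → pair F f = 0) :
    HasWaringDecomp d F P.natDegree := by
  classical
  have hc := natDegree_lt_card_roots hP.ne_zero hP
  let e : Fin P.natDegree ≃ P.roots.toFinset := (Finset.equivFinOfCardEq hc).symm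
  refine hasWaring_of_span hd hF (fun j => ![(e j : ℂ), 1]) fun f hf hv => h f hf ?_
  refine dvd_of_roots hP fun ρ hρ => ?_
  have := hv (e.symm ⟨ρ, by rwa [Multiset.mem_toFinset]⟩)
  rw [eval_dehom]
  simpa using this

lemma piece_waring {a b : ℕ} (hb : 2 ≤ b) (hab : b ≤ a + 1) {l : ℂ} (hl : l ≠ 0) :
    HasWaringDecomp (a + b) (X 0 ^ a * X 1 ^ b + l • X 0 ^ (a + b) : MvPolynomial (Fin 2) ℂ) (a + 1) := by
  set c : ℂ := l * (a+b).factorial / (a.factorial * b.factorial) with hc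
  have hfa : (a.factorial : ℂ) ≠ 0 := by exact_mod_cast Nat.factorial_ne_zero a
  have hfb : (b.factorial : ℂ) ≠ 0 := by exact_mod_cast Nat.factorial_ne_zero b
  have hfab : ((a+b).factorial : ℂ) ≠ 0 := by exact_mod_cast Nat.factorial_ne_zero _
  have hc0 : c ≠ 0 := by
    rw [hc]; exact div_ne_zero (mul_ne_zero hl hfab) (mul_ne_zero hfa hfb)
  have hcc : (a.factorial : ℂ) * b.factorial * c = l * (a+b).factorial := by
    rw [hc]; field_simp
  obtain ⟨e, he, hsep⟩ : ∃ e : ℂ, (b = a + 1 → e = 0) ∧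
      (Polynomial.X ^ (a+1) - Polynomial.C c * Polynomial.X ^ (a + 1 - b) + Polynomial.C e : Polynomial ℂ).Separable := by
    by_cases h : b = a + 1
    · refine ⟨0, fun _ => rfl, ?_⟩
      subst h
      simp only [Nat.sub_self, pow_zero, mul_one, map_zero, add_zero]
      exact Polynomial.separable_X_pow_sub_C c (by exact_mod_cast Nat.succ_ne_zero a) hc0
    · obtain ⟨e, he⟩ := exists_separable_add_C
        (Polynomial.X ^ (a+1) - Polynomial.C c * Polynomial.X ^ (a + 1 - b) : Polynomial ℂ) (by
          have : (Polynomial.X ^ (a+1) - Polynomial.C c * Polynomial.X ^ (a + 1 - b) : Polynomial ℂ).natDegree = a + 1 := by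
            compute_degree!
            rw [if_neg (by omega)]; simp
          omega)
      exact ⟨e, fun h' => absurd h' h, he⟩
  set P : Polynomial ℂ := Polynomial.X ^ (a+1) - Polynomial.C c * Polynomial.X ^ (a + 1 - b) + Polynomial.C e with hP
  have hdeg : P.natDegree = a + 1 := by
    rw [hP]
    compute_degree!
    rw [if_neg (by omega)]; simp
  have hF : (X 0 ^ a * X 1 ^ b + l • X 0 ^ (a + b) : MvPolynomial (Fin 2) ℂ).IsHomogeneous (a + b) := by
    refine IsHomogeneous.add (IsHomogeneous.mul ?_ ?_) ?_
    · simpa using (isHomogeneous_X ℂ (0 : Fin 2)).pow a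
    · simpa using (isHomogeneous_X ℂ (1 : Fin 2)).pow b
    · rw [smul_eq_C_mul]
      simpa using (isHomogeneous_C (Fin 2) l).mul ((isHomogeneous_X ℂ (0 : Fin 2)).pow (a + b))
  have := binary_waring_of_sep (by omega) hF hsep ?_
  · rwa [hdeg] at this
  intro f hf hdvd
  obtain ⟨Q, hQ⟩ := hdvd
  have h1 : (dehom f).coeff a = coeff (bex a b) f := by
    rw [dehom_coeff hf (by omega)]; congr 2; omega
  have h2 : (dehom f).coeff (a+b) = coeff (bex (a+b) 0) f := by
    rw [dehom_coeff hf (by omega)]; congr 2; omega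
  have hQd : Q.natDegree < b := by
    by_cases hQ0 : Q = 0
    · rw [hQ0]; simp; omega
    have hn := dehom_natDegree hf
    rw [hQ, Polynomial.natDegree_mul hsep.ne_zero hQ0, hdeg] at hn
    omega
  have h3 : (dehom f).coeff a = - c * (Q.coeff (b-1)) := by
    rw [hQ, hP, add_mul, sub_mul, Polynomial.coeff_add, Polynomial.coeff_sub,
      Polynomial.coeff_X_pow_mul', if_neg (by omega), mul_assoc, Polynomial.coeff_C_mul,
      Polynomial.coeff_X_pow_mul', if_pos (by omega), Polynomial.coeff_C_mul]
    have : e * Q.coeff a = 0 := by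
      by_cases h : b = a + 1
      · rw [he h, zero_mul]
      · rw [Polynomial.coeff_eq_zero_of_natDegree_lt (by omega), mul_zero]
    rw [this, show a - (a + 1 - b) = b - 1 by omega]
    ring
  have h4 : (dehom f).coeff (a+b) = Q.coeff (b-1) := by
    rw [hQ, hP, add_mul, sub_mul, Polynomial.coeff_add, Polynomial.coeff_sub,
      Polynomial.coeff_X_pow_mul', if_pos (by omega), mul_assoc, Polynomial.coeff_C_mul,
      Polynomial.coeff_X_pow_mul', if_pos (by omega), Polynomial.coeff_C_mul,
      Polynomial.coeff_eq_zero_of_natDegree_lt (n := a + b - (a + 1 - b)) (by omega),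
      Polynomial.coeff_eq_zero_of_natDegree_lt (n := a + b) (by omega),
      show a + b - (a + 1) = b - 1 by omega]
    ring
  have h5 := pair_bex (a+b) 0 f
  rw [pow_zero, mul_one] at h5
  rw [pair_add, LinearMap.add_apply, pair_smul, LinearMap.smul_apply, pair_bex, h5, ← h1, ← h2, h3, h4]
  simp only [Nat.factorial_zero, smul_eq_mul, Nat.cast_one, mul_one]
  linear_combination -Q.coeff (b - 1) * hcc
end binary

section fam34
variable {n a b : ℕ} {κ : ℂ}

/-- the forms of families (3) and (4) -/
def fam34 (n a b : ℕ) (κ : ℂ) : MvPolynomial (Fin (n+2)) ℂ :=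
  ∑ l : Fin (n+1), X 0 ^ a * X l.succ ^ b + κ • X 0 ^ (a + b)

/-- exponents -/
def ex34 (l : Fin (n+1)) (i j : ℕ) : Fin (n+2) →₀ ℕ :=
  Finsupp.single 0 i + Finsupp.single l.succ j

lemma ex34_zero (l : Fin (n+1)) (i j : ℕ) : ex34 l i j 0 = i := by simp [ex34]
lemma ex34_succ (l m : Fin (n+1)) (i j : ℕ) : ex34 l i j m.succ = if l = m then j else 0 := by
  simp [ex34, Finsupp.single_apply]
lemma ex34_degree (l : Fin (n+1)) (i j : ℕ) : (ex34 l i j).degree = i + j := by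
  simp [ex34, Finsupp.degree_single]
lemma ex34_monomial (l : Fin (n+1)) (i j : ℕ) :
    monomial (ex34 l i j) (1:ℂ) = X 0 ^ i * X l.succ ^ j := by
  rw [ex34, X_pow_eq_monomial, X_pow_eq_monomial, monomial_mul, one_mul]

lemma fam34_pderiv (l : Fin (n+1)) :
    pderiv l.succ (fam34 n a b κ) = (b:ℂ) • monomial (ex34 l a (b-1)) (1:ℂ) := by
  rw [fam34, ex34_monomial, map_add, map_sum, Finset.sum_eq_single l]
  · have h0 : pderiv l.succ (X 0 : MvPolynomial (Fin (n+2)) ℂ) = 0 :=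
      pderiv_X_of_ne (Fin.succ_ne_zero l).symm
    rw [(pderiv l.succ).map_smul, pderiv_pow, h0, pderiv_mul, pderiv_pow, pderiv_pow, h0, pderiv_X_self]
    simp [smul_eq_C_mul]
    ring
  · intro m _ hm
    have h0 : pderiv l.succ (X 0 : MvPolynomial (Fin (n+2)) ℂ) = 0 :=
      pderiv_X_of_ne (Fin.succ_ne_zero l).symm
    have h1 : pderiv l.succ (X m.succ : MvPolynomial (Fin (n+2)) ℂ) = 0 :=
      pderiv_X_of_ne (fun h => hm (Fin.succ_injective _ h))
    rw [pderiv_mul, pderiv_pow, pderiv_pow, h0, h1]; simp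
  · simp

lemma fam34_pair (hb : 2 ≤ b) (l : Fin (n+1)) : ∃ c : ℂ, c ≠ 0 ∧ ∀ g,
    pair (fam34 n a b κ) (X l.succ * g) = c * coeff (ex34 l a (b-1)) g := by
  refine ⟨b * mfac (ex34 l a (b-1)), mul_ne_zero (by norm_cast; omega) (mfac_ne _), fun g => ?_⟩
  rw [pair_X_mul, fam34_pderiv, pair_smul, LinearMap.smul_apply, monomial_pair, smul_eq_mul, mul_assoc]

lemma fam34_perp (hb : 2 ≤ b) (l : Fin (n+1)) {h : MvPolynomial (Fin (n+2)) ℂ}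
    (hp : Perp (fam34 n a b κ) (X l.succ * h)) {i j : ℕ} (hi : i ≤ a) (hj : j ≤ b - 1) :
    coeff (ex34 l i j) h = 0 := by
  obtain ⟨c, hc, H⟩ := fam34_pair (a := a) (κ := κ) hb l
  have h1 := hp (monomial (ex34 l (a-i) (b-1-j)) 1)
  rw [mul_assoc, H] at h1
  have : ex34 l a (b-1) = ex34 l i j + ex34 l (a-i) (b-1-j) := by
    ext x
    refine Fin.cases ?_ (fun y => ?_) x
    · rw [Finsupp.add_apply, ex34_zero, ex34_zero, ex34_zero]; omega
    · rw [Finsupp.add_apply, ex34_succ, ex34_succ, ex34_succ]; split_ifs <;> omega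
  rw [this, coeff_mul_monomial, mul_one] at h1
  exact (mul_eq_zero.1 h1).resolve_left hc

lemma lin_usum (α : Fin (n+1) → ℂ) :
    lin (∑ l, α l • (Pi.single l.succ 1 : Fin (n+2) → ℂ)) = ∑ l : Fin (n+1), α l • X l.succ := by
  rw [lin_sum]; simp only [lin_smul, lin_single]

lemma usum_apply (α : Fin (n+1) → ℂ) (x : Fin (n+2)) :
    (∑ l, α l • (Pi.single l.succ 1 : Fin (n+2) → ℂ)) x = Fin.cases 0 α x := by
  refine Fin.cases ?_ (fun y => ?_) x
  · rw [Finset.sum_apply]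
    simp [Pi.single_apply, (Fin.succ_ne_zero _).symm]
  · rw [Finset.sum_apply]
    simp [Pi.single_apply, Fin.succ_inj]

lemma coeff_lin_mul (α : Fin (n+1) → ℂ) (k : MvPolynomial (Fin (n+2)) ℂ) (l : Fin (n+1)) (i : ℕ) :
    coeff (ex34 l i 1) ((∑ l : Fin (n+1), α l • X l.succ) * k) = α l * coeff (Finsupp.single 0 i) k := by
  rw [Finset.sum_mul, coeff_sum, Finset.sum_eq_single l]
  · rw [smul_mul_assoc, coeff_smul, coeff_X_mul', if_pos, smul_eq_mul]
    · congr 2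
      ext x
      refine Fin.cases ?_ (fun y => ?_) x
      · simp [ex34, Finsupp.single_apply]
      · simp [ex34, Finsupp.single_apply, (Fin.succ_ne_zero _).symm]
    · rw [Finsupp.mem_support_iff, ex34_succ]; simp
  · intro m _ hm
    rw [smul_mul_assoc, coeff_smul, coeff_X_mul', if_neg, smul_zero]
    rw [Finsupp.mem_support_iff, ex34_succ, if_neg hm.symm]; simp
  · simp

lemma coeff_lin_mul' (α : Fin (n+1) → ℂ) (k : MvPolynomial (Fin (n+2)) ℂ) (l : Fin (n+1)) (i : ℕ) :
    coeff (ex34 l i 0) ((∑ l : Fin (n+1), α l • X l.succ) * k) = 0 := by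
  rw [Finset.sum_mul, coeff_sum]
  refine Finset.sum_eq_zero fun m _ => ?_
  rw [smul_mul_assoc, coeff_smul, coeff_X_mul', if_neg, smul_zero]
  rw [Finsupp.mem_support_iff, ex34_succ]; simp

/-- exponents of the certificate -/
def exB : (Fin a × Fin n) ⊕ Fin (a-1) → (Fin (n+2) →₀ ℕ)
  | .inl x => ex34 x.2.castSucc (x.1+1) 1
  | .inr k => ex34 (Fin.last n) (k+2) 0

lemma exB_inj : Function.Injective (exB : (Fin a × Fin n) ⊕ Fin (a-1) → (Fin (n+2) →₀ ℕ)) := by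
  rintro (⟨k, j⟩ | k) (⟨k', j'⟩ | k') h
  · simp only [exB] at h
    have h0 := DFunLike.congr_fun h 0
    have h1 := DFunLike.congr_fun h j.castSucc.succ
    rw [ex34_zero, ex34_zero] at h0
    rw [ex34_succ, ex34_succ] at h1
    have : k = k' := by ext; omega
    subst this
    have : j = j' := by
      by_contra hne
      rw [if_pos rfl, if_neg (fun h => hne (Fin.castSucc_injective _ h).symm)] at h1
      omega
    rw [this]
  · simp only [exB] at h
    have h1 := DFunLike.congr_fun h j.castSucc.succ
    rw [ex34_succ, ex34_succ] at h1
    simp at h1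
  · simp only [exB] at h
    have h1 := DFunLike.congr_fun h j'.castSucc.succ
    rw [ex34_succ, ex34_succ] at h1
    simp at h1
  · simp only [exB] at h
    have h0 := DFunLike.congr_fun h 0
    rw [ex34_zero, ex34_zero] at h0
    have : k = k' := by ext; omega
    rw [this]

lemma exB_ne_last (β : (Fin a × Fin n) ⊕ Fin (a-1)) (i : ℕ) : exB β ≠ ex34 (Fin.last n) i 1 := by
  intro h
  have h1 := DFunLike.congr_fun h (Fin.last n).succ
  rcases β with ⟨k, j⟩ | k
  · simp only [exB] at h1
    rw [ex34_succ, ex34_succ, if_neg (Fin.castSucc_lt_last j).ne] at h1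
    simp at h1
  · simp only [exB] at h1
    rw [ex34_succ, ex34_succ] at h1
    simp at h1

lemma fam34_indep (hb : 2 ≤ b) (α : Fin (n+1) → ℂ) (hα : ∀ j, α j ≠ 0) (D : ℕ)
    (c : (Fin a × Fin n) ⊕ Fin (a-1) → ℂ) (h k : MvPolynomial (Fin (n+2)) ℂ)
    (he : (∑ β, (if (exB β).degree = D then c β • monomial (exB β) (1:ℂ) else 0)) =
      h + (∑ l : Fin (n+1), α l • X l.succ) * k)
    (hp : ∀ l : Fin (n+1), Perp (fam34 n a b κ) (X l.succ * h)) :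
    ∀ β, (exB β).degree = D → c β = 0 := by
  have key : ∀ m, coeff m h + coeff m ((∑ l : Fin (n+1), α l • X l.succ) * k) =
      ∑ β, (if (exB β).degree = D then c β * (if exB β = m then 1 else 0) else 0) := by
    intro m
    rw [← coeff_add, ← he, coeff_sum]
    refine Finset.sum_congr rfl fun β _ => ?_
    split_ifs with h1 h2 <;> simp [coeff_monomial, h1, *]
  have key2 : ∀ β, (exB β).degree = D → coeff (exB β) h + coeff (exB β) ((∑ l : Fin (n+1), α l • X l.succ) * k) = c β := by
    intro β hβ
    rw [key, Finset.sum_eq_single β]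
    · simp [hβ]
    · intro β' _ hne
      rw [if_neg (fun h => hne (exB_inj h))]; simp
    · simp
  rintro (⟨i, j⟩ | i) hβ
  · rw [← key2 _ hβ]
    have hk : coeff (Finsupp.single 0 (i.1+1)) k = 0 := by
      have := key (ex34 (Fin.last n) (i.1+1) 1)
      rw [fam34_perp hb _ (hp _) (by omega) (by omega), coeff_lin_mul, zero_add] at this
      have h3 := this.trans (Finset.sum_eq_zero fun β _ => by rw [if_neg (exB_ne_last β _)]; simp)
      exact (mul_eq_zero.1 h3).resolve_left (hα _)
    simp only [exB]
    rw [coeff_lin_mul, hk, fam34_perp hb _ (hp _) (by omega) (by omega)]; simp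
  · rw [← key2 _ hβ]
    simp only [exB]
    rw [coeff_lin_mul', fam34_perp hb _ (hp _) (by omega) (by omega)]; simp

lemma fam34_upper (hb : 2 ≤ b) (hab : b ≤ a + 1) (hn : 1 ≤ n) (hκ : κ = 0 ∨ κ = 1) :
    HasWaringDecomp (a+b) (fam34 n a b κ) ((n+1)*(a+1)) := by
  set lam : Fin (n+1) → ℂ := fun l => if l = Fin.last n then κ - 2 * n else 2 with hlam
  have hl : ∀ l, lam l ≠ 0 := by
    intro l
    simp only [hlam]
    split_ifs
    · rcases hκ with rfl | rfl
      · simp; omega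
      · intro h
        have h2 : (1:ℂ) = ((2 * n : ℕ) : ℂ) := by push_cast; linear_combination h
        have h3 : 1 = 2 * n := by exact_mod_cast h2
        omega
    · norm_num
  have hs : ∑ l, lam l = κ := by
    rw [Fin.sum_univ_castSucc]
    have : ∀ i : Fin n, lam i.castSucc = 2 := fun i => by
      simp [hlam, (Fin.castSucc_lt_last i).ne]
    simp [this, hlam]
    ring
  have hF : fam34 n a b κ = ∑ l : Fin (n+1), rename ![0, l.succ]
      (X 0 ^ a * X 1 ^ b + lam l • X 0 ^ (a + b) : MvPolynomial (Fin 2) ℂ) := by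
    rw [fam34, ← hs, Finset.sum_smul, ← Finset.sum_add_distrib]
    refine Finset.sum_congr rfl fun l _ => ?_
    simp [map_add, smul_eq_C_mul]
  have := HasWaringDecomp.sum' (κ := Fin (n+1)) (d := a + b) (by omega) (fun l => 
    (piece_waring hb hab (hl l)).rename' (ι := ![0, l.succ]) (by
      intro x y hxy
      fin_cases x <;> fin_cases y <;> simp_all [(Fin.succ_ne_zero _).symm]))
  rw [hF]
  simpa using this

def cert34 (hb : 2 ≤ b) (hab : b ≤ a + 1) (hn : 1 ≤ n) (hκ : κ = 0 ∨ κ = 1) :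
    Cert (a+b) (fam34 n a b κ) where
  B := (Fin a × Fin n) ⊕ Fin (a-1)
  fB := inferInstance
  U := Fin (n+1)
  fU := inferInstance
  b β := monomial (exB β) 1
  deg β := (exB β).degree
  two_le := by
    rintro (⟨i, j⟩ | i) <;> simp only [exB, ex34_degree] <;> omega
  hom β := isHomogeneous_monomial _ rfl
  u l := Pi.single l.succ 1
  Lam := {x | x ≠ 0}
  upper := by
    have := fam34_upper (κ := κ) hb hab hn hκ
    convert this using 1
    simp
    obtain ⟨a, rfl⟩ : ∃ a', a = a' + 1 := ⟨a - 1, by omega⟩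
    simp; ring
  indep := by
    intro α hα D c h k he hp
    rw [lin_usum] at he
    simp only [lin_single] at hp
    exact fam34_indep hb α hα D c h k he hp
  K1 := by
    intro w hp
    simp only [lin_single] at hp
    ext x
    refine Fin.cases ?_ (fun l => ?_) x
    · have := fam34_perp hb 0 (hp 0) (i := 1) (j := 0) (by omega) (by omega)
      simpa [ex34, coeff_lin] using this
    · have := fam34_perp hb l (hp l) (i := 0) (j := 1) (by omega) (by omega)
      simpa [ex34, coeff_lin] using this
  R1 := by
    intro α hα w hp x hx
    have : x = 0 := by simpa using hx
    subst this
    obtain ⟨c, hc, H⟩ := fam34_pair (a := a) (κ := κ) hb (0 : Fin (n+1))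
    have hq := hp (monomial (ex34 0 (a-1) (b-1)) 1)
    rw [lin_usum, mul_assoc, Finset.sum_mul, map_sum, Finset.sum_eq_single 0] at hq
    · rw [smul_mul_assoc, map_smul, H] at hq
      have he : ex34 (0 : Fin (n+1)) a (b-1) = ex34 0 1 0 + ex34 0 (a-1) (b-1) := by
        ext x
        refine Fin.cases ?_ (fun y => ?_) x
        · rw [Finsupp.add_apply, ex34_zero, ex34_zero, ex34_zero]; omega
        · rw [Finsupp.add_apply, ex34_succ, ex34_succ, ex34_succ]; split_ifs <;> omega
      rw [he, coeff_mul_monomial] at hq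
      simpa [ex34, coeff_lin, hα, hc] using hq
    · intro l _ hl
      obtain ⟨c, hc, H⟩ := fam34_pair (a := a) (κ := κ) hb l
      rw [smul_mul_assoc, map_smul, H, coeff_mul_monomial', if_neg]
      · simp
      · intro hle
        have := hle (0 : Fin (n+1)).succ
        rw [ex34_succ, ex34_succ, if_pos rfl, if_neg hl] at this
        omega
    · simp
  R2 := by
    intro l hl m hm hlm
    obtain ⟨l, rfl⟩ := Fin.exists_succ_eq.2 (by simpa using hl : l ≠ 0)
    obtain ⟨m, rfl⟩ := Fin.exists_succ_eq.2 (by simpa using hm : m ≠ 0)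
    intro q
    obtain ⟨c, hc, H⟩ := fam34_pair (a := a) (κ := κ) hb l
    rw [mul_assoc, H, coeff_X_mul', if_neg, mul_zero]
    rw [Finsupp.mem_support_iff, ex34_succ, if_neg (fun h => hlm (by rw [h]))]; simp
  R3 := by
    intro α hα l hl x
    rw [usum_apply]
    refine Fin.cases ?_ (fun y => ?_) x
    · simp
    · simp [hα, Fin.succ_ne_zero]

end fam34

section binary

/-- the linear form vanishing at `z` -/
def tz (z : Fin 2 → ℂ) : Fin 2 → ℂ := ![z 1, -z 0]

lemma eval_tz (z w : Fin 2 → ℂ) : eval w (lin (tz z)) = z 1 * w 0 - z 0 * w 1 := by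
  rw [eval_lin]; simp [tz]; ring

lemma eval_tz_self (z : Fin 2 → ℂ) : eval z (lin (tz z)) = 0 := by
  rw [eval_tz]; ring

lemma tz_ne {z : Fin 2 → ℂ} (hz : z ≠ 0) : lin (tz z) ≠ 0 := by
  intro h
  have := lin_eq_zero h
  apply hz
  ext i
  have h0 := congrFun this 0
  have h1 := congrFun this 1
  simp [tz] at h0 h1
  fin_cases i <;> simp [*]

lemma tz_prop {z w : Fin 2 → ℂ} (hz : z ≠ 0) (h : eval w (lin (tz z)) = 0) : ∃ c : ℂ, w = c • z := by
  rw [eval_tz] at h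
  by_cases h0 : z 0 = 0
  · have h1 : z 1 ≠ 0 := by
      intro h1; apply hz; ext i; fin_cases i <;> simp [*]
    refine ⟨w 1 / z 1, ?_⟩
    rw [h0] at h
    have : w 0 = 0 := by
      simpa [h1] using h
    ext i; fin_cases i
    · simp [this, h0]
    · simp; field_simp
  · refine ⟨w 0 / z 0, ?_⟩
    ext i; fin_cases i
    · simp; field_simp
    · simp; field_simp; linear_combination -h

/-- a linear form not vanishing at `z` -/
lemma exists_v {z : Fin 2 → ℂ} (hz : z ≠ 0) : ∃ v : Fin 2 → ℂ, eval z (lin v) ≠ 0 := by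
  by_cases h0 : z 0 = 0
  · refine ⟨Pi.single 1 1, ?_⟩
    rw [lin_single]; simp
    intro h1; apply hz; ext i; fin_cases i <;> simp [*]
  · refine ⟨Pi.single 0 1, ?_⟩
    rw [lin_single]; simpa using h0

lemma homog_zero_eq {f : MvPolynomial (Fin 2) ℂ} (hf : f.IsHomogeneous 0) : ∃ c, f = C c := by
  have := hf
  rw [← mem_homogeneousSubmodule, homogeneousSubmodule_zero] at this
  obtain ⟨c, hc⟩ := Submodule.mem_one.1 this
  exact ⟨c, by rw [← hc]; rfl⟩

/-- every monomial splits as a multiple of `v^e` and `t` -/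
lemma split_at {z : Fin 2 → ℂ} {v : Fin 2 → ℂ} (hv : eval z (lin v) ≠ 0) :
    ∀ {e : ℕ} {f : MvPolynomial (Fin 2) ℂ}, f.IsHomogeneous e →
    ∃ (c : ℂ) (h : MvPolynomial (Fin 2) ℂ), h.IsHomogeneous (e-1) ∧ f = C c * lin v ^ e + lin (tz z) * h := by
  have hX : ∀ i, ∃ c b : ℂ, (X i : MvPolynomial (Fin 2) ℂ) = C c * lin v + C b * lin (tz z) := by
    intro i
    rw [eval_lin, Fin.sum_univ_two] at hv
    set D := v 0 * z 0 + v 1 * z 1 with hD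
    fin_cases i
    · refine ⟨z 0 / D, v 1 / D, ?_⟩
      have h1 : z 0 / D * v 0 + v 1 / D * z 1 = 1 := by field_simp; rw [hD]; ring
      have h2 : z 0 / D * v 1 - v 1 / D * z 0 = 0 := by ring
      simp only [lin, Fin.sum_univ_two, tz]
      have h1' := congrArg (C (σ := Fin 2)) h1
      have h2' := congrArg (C (σ := Fin 2)) h2
      simp only [map_add, map_sub, map_mul, map_one, map_zero] at h1' h2'
      simp
      linear_combination (-X 0) * h1' - X 1 * h2'
    · refine ⟨z 1 / D, -v 0 / D, ?_⟩
      have h1 : z 1 / D * v 0 + -v 0 / D * z 1 = 0 := by ring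
      have h2 : z 1 / D * v 1 - -v 0 / D * z 0 = 1 := by field_simp; rw [hD]; ring
      simp only [lin, Fin.sum_univ_two, tz]
      have h1' := congrArg (C (σ := Fin 2)) h1
      have h2' := congrArg (C (σ := Fin 2)) h2
      simp only [map_add, map_sub, map_mul, map_one, map_zero] at h1' h2'
      simp
      linear_combination (-X 0) * h1' - X 1 * h2'
  have hM : ∀ (e : ℕ) (m : Fin 2 →₀ ℕ), m.degree = e → ∃ (c : ℂ) (h : MvPolynomial (Fin 2) ℂ),
      h.IsHomogeneous (e-1) ∧ monomial m 1 = C c * lin v ^ e + lin (tz z) * h := by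
    intro e
    induction e with
    | zero =>
      intro m hm
      refine ⟨1, 0, isHomogeneous_zero _ _ _, ?_⟩
      rw [Finsupp.degree_eq_zero_iff] at hm
      subst hm; simp
    | succ e ih =>
      intro m hm
      have : ∃ i, m i ≠ 0 := by
        by_contra hcon
        push Not at hcon
        have : m = 0 := by ext i; simp [hcon]
        subst this; simp at hm
      obtain ⟨i, hi⟩ := this
      have hmi : m = (m - Finsupp.single i 1) + Finsupp.single i 1 := by
        ext j; by_cases hj : i = j
        · subst hj; simp; omega
        · simp [Finsupp.single_apply, hj]
      obtain ⟨c, h, hh, he⟩ := ih (m - Finsupp.single i 1) (by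
        have := congrArg Finsupp.degree hmi
        rw [map_add, Finsupp.degree_single] at this
        omega)
      obtain ⟨c', b', hx⟩ := hX i
      refine ⟨c * c', C (b' * c) * lin v ^ e + X i * h, ?_, ?_⟩
      · refine IsHomogeneous.add ?_ ?_
        · exact hcast ((isHomogeneous_C _ _).mul ((lin_isHomogeneous v).pow e)) (by omega)
        · rcases Nat.eq_zero_or_pos e with rfl | hpos
          · have hz : (monomial (m - Finsupp.single i 1)) (1:ℂ) = C 1 := by
              have : (m - Finsupp.single i 1).degree = 0 := by
                have := congrArg Finsupp.degree hmi
                rw [map_add, Finsupp.degree_single] at this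
                omega
              rw [Finsupp.degree_eq_zero_iff] at this
              rw [this]; rfl
            have : h = 0 := by
              obtain ⟨k, hk⟩ := homog_zero_eq hh
              have h2 := congrArg (coeff 0) he
              have h3 := congrArg (eval z) he
              subst hk
              rw [hz] at he
              by_contra hk0
              have hzz : lin (tz z) ≠ 0 := by
                apply tz_ne
                rintro rfl
                apply hv
                rw [eval_lin]; simp
              have h4 : lin (tz z) * C k = C (1 - c) := by
                rw [map_sub, he]; ring
              have h5 := h4.symm ▸ isHomogeneous_C (Fin 2) (1 - c)
              have h6 := (lin_isHomogeneous (tz z)).mul (isHomogeneous_C (Fin 2) k)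
              have := h5.inj_right h6 (mul_ne_zero hzz hk0)
              omega
            rw [this, mul_zero]; exact isHomogeneous_zero _ _ _
          · exact hcast ((isHomogeneous_X _ _).mul hh) (by omega)
      · have h1 : monomial m (1:ℂ) = X i * monomial (m - Finsupp.single i 1) 1 := by
          rw [X, monomial_mul, one_mul, add_comm, ← hmi]
        rw [h1, he, mul_add]
        nth_rewrite 1 [hx]
        simp only [map_mul]
        ring
  intro e f hf
  have hsum := f.as_sum
  have : ∀ m ∈ f.support, ∃ (c : ℂ) (h : MvPolynomial (Fin 2) ℂ),
      h.IsHomogeneous (e-1) ∧ monomial m 1 = C c * lin v ^ e + lin (tz z) * h :=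
    fun m hm => hM e m (homog_degree hf (mem_support_iff.1 hm))
  choose! c h hh he using this
  refine ⟨∑ m ∈ f.support, coeff m f * c m, ∑ m ∈ f.support, C (coeff m f) * h m, ?_, ?_⟩
  · exact IsHomogeneous.sum _ _ _ fun m hm => hcast ((isHomogeneous_C _ _).mul (hh m hm)) (by omega)
  · rw [hsum]
    conv_rhs => rw [← hsum]
    rw [map_sum, Finset.sum_mul, Finset.mul_sum, ← Finset.sum_add_distrib]
    refine Finset.sum_congr rfl fun m hm => ?_
    have : monomial m (coeff m f) = C (coeff m f) * monomial m 1 := by rw [C_mul_monomial, mul_one]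
    rw [this, he m hm]; simp only [map_mul]; ring

lemma factor_zero {z : Fin 2 → ℂ} (hz : z ≠ 0) {e : ℕ} {f : MvPolynomial (Fin 2) ℂ} (hf : f.IsHomogeneous e)
    (h0 : eval z f = 0) : ∃ h : MvPolynomial (Fin 2) ℂ, h.IsHomogeneous (e-1) ∧ f = lin (tz z) * h := by
  obtain ⟨v, hv⟩ := exists_v hz
  obtain ⟨c, h, hh, he⟩ := split_at hv hf
  have := congrArg (eval z) he
  rw [h0] at this
  simp [eval_tz_self, hv] at this
  exact ⟨h, hh, by rw [he, this]; simp⟩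

lemma exists_zero {e : ℕ} (he : 1 ≤ e) {f : MvPolynomial (Fin 2) ℂ} (hf : f.IsHomogeneous e) :
    ∃ z : Fin 2 → ℂ, z ≠ 0 ∧ eval z f = 0 := by
  by_cases hd : (dehom f).degree = 0
  · refine ⟨![1, 0], ?_, ?_⟩
    · intro h; have := congrFun h 0; simp at this
    · have hc : ∀ m ∈ f.support, coeff m f * ∏ i, (![1,0] : Fin 2 → ℂ) i ^ m i = 0 := by
        intro m hm
        have hdeg := homog_degree hf (mem_support_iff.1 hm)
        rw [degree_fin2] at hdeg
        by_cases h1 : m 1 = 0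
        · have h2 := dehom_coeff hf (i := e) le_rfl
          rw [Polynomial.coeff_eq_zero_of_degree_lt (by rw [hd]; exact_mod_cast he)] at h2
          have : m = bex e (e - e) := by
            rw [bex_eta m]; congr 1 <;> omega
          rw [this, ← h2]; simp
        · simp [Fin.prod_univ_two, h1]
      rw [eval_eq']
      exact Finset.sum_eq_zero hc
  · obtain ⟨ρ, hρ⟩ := IsAlgClosed.exists_root _ hd
    refine ⟨![ρ, 1], ?_, ?_⟩
    · intro h; have := congrFun h 1; simp at this
    · have := hρ
      rw [Polynomial.IsRoot, eval_dehom] at this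
      exact this

/-- no common projective zeros -/
def NCZ (f g : MvPolynomial (Fin 2) ℂ) : Prop := ∀ z, z ≠ 0 → eval z f = 0 → eval z g ≠ 0

lemma sylv {g : MvPolynomial (Fin 2) ℂ} {q : ℕ} (hg : g.IsHomogeneous q) : ∀ (p : ℕ) 
    {f : MvPolynomial (Fin 2) ℂ}, f.IsHomogeneous p → f ≠ 0 → NCZ f g → ∀ m, p + q ≤ m + 1 →
    ∀ h : MvPolynomial (Fin 2) ℂ, h.IsHomogeneous m → ∃ u w, h = f * u + g * w := by
  intro p
  induction p with
  | zero =>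
    intro f hf hf0 _ m _ h _
    obtain ⟨c, rfl⟩ := homog_zero_eq hf
    have hc : c ≠ 0 := by rintro rfl; simp at hf0
    refine ⟨C c⁻¹ * h, 0, ?_⟩
    rw [← mul_assoc, ← map_mul, mul_inv_cancel₀ hc]; simp
  | succ p ih =>
    intro f hf hf0 hn m hm h hh
    obtain ⟨z, hz, hfz⟩ := exists_zero (by omega) hf
    obtain ⟨f1, hf1, rfl⟩ := factor_zero hz hf hfz
    have hgz := hn z hz hfz
    obtain ⟨v, hv⟩ := exists_v hz
    set c := eval z h / (eval z g * eval z (lin v) ^ (m - q)) with hc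
    have hk : (h - C c * (g * lin v ^ (m-q))).IsHomogeneous m := by
      refine hh.sub (hcast ((isHomogeneous_C _ _).mul (hg.mul ((lin_isHomogeneous v).pow (m-q)))) (by omega))
    obtain ⟨h1, hh1, he⟩ := factor_zero hz hk (by
      simp only [map_sub, map_mul, map_pow, eval_C, hc]
      field_simp
      simp)
    obtain ⟨u, w, huw⟩ := ih hf1 (right_ne_zero_of_mul hf0) (fun y hy h1 => hn y hy (by simp [h1])) (m-1) (by omega) h1 hh1
    refine ⟨u, C c * lin v ^ (m-q) + lin (tz z) * w, ?_⟩
    rw [huw] at he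
    linear_combination he

lemma gcd_split : ∀ (p : ℕ) {q : ℕ} {f g : MvPolynomial (Fin 2) ℂ}, f.IsHomogeneous p → g.IsHomogeneous q → f ≠ 0 →
    g ≠ 0 →
    ∃ (γ : ℕ) (c f' g' : MvPolynomial (Fin 2) ℂ), c.IsHomogeneous γ ∧ f'.IsHomogeneous (p-γ) ∧
      g'.IsHomogeneous (q-γ) ∧ f = c * f' ∧ g = c * g' ∧ NCZ f' g' ∧ γ ≤ p ∧ γ ≤ q := by
  intro p
  induction p with
  | zero =>
    intro q f g hf hg hf0 hg0
    refine ⟨0, 1, f, g, isHomogeneous_one _ _, hf, hg, by simp, by simp, ?_, le_rfl, by simp⟩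
    intro z hz h0
    obtain ⟨c, rfl⟩ := homog_zero_eq hf
    simp at h0; subst h0; simp at hf0
  | succ p ih =>
    intro q f g hf hg hf0 hg0
    by_cases hn : NCZ f g
    · exact ⟨0, 1, f, g, isHomogeneous_one _ _, hf, hg, by simp, by simp, hn, by simp, by simp⟩
    · unfold NCZ at hn
      push Not at hn
      obtain ⟨z, hz, hfz, hgz⟩ := hn
      obtain ⟨f1, hf1, rfl⟩ := factor_zero hz hf hfz
      have hq : 1 ≤ q := by
        by_contra hq
        have : q = 0 := by omega
        subst this
        obtain ⟨c, rfl⟩ := homog_zero_eq hg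
        simp at hgz; subst hgz; simp at hg0
      obtain ⟨g1, hg1, rfl⟩ := factor_zero hz hg hgz
      obtain ⟨γ, c, f', g', hc, hf', hg', e1, e2, hN, h1, h2⟩ := ih hf1 hg1 (right_ne_zero_of_mul hf0) (right_ne_zero_of_mul hg0)
      refine ⟨γ+1, lin (tz z) * c, f', g', hcast ((lin_isHomogeneous _).mul hc) (by omega), hcast hf' (by omega),
        hcast hg' (by omega), by rw [e1]; ring, by rw [e2]; ring, hN, by omega, by omega⟩

end binary

section binary

/-- `f` has minimal degree `p` in the apolar ideal of `F` -/
def MinP (F : MvPolynomial (Fin 2) ℂ) (p : ℕ) : Prop :=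
  ∀ (e : ℕ) (g : MvPolynomial (Fin 2) ℂ), g.IsHomogeneous e → g ≠ 0 → Perp F g → p ≤ e

lemma lemmaS {F : MvPolynomial (Fin 2) ℂ} {d : ℕ} (hF : F.IsHomogeneous d) {p q : ℕ} (hmin : MinP F p)
    {f g : MvPolynomial (Fin 2) ℂ} (hf : f.IsHomogeneous p) (hg : g.IsHomogeneous q) (hf0 : f ≠ 0) (hg0 : g ≠ 0)
    (pf : Perp F f) (pg : Perp F g) (hpq : p + q ≤ d + 2) : (∃ u, u.IsHomogeneous (q - p) ∧ g = f * u) ∨ (NCZ f g ∧ p + q = d + 2) := by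
  obtain ⟨γ, c, f', g', hc, hf', hg', rfl, rfl, hN, h1, h2⟩ := gcd_split p hf hg hf0 hg0
  have hc0 := left_ne_zero_of_mul hf0
  by_cases hle : γ + (p - γ) + (q - γ) ≤ d + 1
  · left
    have hcp : Perp F c := by
      refine perp_of_homog hF hc fun r k hr hk => ?_
      obtain ⟨u, w, huw⟩ := sylv hg' _ hf' (right_ne_zero_of_mul hf0) hN k (by omega) r hr
      rw [huw, mul_add, map_add]
      have e1 := pf u
      have e2 := pg w
      rw [mul_assoc] at e1 e2
      rw [e1, e2, add_zero]
    have := hmin γ c hc hc0 hcp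
    have hγ : γ = p := by omega
    subst hγ
    rw [Nat.sub_self] at hf'
    obtain ⟨k, rfl⟩ := homog_zero_eq hf'
    have hk : k ≠ 0 := by rintro rfl; simp at hf0
    refine ⟨C k⁻¹ * g', hcast ((isHomogeneous_C _ _).mul hg') (by omega), ?_⟩
    have : C k * C k⁻¹ = (1 : MvPolynomial (Fin 2) ℂ) := by rw [← map_mul, mul_inv_cancel₀ hk, map_one]
    linear_combination (-c * g') * this
  · right
    have hγ : γ = 0 := by omega
    subst hγ
    obtain ⟨k, rfl⟩ := homog_zero_eq hc
    refine ⟨fun z hz h => ?_, by omega⟩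
    have hk : k ≠ 0 := by rintro rfl; simp at hf0
    simp [hk] at h ⊢
    exact hN z hz h

/-- derivation along `t` -/
def Dt {σ : Type*} [Fintype σ] (t : σ → ℂ) : Derivation ℂ (MvPolynomial σ ℂ) (MvPolynomial σ ℂ) :=
  ∑ i, t i • pderiv i

lemma Dt_apply {σ : Type*} [Fintype σ] (t : σ → ℂ) (F : MvPolynomial σ ℂ) :
    Dt t F = ∑ i, t i • pderiv i F := by
  have := congrFun (map_sum (Derivation.coeFnAddMonoidHom (R := ℂ) (A := MvPolynomial σ ℂ) (M := MvPolynomial σ ℂ))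
    (fun i => t i • pderiv i) Finset.univ) F
  rw [Finset.sum_apply] at this
  exact this

lemma pair_lin_mul {σ : Type*} [Fintype σ] (F : MvPolynomial σ ℂ) (t : σ → ℂ) (f : MvPolynomial σ ℂ) :
    pair F (lin t * f) = pair (Dt t F) f := by
  rw [lin, Finset.sum_mul, map_sum, Dt_apply, pair_sum_apply]
  refine Finset.sum_congr rfl fun i _ => ?_
  rw [mul_assoc, ← smul_eq_C_mul, map_smul, pair_X_mul, pair_smul]; rfl

lemma Dt_lin {σ : Type*} [Fintype σ] (t p : σ → ℂ) : Dt t (lin p) = C (eval p (lin t)) := by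
  rw [Dt_apply, eval_lin, map_sum]
  refine Finset.sum_congr rfl fun i _ => ?_
  rw [pderiv_lin, smul_eq_C_mul, map_mul]

/-- forms killed by a square -/
lemma eq_of_perp_sq {F : MvPolynomial (Fin 2) ℂ} {d : ℕ} (hd : 2 ≤ d) (hF : F.IsHomogeneous d) {z : Fin 2 → ℂ} (hz : z ≠ 0)
    (h : Perp F (lin (tz z) * lin (tz z))) : ∃ L M : Fin 2 → ℂ, F = lin L * lin M ^ (d - 1) := by
  obtain ⟨v, hv⟩ := exists_v hz
  have hw : ∃ w, eval w (lin (tz z)) ≠ 0 := exists_eval_ne (tz_ne hz)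
  obtain ⟨w, hw⟩ := hw
  obtain ⟨n, rfl⟩ : ∃ n, d = n + 1 := ⟨d - 1, by omega⟩
  have hfn : ((n.factorial : ℕ) : ℂ) ≠ 0 := by exact_mod_cast Nat.factorial_ne_zero _
  have hfn1 : (((n+1).factorial : ℕ) : ℂ) ≠ 0 := by exact_mod_cast Nat.factorial_ne_zero _
  have hzt : ∀ k q, pair (lin z ^ k) (lin (tz z) * q) = 0 := by
    intro k q
    rw [pair_lin_mul, Derivation.leibniz_pow, Dt_lin, eval_tz_self]; simp [pair_zero]
  have hwt : ∀ q, pair (lin w * lin z ^ n) (lin (tz z) * q) = eval w (lin (tz z)) * pair (lin z ^ n) q := by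
    intro q
    rw [pair_lin_mul, Derivation.leibniz, Derivation.leibniz_pow, Dt_lin, Dt_lin, eval_tz_self]
    simp only [map_zero, smul_zero, zero_add, smul_eq_mul, mul_zero, zero_mul]
    rw [mul_comm (lin z ^ n), ← smul_eq_C_mul, pair_smul]; rfl
  have hzv : ∀ k, pair (lin z ^ k) (lin v ^ k) = k.factorial * eval z (lin v) ^ k := by
    intro k
    rw [pair_lin_pow z (hcast ((lin_isHomogeneous v).pow k) (by omega)), map_pow]
  set β := pair F (lin (tz z) * lin v ^ n) / (eval w (lin (tz z)) * (n.factorial * eval z (lin v) ^ n)) with hβ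
  set α := (pair F (lin v ^ (n+1)) - β * pair (lin w * lin z ^ n) (lin v ^ (n+1))) /
    ((n+1).factorial * eval z (lin v) ^ (n+1)) with hα
  refine ⟨α • z + β • w, z, ?_⟩
  have hG : lin (α • z + β • w) * lin z ^ (n + 1 - 1) = α • lin z ^ (n+1) + β • (lin w * lin z ^ n) := by
    rw [lin_add, lin_smul, lin_smul, Nat.add_sub_cancel]
    simp only [smul_eq_C_mul]; ring
  have hGh : (lin (α • z + β • w) * lin z ^ (n + 1 - 1)).IsHomogeneous (n+1) :=
    hcast ((lin_isHomogeneous _).mul ((lin_isHomogeneous z).pow _)) (by omega)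
  apply pair_inj
  intro f
  rw [pair_homComp hF, pair_homComp hGh, hG, pair_add, pair_smul, pair_smul]
  simp only [LinearMap.add_apply, LinearMap.smul_apply, smul_eq_mul]
  have hf := homogeneousComponent_isHomogeneous (n+1) f
  set f' := homogeneousComponent (n+1) f
  obtain ⟨c, h1, hh1, e1⟩ := split_at hv hf
  obtain ⟨c', h2, hh2, e2⟩ := split_at hv hh1
  rw [Nat.add_sub_cancel] at e2
  rw [e1, e2]
  simp only [mul_add, map_add, hzt, hwt]
  have e3 : pair F (lin (tz z) * (lin (tz z) * h2)) = 0 := by rw [← mul_assoc]; exact h h2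
  rw [e3]
  have e4 : lin (tz z) * (C c' * lin v ^ n) = c' • (lin (tz z) * lin v ^ n) := by rw [smul_eq_C_mul]; ring
  rw [e4, ← smul_eq_C_mul, ← smul_eq_C_mul]
  simp only [map_smul, hzv, smul_eq_mul]
  have e5 : pair F (lin (tz z) * lin v ^ n) = β * (eval w (lin (tz z)) * (n.factorial * eval z (lin v) ^ n)) := by
    rw [hβ]; field_simp
  have e6 : pair F (lin v ^ (n+1)) = α * ((n+1).factorial * eval z (lin v) ^ (n+1)) +
     β * pair (lin w * lin z ^ n) (lin v ^ (n+1)) := by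
    rw [hα]; field_simp; ring
  rw [e5, e6]
  ring

/-- no square of a linear form divides `g` -/
def Sqf (g : MvPolynomial (Fin 2) ℂ) : Prop :=
  ∀ z, z ≠ 0 → ∀ h, g ≠ lin (tz z) * (lin (tz z) * h)

lemma sqf_points : ∀ (k : ℕ) {g : MvPolynomial (Fin 2) ℂ}, g.IsHomogeneous k → g ≠ 0 → Sqf g →
    ∃ p : Fin k → Fin 2 → ℂ, (∀ j, p j ≠ 0 ∧ eval (p j) g = 0) ∧
    ∀ (d : ℕ) (f : MvPolynomial (Fin 2) ℂ), f.IsHomogeneous d → (∀ j, eval (p j) f = 0) → g ∣ f := by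
  intro k
  induction k with
  | zero =>
    intro g hg hg0 _
    refine ⟨fun j => j.elim0, fun j => j.elim0, fun d f _ _ => ?_⟩
    obtain ⟨c, rfl⟩ := homog_zero_eq hg
    have hc : c ≠ 0 := by rintro rfl; simp at hg0
    exact ((isUnit_iff_ne_zero.2 hc).map C).dvd
  | succ k ih =>
    intro g hg hg0 hs
    obtain ⟨z, hz, hgz⟩ := exists_zero (by omega) hg
    obtain ⟨g1, hg1, rfl⟩ := factor_zero hz hg hgz
    have hg10 := right_ne_zero_of_mul hg0
    have hg1z : eval z g1 ≠ 0 := by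
      intro h0
      obtain ⟨h, _, he⟩ := factor_zero hz hg1 h0
      exact hs z hz h (by rw [he])
    obtain ⟨p, hp, H⟩ := ih hg1 hg10 (fun y hy h he => hs y hy (lin (tz z) * h) (by rw [he]; ring))
    refine ⟨Fin.cons z p, ?_, ?_⟩
    · intro j
      refine Fin.cases ?_ (fun j => ?_) j
      · exact ⟨hz, hgz⟩
      · simp only [Fin.cons_succ]
        exact ⟨(hp j).1, by rw [map_mul, (hp j).2, mul_zero]⟩
    · intro d f hf hv
      obtain ⟨f1, hf1, rfl⟩ := factor_zero hz hf (hv 0)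
      apply mul_dvd_mul_left
      refine H _ f1 hf1 fun j => ?_
      have := hv j.succ
      rw [Fin.cons_succ, map_mul] at this
      refine (mul_eq_zero.1 this).resolve_left fun h => ?_
      obtain ⟨c, hc⟩ := tz_prop hz h
      have h1 := (hp j).2
      have h2 := (hp j).1
      rw [hc, eval_smul_homog hg1] at h1
      rcases mul_eq_zero.1 h1 with h3 | h3
      · have : c = 0 := by
          by_contra hc0; exact pow_ne_zero _ hc0 h3
        rw [hc, this, zero_smul] at h2; exact h2 rfl
      · exact hg1z h3

lemma sqf_waring {F : MvPolynomial (Fin 2) ℂ} {d : ℕ} (hd : 1 ≤ d) (hF : F.IsHomogeneous d) {k : ℕ}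
    {g : MvPolynomial (Fin 2) ℂ} (hg : g.IsHomogeneous k) (hg0 : g ≠ 0) (hs : Sqf g) (pg : Perp F g) :
    HasWaringDecomp d F k := by
  obtain ⟨p, _, H⟩ := sqf_points k hg hg0 hs
  refine hasWaring_of_span hd hF p fun f hf hv => ?_
  obtain ⟨q, rfl⟩ := H d f hf hv
  exact pg q

lemma ord_split {z : Fin 2 → ℂ} (hz : z ≠ 0) : ∀ (e : ℕ) {A : MvPolynomial (Fin 2) ℂ}, A.IsHomogeneous e → A ≠ 0 →
    ∃ m A', A = lin (tz z) ^ m * A' ∧ eval z A' ≠ 0 := by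
  intro e
  induction e with
  | zero =>
    intro A hA hA0
    refine ⟨0, A, by simp, ?_⟩
    obtain ⟨c, rfl⟩ := homog_zero_eq hA
    intro h; simp at h; subst h; simp at hA0
  | succ e ih =>
    intro A hA hA0
    by_cases h0 : eval z A = 0
    · obtain ⟨h, hh, rfl⟩ := factor_zero hz hA h0
      obtain ⟨m, A', rfl, h'⟩ := ih hh (right_ne_zero_of_mul hA0)
      exact ⟨m+1, A', by ring, h'⟩
    · exact ⟨0, A, by simp, h0⟩

/-- Jacobian -/
def Jac (A B : MvPolynomial (Fin 2) ℂ) : MvPolynomial (Fin 2) ℂ :=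
  pderiv 0 A * pderiv 1 B - pderiv 1 A * pderiv 0 B

lemma euler2 {e : ℕ} {A : MvPolynomial (Fin 2) ℂ} (hA : A.IsHomogeneous e) :
    X 0 * pderiv 0 A + X 1 * pderiv 1 A = C (e:ℂ) * A := by
  have := hA.sum_X_mul_pderiv
  rw [Fin.sum_univ_two] at this
  rw [this]; simp [nsmul_eq_mul]

lemma jac_ne {e : ℕ} (he : 1 ≤ e) {A B : MvPolynomial (Fin 2) ℂ} (hA : A.IsHomogeneous e) (hB : B.IsHomogeneous e)
    (hA0 : A ≠ 0) (hn : NCZ A B) : Jac A B ≠ 0 := by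
  intro hJ
  unfold Jac at hJ
  have eA := euler2 hA
  have eB := euler2 hB
  have hCe : (C (e:ℂ) : MvPolynomial (Fin 2) ℂ) ≠ 0 := by
    rw [Ne, C_eq_zero]; norm_cast; omega
  have hi : ∀ i, A * pderiv i B = B * pderiv i A := by
    intro i
    apply mul_left_cancel₀ hCe
    fin_cases i
    · simp only [Fin.zero_eta, Fin.mk_one, Fin.isValue]
      linear_combination (-pderiv 0 B) * eA + pderiv 0 A * eB - X 1 * hJ
    · simp only [Fin.zero_eta, Fin.mk_one, Fin.isValue]
      linear_combination (-pderiv 1 B) * eA + pderiv 1 A * eB + X 0 * hJ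
  obtain ⟨z, hz, hAz⟩ := exists_zero he hA
  obtain ⟨m, A', rfl, hA'⟩ := ord_split hz e hA hA0
  rcases m with _ | m
  · simp at hAz; exact hA' hAz
  have hBz := hn z hz hAz
  have hi2 : ∀ i, tz z i = 0 := by
    intro i
    have h1 := hi i
    rw [pderiv_mul, pderiv_pow, pderiv_lin] at h1
    have h2 : lin (tz z) ^ m * (lin (tz z) * A' * pderiv i B) = lin (tz z) ^ m *
       (B * (C ((m:ℂ) + 1) * C (tz z i) * A' + lin (tz z) * pderiv i A')) := by
      rw [Nat.add_sub_cancel] at h1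
      push_cast at h1
      rw [map_add, map_natCast, map_one]
      linear_combination h1
    have h3 := mul_left_cancel₀ (pow_ne_zero _ (tz_ne hz)) h2
    have h4 := congrArg (eval z) h3
    simp only [map_mul, map_add, eval_tz_self, eval_C] at h4
    have hm : (m:ℂ) + 1 ≠ 0 := by exact_mod_cast Nat.succ_ne_zero m
    simpa [hBz, hA', hm] using h4
  have : tz z = 0 := by ext i; exact hi2 i
  exact tz_ne hz (by rw [this, lin_zero])

lemma finite_zeros : ∀ (e : ℕ) {J : MvPolynomial (Fin 2) ℂ}, J.IsHomogeneous e → J ≠ 0 →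
    ∃ Z : Finset (Fin 2 → ℂ), ∀ z, eval z J = 0 → ∃ y ∈ Z, ∃ c : ℂ, z = c • y := by
  intro e
  induction e with
  | zero =>
    intro J hJ hJ0
    refine ⟨∅, fun z hz => ?_⟩
    obtain ⟨c, rfl⟩ := homog_zero_eq hJ
    simp at hz; subst hz; simp at hJ0
  | succ e ih =>
    classical
    intro J hJ hJ0
    obtain ⟨z, hz, hJz⟩ := exists_zero (by omega) hJ
    obtain ⟨J1, hJ1, rfl⟩ := factor_zero hz hJ hJz
    obtain ⟨Z, hZ⟩ := ih hJ1 (right_ne_zero_of_mul hJ0)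
    refine ⟨insert z Z, fun y hy => ?_⟩
    rw [map_mul] at hy
    rcases mul_eq_zero.1 hy with h | h
    · exact ⟨z, by simp, tz_prop hz h⟩
    · obtain ⟨x, hx, h⟩ := hZ y h
      exact ⟨x, by simp [hx], h⟩

lemma exists_sqf {e : ℕ} (he : 1 ≤ e) {A B : MvPolynomial (Fin 2) ℂ} (hA : A.IsHomogeneous e) (hB : B.IsHomogeneous e)
    (hA0 : A ≠ 0) (hn : NCZ A B) : ∃ c : ℂ, A + C c * B ≠ 0 ∧ Sqf (A + C c * B) := by
  classical
  have hJh : (Jac A B).IsHomogeneous (2*(e-1)) := by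
    refine IsHomogeneous.sub ?_ ?_ <;> exact hcast ((hA.pderiv).mul hB.pderiv) (by omega)
  obtain ⟨Z, hZ⟩ := finite_zeros _ hJh (jac_ne he hA hB hA0 hn)
  obtain ⟨c, hc⟩ := Infinite.exists_notMem_finset (Z.image fun y => - eval y A / eval y B)
  have hs : Sqf (A + C c * B) := by
    intro z hz h hcon
    apply hc
    have h0 : eval z (A + C c * B) = 0 := by rw [hcon]; simp [eval_tz_self]
    have hd : ∀ i, eval z (pderiv i (A + C c * B)) = 0 := by
      intro i; rw [hcon, pderiv_mul, pderiv_mul]; simp [eval_tz_self]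
    have hBz : eval z B ≠ 0 := by
      intro hb
      simp [hb] at h0
      exact hn z hz h0 hb
    have hJz : eval z (Jac A B) = 0 := by
      have d0 := hd 0
      have d1 := hd 1
      simp [pderiv_mul] at d0 d1
      simp only [Jac, map_sub, map_mul]
      linear_combination (eval z (pderiv 1 B)) * d0 - (eval z (pderiv 0 B)) * d1
    obtain ⟨y, hy, k, rfl⟩ := hZ z hJz
    have hk : k ≠ 0 := by rintro rfl; simp at hz
    rw [Finset.mem_image]
    refine ⟨y, hy, ?_⟩
    rw [map_add, map_mul, eval_C, eval_smul_homog hA, eval_smul_homog hB] at h0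
    rw [eval_smul_homog hB] at hBz
    have hyB := right_ne_zero_of_mul hBz
    have h1 : k ^ e * (eval y A + c * eval y B) = 0 := by linear_combination h0
    have h2 := (mul_eq_zero.1 h1).resolve_left (pow_ne_zero _ hk)
    field_simp
    linear_combination -h2
  refine ⟨c, fun h0 => ?_, hs⟩
  exact hs ![1,0] (by intro h; have := congrFun h 0; simp at this) 0 (by rw [h0]; simp)

lemma exists_double {e : ℕ} (he : 2 ≤ e) {A B : MvPolynomial (Fin 2) ℂ} (hA : A.IsHomogeneous e) (hB : B.IsHomogeneous e) :
    ∃ (l m : ℂ) (z : Fin 2 → ℂ) (h : MvPolynomial (Fin 2) ℂ), (l ≠ 0 ∨ m ≠ 0) ∧ z ≠ 0 ∧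
      C l * A + C m * B = lin (tz z) * (lin (tz z) * h) := by
  have hJh : (Jac A B).IsHomogeneous (2*(e-1)) := by
    refine IsHomogeneous.sub ?_ ?_ <;> exact hcast ((hA.pderiv).mul hB.pderiv) (by omega)
  obtain ⟨z, hz, hJ⟩ := exists_zero (by omega) hJh
  simp only [Jac, map_sub, map_mul] at hJ
  have hlm : ∃ l m : ℂ, (l ≠ 0 ∨ m ≠ 0) ∧ ∀ i, l * eval z (pderiv i A) + m * eval z (pderiv i B) = 0 := by
    by_cases h : ∀ i, eval z (pderiv i A) = 0 ∧ eval z (pderiv i B) = 0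
    · exact ⟨1, 0, by simp, fun i => by simp [(h i).1]⟩
    · push Not at h
      obtain ⟨i, hi⟩ := h
      refine ⟨eval z (pderiv i B), - eval z (pderiv i A), ?_, ?_⟩
      · by_cases h1 : eval z (pderiv i A) = 0
        · left; exact hi h1
        · right; simpa using h1
      · intro j
        fin_cases i <;> fin_cases j <;> simp only [Fin.zero_eta, Fin.mk_one, Fin.isValue] <;> first | linear_combination hJ | linear_combination -hJ | linear_combination 0*hJ
  obtain ⟨l, m, hlm, hd⟩ := hlm
  have hGh : (C l * A + C m * B).IsHomogeneous e := by
    refine IsHomogeneous.add ?_ ?_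
    · exact hcast ((isHomogeneous_C _ _).mul hA) (by omega)
    · exact hcast ((isHomogeneous_C _ _).mul hB) (by omega)
  have hG0 : eval z (C l * A + C m * B) = 0 := by
    have := congrArg (eval z) (euler2 hGh)
    simp [pderiv_mul] at this
    have d0 := hd 0
    have d1 := hd 1
    have h2 : (e:ℂ) * eval z (C l * A + C m * B) = 0 := by
      simp only [map_add, map_mul, eval_C]
      linear_combination -this + z 0 * d0 + z 1 * d1
    exact (mul_eq_zero.1 h2).resolve_left (by norm_cast; omega)
  obtain ⟨h1, hh1, e1⟩ := factor_zero hz hGh hG0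
  have : eval z h1 = 0 := by
    have hi : ∀ i, tz z i * eval z h1 = 0 := by
      intro i
      have := congrArg (fun f => eval z (pderiv i f)) e1
      simp [pderiv_mul, pderiv_lin, eval_tz_self] at this
      rw [mul_comm, ← this, hd i]
    by_contra hne
    have : tz z = 0 := by
      ext i; simpa [hne] using hi i
    exact tz_ne hz (by rw [this, lin_zero])
  obtain ⟨h2, _, e2⟩ := factor_zero hz hh1 this
  exact ⟨l, m, z, h2, hlm, hz, by rw [e1, e2]⟩

end binary

section binary

lemma hc_mul {σ : Type*} {l : MvPolynomial σ ℂ} {a : ℕ} (hl : l.IsHomogeneous a) (n : ℕ) (q : MvPolynomial σ ℂ) :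
    homogeneousComponent (a+n) (l * q) = l * homogeneousComponent n q := by
  have key : ∀ k, homogeneousComponent (a+n) (l * homogeneousComponent k q) = if k = n then l * homogeneousComponent k q else 0 := by
    intro k
    rw [homogeneousComponent_of_mem ((mem_homogeneousSubmodule _ _).2 (hl.mul (homogeneousComponent_isHomogeneous k q)))]
    by_cases h : k = n
    · simp [h]
    · rw [if_neg (by omega), if_neg h]
  conv_lhs => rw [← sum_homogeneousComponent q, Finset.mul_sum, map_sum]
  simp only [key]
  rw [Finset.sum_ite_eq' (Finset.range _) n]
  split_ifs with h
  · rfl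
  · rw [homogeneousComponent_eq_zero, mul_zero]
    simp at h; omega

lemma perp_comp {σ : Type*} [Fintype σ] {F : MvPolynomial σ ℂ} {d : ℕ} (hF : F.IsHomogeneous d)
    {h : MvPolynomial σ ℂ} (hp : Perp F h) (D : ℕ) : Perp F (homogeneousComponent D h) := by
  refine perp_of_homog hF (homogeneousComponent_isHomogeneous D h) fun q k hq hk => ?_
  have h1 := hp q
  rw [pair_homComp hF, ← hk, mul_comm, add_comm, hc_mul hq, mul_comm] at h1
  exact h1

/-- binary form with given coefficients -/
def polyL (m : ℕ) : (Fin (m+1) → ℂ) →ₗ[ℂ] MvPolynomial (Fin 2) ℂ :=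
  ∑ i : Fin (m+1), (monomial (bex i (m - i))) ∘ₗ LinearMap.proj i

lemma polyL_coeff (m : ℕ) (c : Fin (m+1) → ℂ) (i : Fin (m+1)) :
    coeff (bex i (m-i)) (polyL m c) = c i := by
  simp only [polyL, LinearMap.sum_apply, LinearMap.comp_apply, LinearMap.proj_apply, coeff_sum, coeff_monomial]
  rw [Finset.sum_eq_single i]
  · simp
  · intro j _ hj
    rw [if_neg]
    intro h
    have := DFunLike.congr_fun h 0
    simp at this
    exact hj (by ext; omega)
  · simp

lemma polyL_inj (m : ℕ) : Function.Injective (polyL m) := by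
  intro c c' h
  ext i
  have := congrArg (coeff (bex i (m-i))) h
  rwa [polyL_coeff, polyL_coeff] at this

lemma polyL_hom (m : ℕ) (c : Fin (m+1) → ℂ) : (polyL m c).IsHomogeneous m := by
  simp only [polyL, LinearMap.sum_apply, LinearMap.comp_apply, LinearMap.proj_apply]
  refine IsHomogeneous.sum _ _ _ fun i _ => isHomogeneous_monomial _ ?_
  rw [bex_degree]; omega

lemma polyL_range (m : ℕ) : LinearMap.range (polyL m) = homogeneousSubmodule (Fin 2) ℂ m := by
  ext f
  rw [mem_homogeneousSubmodule]
  constructor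
  · rintro ⟨c, rfl⟩; exact polyL_hom m c
  · intro hf
    refine ⟨fun i => coeff (bex i (m-i)) f, ?_⟩
    ext x
    by_cases hx : x.degree = m
    · rw [degree_fin2] at hx
      have := polyL_coeff m (fun i => coeff (bex i (m-i)) f) ⟨x 0, by omega⟩
      have e : x = bex (x 0) (m - x 0) := by
        conv_lhs => rw [bex_eta x]
        congr 1; omega
      rw [e]; exact this
    · rw [(polyL_hom m _).coeff_eq_zero hx, hf.coeff_eq_zero hx]

lemma finrank_hom (m : ℕ) : Module.finrank ℂ (homogeneousSubmodule (Fin 2) ℂ m) = m + 1 := by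
  rw [← polyL_range, ← (LinearEquiv.ofInjective _ (polyL_inj m)).finrank_eq]
  simp

instance fd_hom (m : ℕ) : Module.Finite ℂ (homogeneousSubmodule (Fin 2) ℂ m) := by
  rw [← polyL_range]; infer_instance

lemma count {F : MvPolynomial (Fin 2) ℂ} {d : ℕ} (hF : F.IsHomogeneous d) {e : ℕ} (he : e ≤ d) :
    ∃ K : Submodule ℂ (MvPolynomial (Fin 2) ℂ), 2 * e ≤ Module.finrank ℂ K + d ∧ 
      ∀ f ∈ K, f.IsHomogeneous e ∧ Perp F f := by
  let Φ : homogeneousSubmodule (Fin 2) ℂ e →ₗ[ℂ] Module.Dual ℂ (homogeneousSubmodule (Fin 2) ℂ (d-e)) :=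
    LinearMap.mk₂ ℂ (fun f q => pair F (f.1 * q.1)) 
      (by intro a b c; simp [add_mul]) (by intro a b c; simp)
      (by intro a b c; simp [mul_add]) (by intro a b c; simp)
  refine ⟨(LinearMap.ker Φ).map (Submodule.subtype _), ?_, ?_⟩
  · rw [Submodule.finrank_map_subtype_eq]
    have h1 := Φ.finrank_range_add_finrank_ker
    rw [finrank_hom] at h1
    have h2 : Module.finrank ℂ (LinearMap.range Φ) ≤ d - e + 1 := by
      refine (Submodule.finrank_le _).trans ?_
      rw [Subspace.dual_finrank_eq, finrank_hom]
    omega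
  · rintro f ⟨⟨f, hf⟩, hk, rfl⟩
    rw [mem_homogeneousSubmodule] at hf
    refine ⟨hf, ?_⟩
    refine perp_of_homog hF hf fun q k hq hek => ?_
    have : k = d - e := by omega
    subst this
    exact LinearMap.congr_fun (LinearMap.mem_ker.1 hk) ⟨q, (mem_homogeneousSubmodule _ _).2 hq⟩

lemma exists_low {F : MvPolynomial (Fin 2) ℂ} {d : ℕ} (hd : 2 ≤ d) (hF : F.IsHomogeneous d) :
    ∃ f : MvPolynomial (Fin 2) ℂ, f.IsHomogeneous (d/2+1) ∧ f ≠ 0 ∧ Perp F f := by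
  obtain ⟨K, hK, h⟩ := count hF (e := d/2+1) (by omega)
  have : K ≠ ⊥ := by
    rintro rfl
    rw [finrank_bot] at hK; omega
  obtain ⟨f, hf, hf0⟩ := Submodule.exists_mem_ne_zero_of_ne_bot this
  exact ⟨f, (h f hf).1, hf0, (h f hf).2⟩

lemma exists_g2 {F : MvPolynomial (Fin 2) ℂ} {d : ℕ} (hF : F.IsHomogeneous d) {p : ℕ} (hp : 2 ≤ p) (hp2 : 2 * p ≤ d + 2)
    (f : MvPolynomial (Fin 2) ℂ) :
    ∃ g : MvPolynomial (Fin 2) ℂ, g.IsHomogeneous (d+2-p) ∧ Perp F g ∧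
      ¬ ∃ u, u.IsHomogeneous (d+2-p-p) ∧ g = f * u := by
  obtain ⟨K, hK, h⟩ := count hF (e := d+2-p) (by omega)
  by_contra hcon
  push Not at hcon
  have hle : K ≤ (homogeneousSubmodule (Fin 2) ℂ (d+2-p-p)).map (LinearMap.mulLeft ℂ f) := by
    intro g hg
    obtain ⟨u, hu, rfl⟩ := hcon g (h g hg).1 (h g hg).2
    exact ⟨u, hu, rfl⟩
  have h1 := Submodule.finrank_mono hle
  have h2 := Submodule.finrank_map_le (LinearMap.mulLeft ℂ f) (homogeneousSubmodule (Fin 2) ℂ (d+2-p-p))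
  rw [finrank_hom] at h2
  omega

def cert2 {F : MvPolynomial (Fin 2) ℂ} {d : ℕ} (hF : F.IsHomogeneous d) {k : ℕ} (hk : 2 ≤ k)
    (hup : HasWaringDecomp d F k) {z : Fin 2 → ℂ} (hz : z ≠ 0)
    (H : ∀ D, D < k → ∀ h : MvPolynomial (Fin 2) ℂ, h.IsHomogeneous D → Perp F (lin (tz z) * h) → eval z h = 0)
    (hK : ∀ w, Perp F (lin (tz z) * lin w) → w = 0) : Cert d F where
  B := Fin (k-2)
  fB := inferInstance
  U := Unit
  fU := inferInstance
  b β := lin (exists_v hz).choose ^ (β.1 + 2)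
  deg β := β.1 + 2
  two_le β := by omega
  hom β := hcast ((lin_isHomogeneous _).pow _) (by omega)
  u _ := tz z
  Lam := ∅
  upper := by
    convert hup using 1
    simp; omega
  indep := by
    intro α hα D c h q he hp β hβ
    have hv := (exists_v hz).choose_spec
    set v := (exists_v hz).choose
    have he2 : c β • lin v ^ D = homogeneousComponent D h + lin (tz z) * (α () • homogeneousComponent (D-1) q) := by
      have h1 := congrArg (homogeneousComponent D) he
      rw [Finset.sum_eq_single β, if_pos hβ, hβ] at h1
      · have h2 : (c β • lin v ^ D).IsHomogeneous D := by
          rw [smul_eq_C_mul]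
          exact hcast ((isHomogeneous_C _ _).mul ((lin_isHomogeneous v).pow D)) (by omega)
        rw [homogeneousComponent_of_mem ((mem_homogeneousSubmodule _ _).2 h2), if_pos rfl, map_add] at h1
        rw [h1]
        congr 1
        simp only [Finset.univ_unique, Finset.sum_singleton, lin_smul, PUnit.default_eq_unit]
        obtain ⟨D', rfl⟩ : ∃ D', D = 1 + D' := ⟨D - 1, by omega⟩
        rw [smul_mul_assoc, map_smul, hc_mul (lin_isHomogeneous _)]
        simp
      · intro β' _ hne
        rw [if_neg]; intro h'; apply hne; ext; omega
      · simp
    have hpD : Perp F (lin (tz z) * homogeneousComponent D h) := by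
      have h1 := perp_comp hF (hp ()) (1 + D)
      rwa [hc_mul (lin_isHomogeneous _)] at h1
    have h0 := H D (by omega) _ (homogeneousComponent_isHomogeneous D h) hpD
    have := congrArg (eval z) he2
    simp only [smul_eval, map_add, map_mul, map_pow, h0, eval_tz_self] at this
    simpa [hv] using this
  K1 := by
    intro w hp; exact hK w (hp ())
  R1 := by
    intro α hα w hp x _
    have : Perp F (lin (tz z) * lin w) := by
      have h2 := hp.smul (α ())⁻¹
      simpa [lin_smul, smul_smul, hα] using h2
    rw [hK w this]; rfl
  R2 := by simp
  R3 := by simp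

lemma exists_coprime_lin {k : ℕ} {g : MvPolynomial (Fin 2) ℂ} (hg : g.IsHomogeneous k) (hg0 : g ≠ 0) :
    ∃ v, NCZ (lin v) g := by
  classical
  obtain ⟨Z, hZ⟩ := finite_zeros k hg hg0
  obtain ⟨c, hc⟩ := Infinite.exists_notMem_finset (Z.image fun y => - y 0 / y 1)
  refine ⟨![1, c], fun z hz h1 h2 => ?_⟩
  obtain ⟨y, hy, b, rfl⟩ := hZ z h2
  have hb : b ≠ 0 := by rintro rfl; simp at hz
  rw [eval_lin, Fin.sum_univ_two] at h1
  simp at h1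
  have h3 : b * (y 0 + c * y 1) = 0 := by linear_combination h1
  have h4 := (mul_eq_zero.1 h3).resolve_left hb
  by_cases hy1 : y 1 = 0
  · rw [hy1] at h4
    apply hz
    have : y = 0 := by
      ext i; fin_cases i
      · simpa using h4
      · simpa using hy1
    rw [this, smul_zero]
  · apply hc
    rw [Finset.mem_image]
    refine ⟨y, hy, ?_⟩
    field_simp
    linear_combination -h4

lemma cert_binary {F : MvPolynomial (Fin 2) ℂ} {d : ℕ} (hd : 3 ≤ d) (hF : F.IsHomogeneous d)
    (hN : ¬ ∃ L M : Fin 2 → ℂ, F = lin L * lin M ^ (d - 1)) : Nonempty (Cert d F) := by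
  classical
  have hsq : ∀ z, z ≠ 0 → ¬ Perp F (lin (tz z) * lin (tz z)) := fun z hz h =>
    hN (eq_of_perp_sq (by omega) hF hz h)
  have hex : ∃ e, ∃ f : MvPolynomial (Fin 2) ℂ, f.IsHomogeneous e ∧ f ≠ 0 ∧ Perp F f :=
    ⟨_, exists_low (by omega) hF⟩
  obtain ⟨f, hf, hf0, pf⟩ := Nat.find_spec hex
  have hmin : MinP F (Nat.find hex) := fun e g hg hg0 pg => Nat.find_min' hex ⟨g, hg, hg0, pg⟩
  have hp2 : 2 * Nat.find hex ≤ d + 2 := by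
    have := Nat.find_min' hex (exists_low (by omega) hF)
    omega
  set p := Nat.find hex with hpdef
  clear_value p
  have hone : (![1,0] : Fin 2 → ℂ) ≠ 0 := by
    intro h; have := congrFun h 0; simp at this
  have hp : 2 ≤ p := by
    by_contra hlt
    have : p = 0 ∨ p = 1 := by omega
    rcases this with rfl | rfl
    · obtain ⟨c, rfl⟩ := homog_zero_eq hf
      have hc : c ≠ 0 := by rintro rfl; simp at hf0
      apply hsq _ hone
      have h1 := pf.mul_right (C c⁻¹ * (lin (tz ![1,0]) * lin (tz ![1,0])))
      rwa [← mul_assoc, ← map_mul, mul_inv_cancel₀ hc, map_one, one_mul] at h1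
    · obtain ⟨z, hz, hfz⟩ := exists_zero le_rfl hf
      obtain ⟨h, hh, rfl⟩ := factor_zero hz hf hfz
      obtain ⟨c, rfl⟩ := homog_zero_eq hh
      have hc : c ≠ 0 := by rintro rfl; simp at hf0
      apply hsq _ hz
      have h1 := pf.mul_right (C c⁻¹ * lin (tz z))
      rwa [mul_assoc, ← mul_assoc (C c), ← map_mul, mul_inv_cancel₀ hc, map_one, one_mul] at h1
  by_cases hAC : ∃ f : MvPolynomial (Fin 2) ℂ, f.IsHomogeneous p ∧ f ≠ 0 ∧ Perp F f ∧ ∃ z, z ≠ 0 ∧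
      ∃ h, f = lin (tz z) * (lin (tz z) * h)
  · clear hf0 pf
    clear hf f
    obtain ⟨f, hf, hf0, pf, z, hz, h, hfe⟩ := hAC
    have hfz : eval z f = 0 := by rw [hfe]; simp [eval_tz_self]
    obtain ⟨g, hg, pg, hgn⟩ := exists_g2 hF hp hp2 f
    have hg0 : g ≠ 0 := by
      rintro rfl; exact hgn ⟨0, isHomogeneous_zero _ _ _, by simp⟩
    have hNC : NCZ f g := by
      rcases lemmaS hF hmin hf hg hf0 hg0 pf pg (by omega) with h | h
      · exact absurd h hgn
      · exact h.1
    have H : ∀ D, D < d+2-p → ∀ h : MvPolynomial (Fin 2) ℂ, h.IsHomogeneous D → Perp F (lin (tz z) * h) → eval z h = 0 := by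
      intro D hD h' hh' ph'
      by_cases h0 : h' = 0
      · rw [h0, map_zero]
      rcases lemmaS hF hmin hf ((lin_isHomogeneous (tz z)).mul hh') hf0 (mul_ne_zero (tz_ne hz) h0) pf ph' (by omega) with hu | hu
      · obtain ⟨u, _, hu⟩ := hu
        rw [hfe] at hu
        have : h' = lin (tz z) * h * u := by
          apply mul_left_cancel₀ (tz_ne hz)
          rw [hu]; ring
        rw [this]; simp [eval_tz_self]
      · exact absurd (by simp [eval_tz_self]) (hu.1 z hz hfz)
    have hup : HasWaringDecomp d F (d+2-p) := by
      obtain ⟨v, hv⟩ := exists_coprime_lin hg hg0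
      have hv0 : lin v ≠ 0 := by
        intro h0
        exact hv ![1,0] hone (by rw [h0]; simp) |>.elim (by
          obtain ⟨y, hy, hy0⟩ := exists_zero (by omega) hg
          exact absurd hy0 (hv y hy (by rw [h0]; simp)))
      have hA : (f * lin v ^ (d+2-p-p)).IsHomogeneous (d+2-p) :=
        hcast (hf.mul ((lin_isHomogeneous v).pow _)) (by omega)
      obtain ⟨c, hc0, hcs⟩ := exists_sqf (by omega) hA hg (mul_ne_zero hf0 (pow_ne_zero _ hv0)) (by
        intro y hy hy0
        rw [map_mul, map_pow] at hy0
        rcases mul_eq_zero.1 hy0 with h1 | h1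
        · exact hNC y hy h1
        · exact hv y hy (by by_contra h3; exact pow_ne_zero _ h3 h1))
      refine sqf_waring (by omega) hF ?_ hc0 hcs ((pf.mul_right _).add (pg.mul_left _))
      exact hA.add (hcast ((isHomogeneous_C _ _).mul hg) (by omega))
    refine ⟨cert2 hF (by omega) hup hz H ?_⟩
    intro w hw
    have h0 := H 1 (by omega) (lin w) (lin_isHomogeneous w) hw
    obtain ⟨h', hh', he⟩ := factor_zero hz (lin_isHomogeneous w) h0
    obtain ⟨c, rfl⟩ := homog_zero_eq hh'
    by_cases hc : c = 0
    · apply lin_eq_zero; rw [he, hc]; simp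
    · exfalso
      apply hsq z hz
      rw [he] at hw
      have := hw.mul_right (C c⁻¹)
      rwa [mul_assoc, mul_assoc, ← map_mul, mul_inv_cancel₀ hc, map_one, mul_one] at this
  · have hlt : 2 * p < d + 2 := by
      by_contra hge
      have he : d + 2 - p = p := by omega
      obtain ⟨g, hg, pg, hgn⟩ := exists_g2 hF hp hp2 f
      rw [he] at hg
      obtain ⟨l, m, z, h, hlm, hz, hd⟩ := exists_double hp hf hg
      apply hAC
      refine ⟨C l * f + C m * g, ?_, ?_, (pf.mul_left _).add (pg.mul_left _), z, hz, h, hd⟩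
      · exact (hcast ((isHomogeneous_C _ _).mul hf) (by omega)).add (hcast ((isHomogeneous_C _ _).mul hg) (by omega))
      · intro h0
        by_cases hm : m = 0
        · have hl : l ≠ 0 := by
            rcases hlm with h | h
            · exact h
            · exact absurd hm h
          rw [hm] at h0
          simp [hl, hf0] at h0
        · apply hgn
          refine ⟨C (-l/m), hcast (isHomogeneous_C _ _) (by omega), ?_⟩
          have h1 : C m * (g - f * C (-l/m)) = 0 := by
            have h2 : C m * C (-l/m) = (- C l : MvPolynomial (Fin 2) ℂ) := by
              rw [← map_mul, ← map_neg]; congr 1; field_simp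
            linear_combination h0 - f * h2
          have h3 := (mul_eq_zero.1 h1).resolve_left (fun h => hm (C_eq_zero.1 h))
          linear_combination h3
    have hs : Sqf f := fun z hz h he => hAC ⟨f, hf, hf0, pf, z, hz, h, he⟩
    obtain ⟨z, hfz⟩ := exists_eval_ne hf0
    have hz : z ≠ 0 := by
      rintro rfl
      apply hfz
      have := eval_smul_homog hf 0 0
      rw [zero_smul, zero_pow (by omega), zero_mul] at this
      exact this
    have H : ∀ D, D < p → ∀ h : MvPolynomial (Fin 2) ℂ, h.IsHomogeneous D → Perp F (lin (tz z) * h) → h = 0 := by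
      intro D hD h hh ph
      by_contra h0
      rcases lemmaS hF hmin hf ((lin_isHomogeneous (tz z)).mul hh) hf0 (mul_ne_zero (tz_ne hz) h0) pf ph (by omega) with hu | hu
      · obtain ⟨u, hu1, hu⟩ := hu
        rw [show 1 + D - p = 0 by omega] at hu1
        obtain ⟨c, rfl⟩ := homog_zero_eq hu1
        have := congrArg (eval z) hu
        simp [eval_tz_self, hfz] at this
        rw [this] at hu
        simp [tz_ne hz, h0] at hu
      · omega
    refine ⟨cert2 hF hp (sqf_waring (by omega) hF hf hf0 hs pf) hz (fun D hD h hh ph => by rw [H D hD h hh ph, map_zero]) ?_⟩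
    intro w hw
    exact lin_eq_zero (H 1 (by omega) _ (lin_isHomogeneous w) hw)

end binary

lemma prim_elt {A R : Type} [CommRing A] [IsDomain A] [CommRing R] [IsDomain R] [Algebra A R]
    [IsIntegrallyClosed A] [IsIntegrallyClosed R] [CharZero A] [Module.Finite A R]
    (hinj : Function.Injective (algebraMap A R)) {B : Type} [Fintype B] (b : B → R)
    (hb : LinearIndependent A b) :
    ∃ (θ : R) (U V : Polynomial A) (D : A), D ≠ 0 ∧
      U * minpoly A θ + V * (minpoly A θ).derivative = Polynomial.C D ∧
      Fintype.card B ≤ (minpoly A θ).natDegree := by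
  have : FaithfulSMul A R := (faithfulSMul_iff_algebraMap_injective A R).2 hinj
  let K := FractionRing A
  let L := FractionRing R
  let : Algebra K L := FractionRing.liftAlgebra A L
  have hinjL : Function.Injective (algebraMap R L) := IsFractionRing.injective R L
  have : CharZero K := charZero_of_injective_algebraMap (IsFractionRing.injective A K)
  have : FiniteDimensional K L := by
    have : IsLocalization (Algebra.algebraMapSubmonoid R (nonZeroDivisors A)) L := inferInstance
    exact Module.Finite.of_isLocalization A R (nonZeroDivisors A)
  have : Algebra.IsAlgebraic A L := (IsFractionRing.comap_isAlgebraic_iff (K := K)).mpr inferInstance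
  have hbL : LinearIndependent A (fun β => algebraMap R L (b β)) := by
    have := hb.map' (IsScalarTower.toAlgHom A R L).toLinearMap (LinearMap.ker_eq_bot.2 hinjL)
    exact this
  have hbK := (LinearIndependent.iff_fractionRing A K).1 hbL
  have hcard : Fintype.card B ≤ Module.finrank K L := hbK.fintype_card_le_finrank
  obtain ⟨x, hx⟩ := Field.exists_primitive_element K L
  obtain ⟨y, hy, hyx⟩ := ((Algebra.IsAlgebraic.isAlgebraic (R := A) x)).exists_integral_multiple
  obtain ⟨θ, hθ⟩ := IsIntegrallyClosed.isIntegral_iff.1 (hyx.tower_top (A := R))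
  have hintegral : IsIntegral A θ := Algebra.IsIntegral.isIntegral θ
  have hgen : IntermediateField.adjoin K {algebraMap R L θ} = ⊤ := by
    rw [eq_top_iff, ← hx, IntermediateField.adjoin_simple_le_iff]
    have h1 : x = (algebraMap A K y)⁻¹ • algebraMap R L θ := by
      rw [hθ, ← algebraMap_smul K y x, smul_smul, inv_mul_cancel₀, one_smul]
      exact fun h => hy (IsFractionRing.injective A K (by rw [h, map_zero]))
    rw [h1]
    exact IntermediateField.smul_mem _ (IntermediateField.mem_adjoin_simple_self K _)
  set m := minpoly A θ with hm
  have hmK : minpoly K (algebraMap R L θ) = m.map (algebraMap A K) :=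
    minpoly.isIntegrallyClosed_eq_field_fractions K L hintegral
  have hmon : m.Monic := minpoly.monic hintegral
  have hdeg : m.natDegree = Module.finrank K L := by
    rw [← IntermediateField.finrank_top', ← hgen, IntermediateField.adjoin.finrank (IsIntegral.of_finite K _), hmK,
      hmon.natDegree_map]
  have hsep : (m.map (algebraMap A K)).Separable := by
    rw [← hmK]; exact Algebra.IsSeparable.isSeparable K _
  obtain ⟨U, V, hUV⟩ := hsep
  obtain ⟨p, hp0, hp⟩ := IsLocalization.integerNormalization_spec (nonZeroDivisors A) U
  obtain ⟨q, hq0, hq⟩ := IsLocalization.integerNormalization_spec (nonZeroDivisors A) V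
  refine ⟨θ, (q : A) • IsLocalization.integerNormalization (nonZeroDivisors A) U,
    (p : A) • IsLocalization.integerNormalization (nonZeroDivisors A) V, p * q, ?_, ?_, ?_⟩
  · exact mul_ne_zero (nonZeroDivisors.ne_zero hp0) (nonZeroDivisors.ne_zero hq0)
  · apply Polynomial.map_injective _ (IsFractionRing.injective A K)
    rw [Polynomial.derivative_map] at hUV
    simp only [Polynomial.map_add, Polynomial.map_mul, Polynomial.map_smul, hp, hq, Polynomial.map_C, map_mul]
    rw [← hm]
    have h2 : ∀ (r : A) (P : Polynomial K), r • P = Polynomial.C (algebraMap A K r) * P := by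
      intro r P
      rw [← algebraMap_smul K r P, Polynomial.smul_eq_C_mul]
    have h3 : ∀ (r : A) (P : Polynomial K), (algebraMap A K r) • P = Polynomial.C (algebraMap A K r) * P := by
      intro r P
      rw [Polynomial.smul_eq_C_mul]
    simp only [h2, h3]
    linear_combination (Polynomial.C (algebraMap A K p) * Polynomial.C (algebraMap A K q)) * hUV
  · rw [hdeg]; exact hcard


lemma lift_point {A : Type} [CommRing A] [IsDomain A] [IsIntegrallyClosed A] {τ : Type} [Finite τ]
    [Algebra A (MvPolynomial τ ℂ)] [Module.Finite A (MvPolynomial τ ℂ)]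
    (hinj : Function.Injective (algebraMap A (MvPolynomial τ ℂ)))
    (θ : MvPolynomial τ ℂ) (e : A →+* ℂ) (ι : ℂ → A) (hι : ∀ c, e (ι c) = c ∧ algebraMap A (MvPolynomial τ ℂ) (ι c) = C c) (ρ : ℂ)
    (hρ : (minpoly A θ).eval₂ e ρ = 0) :
    ∃ z : τ → ℂ, eval z θ = ρ ∧ ∀ a : A, e a = 0 → eval z (algebraMap A _ a) = 0 := by
  have : FaithfulSMul A (MvPolynomial τ ℂ) := (faithfulSMul_iff_algebraMap_injective A _).2 hinj
  have hintegral : IsIntegral A θ := Algebra.IsIntegral.isIntegral θ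
  set m := minpoly A θ with hm
  let φ : AdjoinRoot m →+* ℂ := AdjoinRoot.lift e ρ hρ
  have hφ : Function.Surjective φ := by
    intro c
    exact ⟨AdjoinRoot.of m (ι c), by simp [φ, (hι c).1]⟩
  let ψ : AdjoinRoot m →+* MvPolynomial τ ℂ :=
    AdjoinRoot.lift (algebraMap A _) θ (by rw [← Polynomial.aeval_def]; exact minpoly.aeval A θ)
  have hψ : Function.Injective ψ := by
    rw [injective_iff_map_eq_zero]
    intro p hp
    obtain ⟨q, rfl⟩ := AdjoinRoot.mk_surjective p
    rw [AdjoinRoot.mk_eq_zero]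
    apply minpoly.isIntegrallyClosed_dvd hintegral
    simpa [ψ, Polynomial.aeval_def] using hp
  have hker : (RingHom.ker φ).IsMaximal := RingHom.ker_isMaximal_of_surjective φ hφ
  let : Algebra (AdjoinRoot m) (MvPolynomial τ ℂ) := ψ.toAlgebra
  have : IsScalarTower A (AdjoinRoot m) (MvPolynomial τ ℂ) := by
    apply IsScalarTower.of_algebraMap_eq
    intro a
    change _ = ψ (AdjoinRoot.of m a)
    simp [ψ]
  have : Algebra.IsIntegral (AdjoinRoot m) (MvPolynomial τ ℂ) :=
    ⟨fun x => (Algebra.IsIntegral.isIntegral (R := A) x).tower_top⟩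
  obtain ⟨Q, hQ, hQc⟩ := Ideal.exists_ideal_over_maximal_of_isIntegral (S := MvPolynomial τ ℂ)
    (RingHom.ker φ) (by
      change RingHom.ker ψ ≤ _
      rw [(RingHom.injective_iff_ker_eq_bot _).1 hψ]; exact bot_le)
  obtain ⟨z, hz⟩ := MvPolynomial.isMaximal_iff_eq_vanishingIdeal_singleton.1 hQ
  have key : ∀ p, φ p = 0 → eval z (ψ p) = 0 := by
    intro p hp
    have h1 : p ∈ Q.comap (algebraMap (AdjoinRoot m) (MvPolynomial τ ℂ)) := by
      rw [hQc]; exact hp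
    rw [Ideal.mem_comap, hz] at h1
    have := h1
    rw [MvPolynomial.mem_vanishingIdeal_singleton_iff] at this
    exact this
  refine ⟨z, ?_, ?_⟩
  · have := key (AdjoinRoot.root m - AdjoinRoot.of m (ι ρ)) (by simp [φ, (hι ρ).1])
    simp only [ψ, map_sub, AdjoinRoot.lift_root, AdjoinRoot.lift_of, (hι ρ).2, eval_C] at this
    linear_combination this
  · intro a ha
    have := key (AdjoinRoot.of m a) (by simp [φ, ha])
    simpa [ψ] using this


/-- enough points in some fibre of a finite map with `b` independent over `ℂ[g]` -/
lemma fiber {σ τ : Type} [Fintype σ] [Fintype τ] {B : Type} [Fintype B]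
    (g : σ → MvPolynomial τ ℂ)
    (hfin : (aeval g : MvPolynomial σ ℂ →ₐ[ℂ] MvPolynomial τ ℂ).toRingHom.Finite)
    (b : B → MvPolynomial τ ℂ)
    (hb : ∀ P : B → MvPolynomial σ ℂ, ∑ β, aeval g (P β) * b β = 0 → ∀ β, P β = 0) :
    ∃ (c : σ → ℂ) (z : B → τ → ℂ), Function.Injective z ∧ ∀ β k, eval (z β) (g k) = c k := by
  classical
  rcases isEmpty_or_nonempty B with hB | ⟨⟨β₀⟩⟩
  · exact ⟨0, fun β => hB.elim β, fun β => hB.elim β, fun β => hB.elim β⟩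
  let : Algebra (MvPolynomial σ ℂ) (MvPolynomial τ ℂ) := (aeval g).toRingHom.toAlgebra
  have hmap : ∀ p : MvPolynomial σ ℂ, algebraMap _ (MvPolynomial τ ℂ) p = aeval g p := fun _ => rfl
  have : Module.Finite (MvPolynomial σ ℂ) (MvPolynomial τ ℂ) := hfin
  have hinj : Function.Injective (algebraMap (MvPolynomial σ ℂ) (MvPolynomial τ ℂ)) := by
    rw [injective_iff_map_eq_zero]
    intro p hp
    rw [hmap] at hp
    exact hb (fun _ => p) (Finset.sum_eq_zero fun β _ => by rw [hp, zero_mul]) β₀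
  have hli : LinearIndependent (MvPolynomial σ ℂ) b := by
    rw [Fintype.linearIndependent_iff]
    intro P hP
    apply hb P
    simpa [Algebra.smul_def, hmap] using hP
  obtain ⟨θ, U, V, D, hD, hUV, hcard⟩ := prim_elt hinj b hli
  obtain ⟨c, hc⟩ := exists_eval_ne hD
  set m := minpoly (MvPolynomial σ ℂ) θ with hm
  have hintegral : IsIntegral (MvPolynomial σ ℂ) θ := Algebra.IsIntegral.isIntegral θ
  have hmon : m.Monic := minpoly.monic hintegral
  have hsep : (m.map (eval c)).Separable := by
    refine ⟨Polynomial.C (eval c D)⁻¹ * U.map (eval c), Polynomial.C (eval c D)⁻¹ * V.map (eval c), ?_⟩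
    have h1 := congrArg (Polynomial.map (eval c)) hUV
    simp only [Polynomial.map_add, Polynomial.map_mul, Polynomial.map_C] at h1
    rw [Polynomial.derivative_map, mul_assoc, mul_assoc, ← mul_add, h1, ← map_mul, inv_mul_cancel₀ hc, map_one]
  have hroots : Fintype.card B ≤ (m.map (eval c)).roots.toFinset.card := by
    rw [Multiset.toFinset_card_of_nodup (Polynomial.nodup_roots hsep),
      ← (IsAlgClosed.splits _).natDegree_eq_card_roots, hmon.natDegree_map]
    exact hcard
  have hpt : ∀ ρ ∈ (m.map (eval c)).roots.toFinset, ∃ z : τ → ℂ, eval z θ = ρ ∧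
      ∀ k, eval z (g k) = c k := by
    intro ρ hρ
    rw [Multiset.mem_toFinset, Polynomial.mem_roots', Polynomial.IsRoot, Polynomial.eval_map] at hρ
    obtain ⟨z, hz, hz2⟩ := lift_point hinj θ (eval c) C (fun c => ⟨by simp, by rw [hmap]; simp⟩) ρ hρ.2
    refine ⟨z, hz, fun k => ?_⟩
    have := hz2 (X k - C (c k)) (by simp)
    rw [hmap] at this
    simp only [map_sub, aeval_X, aeval_C, algebraMap_eq, eval_C] at this
    linear_combination this
  obtain ⟨f⟩ : Nonempty (B ↪ (m.map (eval c)).roots.toFinset) := by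
    apply Function.Embedding.nonempty_of_card_le
    simpa using hroots
  choose z hz1 hz2 using hpt
  refine ⟨c, fun β => z (f β) (f β).2, ?_, fun β k => hz2 _ _ k⟩
  intro β β' h
  apply f.injective
  apply Subtype.ext
  rw [← hz1 (f β) (f β).2, ← hz1 (f β') (f β').2]
  exact congrArg (fun z => eval z θ) h

section
variable {τ : Type} [Fintype τ]

def RegL : List (MvPolynomial τ ℂ) → Prop
  | [] => True
  | a :: rs => RegL rs ∧ ∀ m, a * m ∈ Ideal.ofList rs → m ∈ Ideal.ofList rs

def HomL (rs : List (MvPolynomial τ ℂ)) : Prop := ∀ r ∈ rs, ∃ e : ℕ, 1 ≤ e ∧ r.IsHomogeneous e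

lemma HomL.comp {rs : List (MvPolynomial τ ℂ)} (h : HomL rs) {m : MvPolynomial τ ℂ}
    (hm : m ∈ Ideal.ofList rs) (D : ℕ) : homogeneousComponent D m ∈ Ideal.ofList rs := by
  let : GradedAlgebra (homogeneousSubmodule τ ℂ) := MvPolynomial.gradedAlgebra
  refine homogeneousComponent_mem_of_mem (I := Ideal.ofList rs) (Ideal.homogeneous_span (homogeneousSubmodule τ ℂ) _ ?_) hm D
  intro r hr
  obtain ⟨e, -, he⟩ := h r hr
  exact ⟨e, he⟩

lemma ofList_cons_mem {a m : MvPolynomial τ ℂ} {rs : List (MvPolynomial τ ℂ)} :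
    m ∈ Ideal.ofList (a :: rs) ↔ ∃ q, ∃ j ∈ Ideal.ofList rs, m = a * q + j := by
  rw [Ideal.ofList_cons, Submodule.mem_sup]
  constructor
  · rintro ⟨y, hy, j, hj, rfl⟩
    obtain ⟨q, rfl⟩ := Ideal.mem_span_singleton'.1 hy
    exact ⟨q, j, hj, by ring⟩
  · rintro ⟨q, j, hj, rfl⟩
    exact ⟨a * q, Ideal.mem_span_singleton'.2 ⟨q, by ring⟩, j, hj, rfl⟩

lemma ofList_perm {rs rs' : List (MvPolynomial τ ℂ)} (h : rs.Perm rs') :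
    Ideal.ofList rs = Ideal.ofList rs' := by
  unfold Ideal.ofList
  congr 1
  ext x
  exact h.mem_iff

lemma nak {rs : List (MvPolynomial τ ℂ)} (h : HomL rs) {a : MvPolynomial τ ℂ} {e : ℕ} (he : 1 ≤ e)
    (ha : a.IsHomogeneous e) {m : MvPolynomial τ ℂ}
    (hm : ∀ k : ℕ, ∃ q, ∃ j ∈ Ideal.ofList rs, m = a ^ k * q + j) : m ∈ Ideal.ofList rs := by
  obtain ⟨q, j, hj, hq⟩ := hm (m.totalDegree + 1)
  rw [← sum_homogeneousComponent m]
  refine Ideal.sum_mem _ fun i hi => ?_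
  rw [Finset.mem_range] at hi
  have h1 : homogeneousComponent i (a ^ (m.totalDegree + 1) * q) = 0 := by
    rw [← sum_homogeneousComponent q, Finset.mul_sum, map_sum]
    refine Finset.sum_eq_zero fun x _ => ?_
    have h2 := (ha.pow (m.totalDegree + 1)).mul (homogeneousComponent_isHomogeneous x q)
    rw [homogeneousComponent_of_mem h2, if_neg]
    nlinarith
  rw [hq, map_add, h1, zero_add]
  exact h.comp hj i

lemma RegL.perm {rs rs' : List (MvPolynomial τ ℂ)} (p : rs.Perm rs') (hh : HomL rs)
    (h : RegL rs) : RegL rs' := by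
  induction p with
  | nil => trivial
  | cons x p ih =>
    refine ⟨ih (fun r hr => hh r (List.mem_cons_of_mem _ hr)) h.1, ?_⟩
    rw [← ofList_perm p]
    exact h.2
  | swap a b t =>
    -- h : RegL (b :: a :: t)
    obtain ⟨⟨ht, ha⟩, hb⟩ := h
    have hht : HomL t := fun r hr => hh r (by simp [hr])
    obtain ⟨e, he, hae⟩ := hh a (by simp)
    refine ⟨⟨ht, ?_⟩, ?_⟩
    · have key : ∀ m, b * m ∈ Ideal.ofList t → ∃ m', b * m' ∈ Ideal.ofList t ∧
          ∃ j ∈ Ideal.ofList t, m = a * m' + j := by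
        intro m hm
        obtain ⟨q, j, hj, hq⟩ := ofList_cons_mem.1 (hb m (by
          rw [ofList_cons_mem]; exact ⟨0, _, hm, by simp⟩))
        refine ⟨q, ?_, j, hj, hq⟩
        apply ha
        have : a * (b * q) = b * m - b * j := by rw [hq]; ring
        rw [this]
        exact Ideal.sub_mem _ hm (Ideal.mul_mem_left _ _ hj)
      intro m hm
      apply nak hht he hae
      intro k
      suffices ∃ q, b * q ∈ Ideal.ofList t ∧ ∃ j ∈ Ideal.ofList t, m = a ^ k * q + j by
        obtain ⟨q, -, h⟩ := this
        exact ⟨q, h⟩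
      induction k with
      | zero => exact ⟨m, hm, 0, Ideal.zero_mem _, by simp⟩
      | succ k ih =>
        obtain ⟨q, hq, j, hj, e1⟩ := ih
        obtain ⟨q', hq', j', hj', e2⟩ := key q hq
        exact ⟨q', hq', a ^ k * j' + j, Ideal.add_mem _ (Ideal.mul_mem_left _ _ hj') hj,
          by rw [e1, e2]; ring⟩
    · intro m hm
      obtain ⟨n, j, hj, e1⟩ := ofList_cons_mem.1 hm
      obtain ⟨n', j', hj', e2⟩ := ofList_cons_mem.1 (hb n (by
        rw [ofList_cons_mem]; exact ⟨m, -j, Ideal.neg_mem_iff _ |>.2 hj, by rw [e1]; ring⟩))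
      rw [ofList_cons_mem]
      refine ⟨n', m - b * n', ?_, by ring⟩
      apply ha
      have : a * (m - b * n') = b * j' + j := by rw [mul_sub, e1, e2]; ring
      rw [this]
      exact Ideal.add_mem _ (Ideal.mul_mem_left _ _ hj') hj
  | trans p q ih1 ih2 =>
    exact ih2 (fun r hr => hh r (p.mem_iff.2 hr)) (ih1 hh h)

lemma RegL.exchange {l g : MvPolynomial τ ℂ} {rs : List (MvPolynomial τ ℂ)} (h : RegL (l :: rs))
    {k : ℕ} (hk : l ^ k ∈ Ideal.ofList (g :: rs)) : RegL (g :: rs) := by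
  refine ⟨h.1, fun m hm => ?_⟩
  obtain ⟨q, j, hj, e⟩ := ofList_cons_mem.1 hk
  have h1 : l ^ k * m ∈ Ideal.ofList rs := by
    have : l ^ k * m = q * (g * m) + m * j := by rw [e]; ring
    rw [this]
    exact Ideal.add_mem _ (Ideal.mul_mem_left _ _ hm) (Ideal.mul_mem_left _ _ hj)
  clear hk e
  induction k with
  | zero => simpa using h1
  | succ k ih => exact ih (h.2 _ (by rw [pow_succ'] at h1; rwa [← mul_assoc]))

def ZeroL (rs : List (MvPolynomial τ ℂ)) : Prop := ∀ z : τ → ℂ, (∀ r ∈ rs, eval z r = 0) → z = 0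

lemma ZeroL.pow {rs : List (MvPolynomial τ ℂ)} (h : ZeroL rs) {f : MvPolynomial τ ℂ}
    (hf : eval 0 f = 0) : ∃ k, f ^ k ∈ Ideal.ofList rs := by
  have : f ∈ (Ideal.ofList rs).radical := by
    rw [← MvPolynomial.vanishingIdeal_zeroLocus_eq_radical (K := ℂ)]
    rw [mem_vanishingIdeal_iff]
    intro z hz
    rw [h z, ]
    · exact hf
    · intro r hr
      exact hz r (Ideal.subset_span hr)
  exact this

end

section
variable {τ : Type} [Fintype τ]

lemma hc_mul_lt {l : MvPolynomial τ ℂ} {a D : ℕ} (hl : l.IsHomogeneous a) (hD : D < a)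
    (q : MvPolynomial τ ℂ) : homogeneousComponent D (l * q) = 0 := by
  rw [← sum_homogeneousComponent q, Finset.mul_sum, map_sum]
  refine Finset.sum_eq_zero fun x _ => ?_
  rw [homogeneousComponent_of_mem (hl.mul (homogeneousComponent_isHomogeneous x q)), if_neg]
  omega

lemma homog_span {n : ℕ} {g : Fin n → MvPolynomial τ ℂ} {e : Fin n → ℕ}
    (hg : ∀ k, (g k).IsHomogeneous (e k)) {D : ℕ} {f : MvPolynomial τ ℂ} (hf : f.IsHomogeneous D)
    (hm : f ∈ Ideal.span (Set.range g)) :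
    ∃ h : Fin n → MvPolynomial τ ℂ, (∀ k, (h k).IsHomogeneous (D - e k)) ∧
      (∀ k, D < e k → h k = 0) ∧ f = ∑ k, h k * g k := by
  obtain ⟨q, hq⟩ := Ideal.mem_span_range_iff_exists_fun.1 hm
  refine ⟨fun k => if D < e k then 0 else homogeneousComponent (D - e k) (q k), ?_, ?_, ?_⟩
  · intro k
    dsimp only
    split_ifs
    · exact isHomogeneous_zero _ _ _
    · exact homogeneousComponent_isHomogeneous _ _
  · intro k hk
    simp [hk]
  · have h1 : homogeneousComponent D f = f := by
      rw [homogeneousComponent_of_mem hf, if_pos rfl]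
    rw [← h1, ← hq, map_sum]
    refine Finset.sum_congr rfl fun k _ => ?_
    dsimp only
    split_ifs with h
    · rw [mul_comm, hc_mul_lt (hg k) h, zero_mul]
    · have : D = e k + (D - e k) := by omega
      conv_lhs => rw [this, mul_comm, hc_mul (hg k), mul_comm]

lemma finite_of_zero {n : ℕ} {g : Fin n → MvPolynomial τ ℂ} {e : Fin n → ℕ}
    (hg : ∀ k, (g k).IsHomogeneous (e k)) (he : ∀ k, 1 ≤ e k)
    (hz : ∀ z : τ → ℂ, (∀ k, eval z (g k) = 0) → z = 0) :
    (aeval g : MvPolynomial (Fin n) ℂ →ₐ[ℂ] MvPolynomial τ ℂ).toRingHom.Finite := by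
  classical
  have hrad : idealOfVars τ ℂ ≤ (Ideal.span (Set.range g)).radical := by
    rw [← MvPolynomial.vanishingIdeal_zeroLocus_eq_radical (K := ℂ)]
    unfold idealOfVars
    rw [Ideal.span_le]
    rintro _ ⟨i, rfl⟩
    rw [SetLike.mem_coe, mem_vanishingIdeal_iff]
    intro z hz'
    rw [hz z fun k => hz' _ (Ideal.subset_span ⟨k, rfl⟩)]
    simp
  obtain ⟨M, hM⟩ := Ideal.exists_pow_le_of_le_radical_of_fg hrad (idealOfVars_fg τ ℂ)
  have hin : ∀ D, M ≤ D → ∀ f : MvPolynomial τ ℂ, f.IsHomogeneous D → f ∈ Ideal.span (Set.range g) := by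
    intro D hD f hf
    apply hM
    rw [mem_pow_idealOfVars_iff']
    intro x hx
    exact hf.coeff_eq_zero (by omega)
  let : Algebra (MvPolynomial (Fin n) ℂ) (MvPolynomial τ ℂ) :=
    (aeval g : MvPolynomial (Fin n) ℂ →ₐ[ℂ] MvPolynomial τ ℂ).toRingHom.toAlgebra
  have hmap : ∀ p : MvPolynomial (Fin n) ℂ, algebraMap _ (MvPolynomial τ ℂ) p = aeval g p := fun _ => rfl
  change Module.Finite (MvPolynomial (Fin n) ℂ) (MvPolynomial τ ℂ)
  have hfs := Finsupp.finite_of_degree_le (σ := τ) M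
  set S : Submodule (MvPolynomial (Fin n) ℂ) (MvPolynomial τ ℂ) :=
    Submodule.span _ ((fun m : τ →₀ ℕ => monomial m (1:ℂ)) '' {m | m.degree ≤ M}) with hS
  have key : ∀ D, ∀ f : MvPolynomial τ ℂ, f.IsHomogeneous D → f ∈ S := by
    intro D
    induction D using Nat.strong_induction_on with
    | _ D ih =>
      intro f hf
      rcases le_or_gt M D with hD | hD
      · obtain ⟨h, hh, h0, hs⟩ := homog_span hg hf (hin D hD f hf)
        rw [hs]
        refine S.sum_mem fun k _ => ?_
        by_cases hk : D < e k
        · rw [h0 k hk, zero_mul]; exact S.zero_mem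
        · have h1 := S.smul_mem (X k) (ih (D - e k) (by have := he k; omega) _ (hh k))
          rw [Algebra.smul_def, hmap, aeval_X, mul_comm] at h1
          exact h1
      · rw [f.as_sum]
        refine S.sum_mem fun m hm => ?_
        have h1 : (monomial m (coeff m f)) = (C (coeff m f) : MvPolynomial (Fin n) ℂ) • (monomial m (1:ℂ) : MvPolynomial τ ℂ) := by
          rw [Algebra.smul_def, hmap, aeval_C, algebraMap_eq, C_mul_monomial, mul_one]
        rw [h1]
        apply S.smul_mem
        apply Submodule.subset_span
        refine ⟨m, ?_, rfl⟩
        have := homog_degree hf (mem_support_iff.1 hm)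
        change m.degree ≤ M
        omega
  refine ⟨⟨(hfs.image (fun m : τ →₀ ℕ => monomial m (1:ℂ))).toFinset, ?_⟩⟩
  rw [Set.Finite.coe_toFinset, eq_top_iff]
  intro f _
  rw [← sum_homogeneousComponent f]
  exact S.sum_mem fun i _ => key i _ (homogeneousComponent_isHomogeneous i f)

/-- choice of a linear parameter -/
lemma choice {rs : List (MvPolynomial τ ℂ)} {g : MvPolynomial τ ℂ} (hh : HomL (g :: rs))
    (hz : ZeroL (g :: rs)) : ∃ w : τ → ℂ, ZeroL (lin w :: rs) := by
  classical
  set G : Fin (g :: rs).length → MvPolynomial τ ℂ := (g :: rs).get with hG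
  have hG0 : G ⟨0, by simp⟩ = g := rfl
  have h1 : ∀ k, ∃ e : ℕ, 1 ≤ e ∧ (G k).IsHomogeneous e := fun k => hh _ (List.get_mem _ _)
  choose e he hGe using h1
  have hfin := finite_of_zero hGe he (fun z h => hz z (by
    intro r hr
    obtain ⟨k, rfl⟩ := List.get_of_mem hr
    exact h k))
  have hW : {z : τ → ℂ | eval z g = 1 ∧ ∀ r ∈ rs, eval z r = 0}.Finite := by
    have hintegral : ∀ i : τ, ∃ p : Polynomial (MvPolynomial (Fin (g :: rs).length) ℂ), p.Monic ∧
        p.eval₂ (aeval G : _ →ₐ[ℂ] MvPolynomial τ ℂ).toRingHom (X i) = 0 := fun i => hfin.to_isIntegral (X i)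
    choose p hp hp0 using hintegral
    let c : Fin (g :: rs).length → ℂ := fun k => if k.1 = 0 then 1 else 0
    refine Set.Finite.subset (Set.Finite.pi' (t := fun i => {x | x ∈ ((p i).map (eval c)).roots.toFinset})
      (fun i => Finset.finite_toSet _)) ?_
    rintro z ⟨hz1, hz2⟩ i
    have hGc : ∀ k, eval z (G k) = c k := by
      rintro ⟨k, hk⟩
      rcases k with _ | k
      · simpa [c, hG] using hz1
      · have : eval z (G ⟨k+1, hk⟩) = 0 := hz2 _ (by simp [hG])
        rw [this]; simp [c]
    have hcomp : (eval z).comp (aeval G : _ →ₐ[ℂ] MvPolynomial τ ℂ).toRingHom = eval c := by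
      apply MvPolynomial.ringHom_ext
      · intro a; simp
      · intro k; simp [hGc k]
    have h3 := congrArg (eval z) (hp0 i)
    rw [Polynomial.hom_eval₂, hcomp, map_zero, eval_X] at h3
    change z i ∈ ((p i).map (eval c)).roots.toFinset
    rw [Multiset.mem_toFinset, Polynomial.mem_roots ((hp i).map _).ne_zero, Polynomial.IsRoot, Polynomial.eval_map]
    exact h3
  have : Fintype {z : τ → ℂ | eval z g = 1 ∧ ∀ r ∈ rs, eval z r = 0} := hW.fintype
  obtain ⟨w, -, hw⟩ := generic_vec (fun z : {z : τ → ℂ | eval z g = 1 ∧ ∀ r ∈ rs, eval z r = 0} => z.1)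
  refine ⟨w, fun z hzr => ?_⟩
  by_contra hz0
  have hrs : ∀ r ∈ rs, eval z r = 0 := fun r hr => hzr r (by simp [hr])
  have hgz : eval z g ≠ 0 := fun h => hz0 (hz z (by
    intro r hr
    rcases List.mem_cons.1 hr with rfl | hr
    · exact h
    · exact hrs r hr))
  obtain ⟨E, hE, hgE⟩ := hh g (by simp)
  obtain ⟨t, ht⟩ := IsAlgClosed.exists_pow_nat_eq ((eval z g)⁻¹) (n := E) (by omega)
  have ht0 : t ≠ 0 := by
    rintro rfl
    rw [zero_pow (by omega)] at ht
    exact inv_ne_zero hgz ht.symm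
  refine hw ⟨t • z, ?_, ?_⟩ ?_ ?_
  · rw [eval_smul_homog hgE, ht, inv_mul_cancel₀ hgz]
  · intro r hr
    obtain ⟨e', -, hre⟩ := hh r (by simp [hr])
    rw [eval_smul_homog hre, hrs r hr, mul_zero]
  · exact smul_ne_zero ht0 hz0
  · have h4 := hzr (lin w) (by simp)
    rw [eval_lin] at h4
    simp only [Pi.smul_apply, smul_eq_mul]
    have : ∑ a, w a * (t * z a) = t * ∑ a, w a * z a := by
      rw [Finset.mul_sum]; exact Finset.sum_congr rfl fun a _ => by ring
    rw [this, h4, mul_zero]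

end

section
variable {τ : Type} [Fintype τ]

lemma RegL_X {κ : Type} [Fintype κ] (L : List κ) (hL : L.Nodup) :
    RegL (L.map (fun k => (X k : MvPolynomial κ ℂ))) := by
  classical
  induction L with
  | nil => trivial
  | cons a L ih =>
    rw [List.nodup_cons] at hL
    refine ⟨ih hL.2, fun m hm => ?_⟩
    have h1 : Ideal.ofList (L.map (fun k => (X k : MvPolynomial κ ℂ))) = Ideal.span (X '' {k | k ∈ L}) := by
      unfold Ideal.ofList
      congr 1
      ext x
      simp
    rw [h1, mem_ideal_span_X_image] at hm ⊢
    intro s hs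
    have h2 : s + Finsupp.single a 1 ∈ (X a * m).support := by
      rw [mem_support_iff, mul_comm, coeff_mul_X]
      exact mem_support_iff.1 hs
    obtain ⟨i, hi, h3⟩ := hm _ h2
    refine ⟨i, hi, ?_⟩
    have : i ≠ a := by rintro rfl; exact hL.1 hi
    simpa [Finsupp.single_apply, this.symm] using h3

lemma ofList_map {κ : Type} [Fintype κ] (f : MvPolynomial τ ℂ →ₐ[ℂ] MvPolynomial κ ℂ)
    {rs : List (MvPolynomial τ ℂ)} {m : MvPolynomial τ ℂ} (hm : m ∈ Ideal.ofList rs) :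
    f m ∈ Ideal.ofList (rs.map f) := by
  have := Ideal.mem_map_of_mem f.toRingHom hm
  rw [Ideal.map_ofList] at this
  exact this

lemma RegL_of_map {κ : Type} [Fintype κ] (f : MvPolynomial τ ℂ →ₐ[ℂ] MvPolynomial κ ℂ)
    (g : MvPolynomial κ ℂ →ₐ[ℂ] MvPolynomial τ ℂ) (hgf : ∀ x, g (f x) = x)
    (rs : List (MvPolynomial τ ℂ)) (h : RegL (rs.map f)) : RegL rs := by
  induction rs with
  | nil => trivial
  | cons a rs ih =>
    refine ⟨ih h.1, fun m hm => ?_⟩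
    have h1 := h.2 (f m) (by rw [← map_mul]; exact ofList_map f hm)
    have h2 := ofList_map g h1
    rw [hgf, List.map_map] at h2
    convert h2
    symm
    conv_rhs => rw [← List.map_id rs]
    exact List.map_congr_left fun x _ => hgf x

lemma lin_def {κ : Type} [Fintype κ] (w : κ → ℂ) : lin w = ∑ i, C (w i) * X i := rfl

lemma RegL_lin (ws : List (τ → ℂ)) (hl : ws.length = Fintype.card τ) (hz : ZeroL (ws.map lin)) :
    RegL (ws.map lin) := by
  classical
  set w : Fin ws.length → τ → ℂ := ws.get with hw
  let Λ : (τ → ℂ) →ₗ[ℂ] (Fin ws.length → ℂ) := (Matrix.of w).mulVecLin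
  have hΛ : ∀ z k, Λ z k = ∑ i, w k i * z i := fun z k => rfl
  have hinj : Function.Injective Λ := by
    rw [injective_iff_map_eq_zero]
    intro z h
    apply hz
    intro r hr
    obtain ⟨v, hv, rfl⟩ := List.mem_map.1 hr
    obtain ⟨k, rfl⟩ := List.get_of_mem hv
    rw [eval_lin]
    exact congrFun h k
  let E := LinearEquiv.ofInjectiveOfFinrankEq Λ hinj (by simp [hl])
  have hE : ∀ z, E z = Λ z := fun z => rfl
  let f : MvPolynomial τ ℂ →ₐ[ℂ] MvPolynomial (Fin ws.length) ℂ :=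
    aeval (fun i => lin (fun k => E.symm (Pi.single k 1) i))
  let g : MvPolynomial (Fin ws.length) ℂ →ₐ[ℂ] MvPolynomial τ ℂ := aeval (fun k => lin (w k))
  have hflin : ∀ {κ κ' : Type} [Fintype κ] [Fintype κ'] (v : κ → κ' → ℂ) (u : κ → ℂ),
      aeval (fun i => lin (v i)) (lin u) = lin (fun k => ∑ i, u i * v i k) := by
    intro κ κ' _ _ v u
    rw [lin_def u, map_sum]
    simp only [map_mul, aeval_C, aeval_X, algebraMap_eq]
    simp only [lin_def, Finset.mul_sum, map_sum, Finset.sum_mul, map_mul]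
    rw [Finset.sum_comm]
    exact Finset.sum_congr rfl fun _ _ => Finset.sum_congr rfl fun _ _ => by ring
  apply RegL_of_map f g
  · intro x
    have : g.comp f = AlgHom.id ℂ _ := by
      apply MvPolynomial.algHom_ext
      intro i
      rw [AlgHom.comp_apply]
      simp only [f, g, aeval_X, AlgHom.id_apply]
      rw [hflin]
      rw [← lin_single]
      congr 1
      ext j
      have h1 : (Pi.single j 1 : τ → ℂ) = E.symm (∑ k, w k j • Pi.single k (1:ℂ)) := by
        rw [LinearEquiv.eq_symm_apply, hE]
        ext k
        rw [hΛ]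
        simp [Pi.single_apply, Finset.sum_apply]
      have h2 := congrFun h1 i
      rw [map_sum, Finset.sum_apply] at h2
      simp only [map_smul, Pi.smul_apply, smul_eq_mul] at h2
      rw [Pi.single_comm] at h2
      rw [h2]
      exact Finset.sum_congr rfl fun k _ => mul_comm _ _
    exact AlgHom.congr_fun this x
  · have : (ws.map lin).map f = (List.finRange ws.length).map (fun k => (X k : MvPolynomial (Fin ws.length) ℂ)) := by
      apply List.ext_get
      · simp
      · intro k hk hk'
        simp only [List.get_eq_getElem, List.getElem_map, List.getElem_finRange]
        have hk2 : k < ws.length := by simpa using hk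
        have hwk : ws[k] = w ⟨k, hk2⟩ := rfl
        rw [hwk]
        simp only [f]
        rw [hflin, ← lin_single]
        congr 1
        ext l
        have h1 := hΛ (E.symm (Pi.single l 1)) ⟨k, hk2⟩
        rw [← hE, LinearEquiv.apply_symm_apply] at h1
        rw [← h1, Pi.single_comm]
        rfl
    rw [this]
    exact RegL_X _ (List.nodup_finRange _)

theorem RegL_of_zero (gs : List (MvPolynomial τ ℂ)) : ∀ (ws : List (τ → ℂ)),
    gs.length + ws.length = Fintype.card τ → HomL gs → ZeroL (gs ++ ws.map lin) →
    RegL (gs ++ ws.map lin) := by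
  induction gs with
  | nil =>
    intro ws hl _ hz
    exact RegL_lin ws (by simpa using hl) hz
  | cons g gs ih =>
    intro ws hl hh hz
    have hhw : HomL (ws.map (lin : (τ → ℂ) → _)) := by
      intro r hr
      obtain ⟨v, -, rfl⟩ := List.mem_map.1 hr
      exact ⟨1, le_rfl, lin_isHomogeneous v⟩
    have hgs : HomL gs := fun r hr => hh r (by simp [hr])
    have hhall : HomL (g :: (gs ++ ws.map lin)) := by
      intro r hr
      rcases List.mem_cons.1 hr with rfl | hr
      · exact hh _ (by simp)
      · rcases List.mem_append.1 hr with hr | hr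
        · exact hgs r hr
        · exact hhw r hr
    obtain ⟨v, hv⟩ := choice hhall hz
    have p : (gs ++ (v :: ws).map lin).Perm (lin v :: (gs ++ ws.map lin)) := by
      rw [List.map_cons]; exact List.perm_middle
    have h1 := ih (v :: ws) (by simp only [List.length_cons] at hl ⊢; omega) hgs (by
      intro z h
      exact hv z fun r hr => h r (p.mem_iff.2 hr))
    have h2 := h1.perm p (by
      intro r hr
      rcases List.mem_cons.1 (p.mem_iff.1 hr) with rfl | hr
      · exact ⟨1, le_rfl, lin_isHomogeneous v⟩
      · exact hhall r (by simp at hr ⊢; tauto))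
    obtain ⟨k, hk⟩ := hz.pow (f := lin v) (by rw [eval_lin]; simp)
    exact h2.exchange hk

lemma RegL.fam {n : ℕ} (f : Fin n → MvPolynomial τ ℂ) (h : RegL (List.ofFn f)) (k : Fin n)
    (m : MvPolynomial τ ℂ) (hm : f k * m ∈ Ideal.span (f '' {j | k < j})) :
    m ∈ Ideal.span (f '' {j | k < j}) := by
  induction n with
  | zero => exact k.elim0
  | succ n ih =>
    rw [List.ofFn_succ] at h
    refine Fin.cases (motive := fun k => f k * m ∈ Ideal.span (f '' {j | k < j}) →
      m ∈ Ideal.span (f '' {j | k < j})) ?_ ?_ k hm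
    · have h1 : Ideal.ofList (List.ofFn fun i => f i.succ) = Ideal.span (f '' {j | 0 < j}) := by
        unfold Ideal.ofList
        congr 1
        ext x
        simp only [List.mem_ofFn', Set.mem_range, Set.mem_image, Set.mem_ofPred_eq]
        constructor
        · rintro ⟨i, rfl⟩; exact ⟨i.succ, Fin.succ_pos i, rfl⟩
        · rintro ⟨i, hi, rfl⟩
          exact ⟨i.pred hi.ne', by simp⟩
      rw [← h1]
      exact h.2 m
    · intro k hm
      have h1 : f '' {j | k.succ < j} = (fun i : Fin n => f i.succ) '' {j | k < j} := by
        ext x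
        simp only [Set.mem_image, Set.mem_ofPred_eq]
        constructor
        · rintro ⟨i, hi, rfl⟩
          have h0 : i ≠ 0 := (lt_of_le_of_lt (Fin.zero_le _) hi).ne'
          exact ⟨i.pred h0, by rwa [← Fin.succ_lt_succ_iff, Fin.succ_pred], by simp⟩
        · rintro ⟨i, hi, rfl⟩
          exact ⟨i.succ, by simpa using hi, rfl⟩
      rw [h1] at hm ⊢
      exact ih _ h.1 k hm

lemma indep_of_reg {n : ℕ} (f : Fin n → MvPolynomial τ ℂ)
    (hf : ∀ k m, f k * m ∈ Ideal.span (f '' {j | k < j}) → m ∈ Ideal.span (f '' {j | k < j}))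
    {B : Type} [Fintype B] (b : B → MvPolynomial τ ℂ)
    (hb : ∀ c : B → ℂ, ∑ β, c β • b β ∈ Ideal.span (Set.range f) → ∀ β, c β = 0)
    (P : B → MvPolynomial (Fin n) ℂ) (hP : ∑ β, aeval f (P β) * b β = 0) (β : B) : P β = 0 := by
  classical
  let J : ℕ → Ideal (MvPolynomial τ ℂ) := fun s => Ideal.span (f '' {j | s ≤ j.1})
  have hJ : ∀ s (Q : MvPolynomial (Fin n) ℂ),
      (∀ m, (∀ j : Fin n, s ≤ j.1 → m j = 0) → coeff m Q = 0) → aeval f Q ∈ J s := by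
    intro s Q hQ
    have h1 : Q ∈ Ideal.span ((X : Fin n → MvPolynomial (Fin n) ℂ) '' {j | s ≤ j.1}) := by
      rw [mem_ideal_span_X_image]
      intro m hm
      by_contra hne
      push Not at hne
      exact mem_support_iff.1 hm (hQ m fun j hj => hne j hj)
    have h2 := Ideal.mem_map_of_mem (aeval f : MvPolynomial (Fin n) ℂ →ₐ[ℂ] MvPolynomial τ ℂ) h1
    rw [Ideal.map_span, ← Set.image_comp] at h2
    convert h2 using 3
    ext j
    simp
  have key : ∀ s, s ≤ n → ∀ P : B → MvPolynomial (Fin n) ℂ, ∑ β, aeval f (P β) * b β ∈ J s →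
      ∀ β m, (∀ j : Fin n, s ≤ j.1 → m j = 0) → coeff m (P β) = 0 := by
    intro s
    induction s with
    | zero =>
      intro _ P hP β m hm
      have hm0 : m = 0 := by ext j; simpa using hm j (Nat.zero_le _)
      subst hm0
      have hJ0 : J 0 = Ideal.span (Set.range f) := by simp [J]
      refine hb (fun β => coeff 0 (P β)) ?_ β
      rw [← hJ0]
      have h1 : ∑ β, aeval f (P β - C (coeff 0 (P β))) * b β ∈ J 0 := by
        refine Ideal.sum_mem _ fun β _ => Ideal.mul_mem_right _ _ (hJ 0 _ ?_)
        intro m hm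
        have hm0 : m = 0 := by ext j; simpa using hm j (Nat.zero_le _)
        subst hm0
        simp
      have h2 := Ideal.sub_mem _ hP h1
      rw [← Finset.sum_sub_distrib] at h2
      convert h2 using 2 with β
      simp [smul_eq_C_mul, sub_mul]
    | succ s ih =>
      intro hs P hP
      have hsJ : J (s+1) ≤ J s := by
        refine Ideal.span_mono (Set.image_mono ?_)
        intro j hj
        have : s + 1 ≤ j.1 := hj
        exact Nat.le_of_succ_le this
      let k : Fin n := ⟨s, hs⟩
      have hnz : ∀ t m, f k ^ t * m ∈ J (s+1) → m ∈ J (s+1) := by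
        have hk : J (s+1) = Ideal.span (f '' {j | k < j}) := by
          rfl
        intro t
        induction t with
        | zero => intro m hm; simpa using hm
        | succ t iht =>
          intro m hm
          apply iht
          rw [pow_succ', mul_assoc] at hm
          rw [hk] at hm ⊢
          exact hf k _ hm
      have main : ∀ t, ∀ β m, (∀ j : Fin n, s + 1 ≤ j.1 → m j = 0) → m k = t →
          coeff m (P β) = 0 := by
        intro t
        induction t using Nat.strong_induction_on with
        | _ t iht =>
        intro β m hm hmk
        let P' : B → MvPolynomial (Fin n) ℂ := fun β => divMonomial (P β) (Finsupp.single k t)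
        have hdec : ∀ β, P β = X k ^ t * P' β + modMonomial (P β) (Finsupp.single k t) := by
          intro β
          have := divMonomial_add_modMonomial (P β) (Finsupp.single k t)
          rw [X_pow_eq_monomial]
          exact this.symm
        have h1 : ∑ β, aeval f (modMonomial (P β) (Finsupp.single k t)) * b β ∈ J (s+1) := by
          refine Ideal.sum_mem _ fun β _ => Ideal.mul_mem_right _ _ (hJ _ _ ?_)
          intro m hm
          by_cases hle : Finsupp.single k t ≤ m
          · exact coeff_modMonomial_of_le _ hle
          · rw [coeff_modMonomial_of_not_le _ hle]
            refine iht (m k) ?_ β m hm rfl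
            by_contra hc
            exact hle (by rw [Finsupp.single_le_iff]; omega)
        have h2 : ∑ β, aeval f (P' β) * b β ∈ J (s+1) := by
          apply hnz t
          have h3 := Ideal.sub_mem _ hP h1
          rw [← Finset.sum_sub_distrib] at h3
          rw [Finset.mul_sum]
          convert h3 using 2 with β
          have := congrArg (aeval f) (hdec β)
          rw [map_add, map_mul, map_pow, aeval_X] at this
          rw [this]
          ring
        have hle : Finsupp.single k t ≤ m := by rw [Finsupp.single_le_iff]; omega
        have h3 := ih (by omega) P' (hsJ h2) β (m - Finsupp.single k t) ?_
        · rw [coeff_divMonomial, add_tsub_cancel_of_le hle] at h3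
          exact h3
        · intro j hj
          rw [Finsupp.tsub_apply]
          by_cases hjk : j = k
          · subst hjk; simp [hmk]
          · rw [hm j ?_, Nat.zero_sub]
            have : j.1 ≠ s := fun h => hjk (Fin.ext h)
            omega
      intro β m hm
      exact main (m k) β m hm rfl
  ext m
  rw [coeff_zero]
  refine key n le_rfl P (by rw [hP]; exact Ideal.zero_mem _) β m ?_
  intro j hj
  have := j.2
  omega

end

section fam5
variable {N : ℕ}

/-- a homogeneous generating condition -/
structure CI (a δ : ℕ) (G : MvPolynomial (Fin N) ℂ) (g : Fin N → MvPolynomial (Fin N) ℂ)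
    (e : Fin N → ℕ) : Prop where
  ha : 2 ≤ a
  hG : G.IsHomogeneous δ
  hG0 : G ≠ 0
  hg : ∀ k, (g k).IsHomogeneous (e k)
  he : ∀ k, a + 1 ≤ e k
  hI : ∀ h, Perp G h ↔ h ∈ Ideal.span (Set.range g)

variable {a δ : ℕ} {G : MvPolynomial (Fin N) ℂ} {g : Fin N → MvPolynomial (Fin N) ℂ}
    {e : Fin N → ℕ}

lemma CI.high (H : CI a δ G g e) {f : MvPolynomial (Fin N) ℂ} {k : ℕ} (hf : f.IsHomogeneous k)
    (hk : δ < k) : Perp G f := by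
  refine perp_of_homog H.hG hf fun q k' _ hk' => ?_
  omega

lemma CI.zero (H : CI a δ G g e) (z : Fin N → ℂ) (hz : ∀ k, eval z (g k) = 0) : z = 0 := by
  ext i
  have h1 : (X i : MvPolynomial (Fin N) ℂ) ^ (δ + 1) ∈ Ideal.span (Set.range g) := by
    rw [← H.hI]
    exact H.high (k := δ + 1) (by simpa using (isHomogeneous_X ℂ i).pow (δ + 1)) (by omega)
  obtain ⟨q, hq⟩ := Ideal.mem_span_range_iff_exists_fun.1 h1
  have := congrArg (eval z) hq
  rw [map_sum, map_pow, eval_X, Finset.sum_eq_zero] at this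
  · simpa using (pow_eq_zero_iff (by omega)).1 this.symm
  · intro k _; rw [map_mul, hz, mul_zero]

/-- monomial basis modulo the ideal -/
lemma CI.basis (H : CI a δ G g e) : ∃ M : Finset (Fin N →₀ ℕ),
    (∀ c : M → ℂ, ∑ m : M, c m • (monomial m.1 1 : MvPolynomial (Fin N) ℂ) ∈
      Ideal.span (Set.range g) → ∀ m, c m = 0) ∧
    ∀ f k, f.IsHomogeneous k → ∃ c : M → ℂ, (∀ m, c m ≠ 0 → m.1.degree = k) ∧
      f - ∑ m : M, c m • (monomial m.1 1 : MvPolynomial (Fin N) ℂ) ∈ Ideal.span (Set.range g) := by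
  classical
  let I := Ideal.span (Set.range g)
  let v : (Fin N →₀ ℕ) → MvPolynomial (Fin N) ℂ ⧸ I := fun m => Ideal.Quotient.mkₐ ℂ I (monomial m 1)
  obtain ⟨b, -, -, hsp, hb⟩ := exists_linearIndepOn_extension (K := ℂ) (v := v)
    (s := ∅) (t := Set.univ) (linearIndepOn_empty ℂ v) (Set.empty_subset _)
  have hfin : b.Finite := by
    refine (Finsupp.finite_of_degree_le (σ := Fin N) δ).subset ?_
    intro m hm
    by_contra hc
    have hc' : δ < m.degree := by simpa using hc
    have h0 : v m = 0 := by
      refine (Ideal.Quotient.eq_zero_iff_mem).2 ((H.hI _).1 (H.high (isHomogeneous_monomial 1 rfl) hc'))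
    exact hb.ne_zero hm h0
  refine ⟨hfin.toFinset, ?_, ?_⟩
  · intro c hc m
    have h1 : LinearIndependent ℂ (fun m : hfin.toFinset => v m.1) := by
      have h2 : LinearIndependent ℂ (fun m : b => v m.1) := hb
      exact h2.comp (fun m : hfin.toFinset => (⟨m.1, hfin.mem_toFinset.1 m.2⟩ : b))
        (fun x y hxy => Subtype.ext (by simpa using hxy))
    rw [Fintype.linearIndependent_iff] at h1
    refine h1 c ?_ m
    have h3 : Ideal.Quotient.mkₐ ℂ I (∑ m : hfin.toFinset, c m • (monomial m.1 1 : MvPolynomial (Fin N) ℂ)) = 0 :=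
      (Ideal.Quotient.eq_zero_iff_mem).2 hc
    rw [map_sum] at h3
    simpa only [map_smul] using h3
  · intro f k hf
    have h1 : Ideal.Quotient.mkₐ ℂ I f ∈ Submodule.span ℂ (v '' b) := by
      rw [f.as_sum, map_sum]
      refine Submodule.sum_mem _ fun m _ => ?_
      have : (monomial m (coeff m f) : MvPolynomial (Fin N) ℂ) = coeff m f • monomial m 1 := by
        rw [smul_monomial, smul_eq_mul, mul_one]
      rw [this, map_smul]
      exact Submodule.smul_mem _ _ (hsp ⟨m, Set.mem_univ _, rfl⟩)
    have h2 : v '' b = Set.range (fun m : hfin.toFinset => v m.1) := by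
      ext x; simp
    rw [h2, Submodule.mem_span_range_iff_exists_fun] at h1
    obtain ⟨c, hc⟩ := h1
    refine ⟨fun m => if m.1.degree = k then c m else 0, fun m hm => by
      by_contra hne; simp [hne] at hm, ?_⟩
    have h3 : f - ∑ m : hfin.toFinset, c m • (monomial m.1 1 : MvPolynomial (Fin N) ℂ) ∈ I := by
      refine Ideal.Quotient.eq_zero_iff_mem.1 ?_
      change Ideal.Quotient.mkₐ ℂ I _ = 0
      rw [map_sub, map_sum, ← hc]
      simp only [map_smul]
      exact sub_self _
    have h4 := perp_comp H.hG ((H.hI _).2 h3) k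
    rw [← H.hI]
    convert h4 using 1
    rw [map_sub, homogeneousComponent_of_mem hf, if_pos rfl, map_sum]
    congr 1
    refine Finset.sum_congr rfl fun m _ => ?_
    rw [map_smul, homogeneousComponent_of_mem (isHomogeneous_monomial (1:ℂ) (rfl : m.1.degree = _))]
    by_cases h : m.1.degree = k
    · simp [h]
    · simp [h, Ne.symm h]

/-- expansion on a fiber -/
lemma CI.expand (H : CI a δ G g e) {M : Finset (Fin N →₀ ℕ)}
    (hM : ∀ f k, f.IsHomogeneous k → ∃ c : M → ℂ, (∀ m, c m ≠ 0 → m.1.degree = k) ∧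
      f - ∑ m : M, c m • (monomial m.1 1 : MvPolynomial (Fin N) ℂ) ∈ Ideal.span (Set.range g))
    {κ : Fin N → ℂ} {Z : Set (Fin N → ℂ)} (hZ : ∀ z ∈ Z, ∀ k, eval z (g k) = κ k) :
    ∀ k f, f.IsHomogeneous k → ∃ γ : M → ℂ,
      (∀ m, γ m ≠ 0 → m.1.degree = k ∨ m.1.degree + (a + 1) ≤ k) ∧
      (∀ z ∈ Z, eval z f = ∑ m : M, γ m * eval z (monomial m.1 1)) ∧
      ((∀ m, m.1.degree = k → γ m = 0) → f ∈ Ideal.span (Set.range g)) := by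
  intro k
  induction k using Nat.strong_induction_on with
  | _ k ih =>
  intro f hf
  obtain ⟨c, hc, hcI⟩ := hM f k hf
  have hhom : (f - ∑ m : M, c m • (monomial m.1 1 : MvPolynomial (Fin N) ℂ)).IsHomogeneous k := by
    refine hf.sub (IsHomogeneous.sum _ _ _ fun m _ => ?_)
    rw [smul_monomial]
    by_cases h : c m = 0
    · rw [h]; simpa using isHomogeneous_zero _ _ _
    · exact isHomogeneous_monomial _ (hc m h)
  obtain ⟨h, hh, hh0, hsum⟩ := homog_span H.hg hhom hcI
  have hex : ∀ j, ∃ γ : M → ℂ, (∀ m, γ m ≠ 0 → m.1.degree + (a + 1) ≤ k) ∧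
      (∀ z ∈ Z, eval z (h j) = ∑ m : M, γ m * eval z (monomial m.1 1)) := by
    intro j
    have hj := H.he j
    by_cases hlt : k < e j
    · exact ⟨0, by simp, by simp [hh0 j hlt]⟩
    · obtain ⟨γ, h1, h2, -⟩ := ih (k - e j) (by omega) (h j) (hh j)
      refine ⟨γ, fun m hm => ?_, h2⟩
      rcases h1 m hm with h | h <;> omega
  choose γ hγ1 hγ2 using hex
  refine ⟨fun m => c m + ∑ j, κ j * γ j m, ?_, ?_, ?_⟩
  · intro m hm
    by_cases hcm : c m = 0
    · right
      obtain ⟨j, -, hj⟩ := Finset.exists_ne_zero_of_sum_ne_zero (by simpa [hcm] using hm)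
      exact hγ1 j m (right_ne_zero_of_mul hj)
    · exact Or.inl (hc m hcm)
  · intro z hz
    have h1 := congrArg (eval z) hsum
    rw [map_sub, map_sum, map_sum, sub_eq_iff_eq_add] at h1
    rw [h1]
    simp only [map_mul, smul_eval, hZ z hz, hγ2 _ z hz, add_mul, Finset.sum_add_distrib,
      Finset.sum_mul]
    rw [add_comm, Finset.sum_comm]
    congr 1
    refine Finset.sum_congr rfl fun m _ => Finset.sum_congr rfl fun j _ => ?_
    ring
  · intro h0
    have : ∀ m, c m = 0 := by
      intro m
      by_contra hcm
      have hdeg := hc m hcm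
      have : c m + ∑ j, κ j * γ j m = 0 := h0 m hdeg
      rw [Finset.sum_eq_zero, add_zero] at this
      · exact hcm this
      · intro j _
        by_contra hne
        have := hγ1 j m (right_ne_zero_of_mul hne)
        omega
    simpa [this] using hcI

lemma separate {B : Type} [Fintype B] [DecidableEq B] {τ : Type} [Fintype τ] (z : B → τ → ℂ)
    (hz : Function.Injective z) (β : B) :
    ∃ p : MvPolynomial τ ℂ, ∀ β', eval (z β') p = if β' = β then 1 else 0 := by
  have h : ∀ β', β' ≠ β → ∃ i, z β' i ≠ z β i := fun β' hne => Function.ne_iff.1 (fun h => hne (hz h))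
  have h2 : ∀ β', ∃ p : MvPolynomial τ ℂ, eval (z β) p = 1 ∧ (β' ≠ β → eval (z β') p = 0) := by
    intro β'
    by_cases hb : β' = β
    · exact ⟨1, by simp, fun h => absurd hb h⟩
    · obtain ⟨i, hi⟩ := h β' hb
      refine ⟨C (z β i - z β' i)⁻¹ * (X i - C (z β' i)), ?_, ?_⟩
      · simp [inv_mul_cancel₀ (sub_ne_zero.2 hi.symm)]
      · simp
  choose p hp1 hp2 using h2
  refine ⟨∏ β', p β', fun β' => ?_⟩
  rw [map_prod]
  split_ifs with hb
  · subst hb; simp [hp1]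
  · exact Finset.prod_eq_zero (Finset.mem_univ β') (hp2 β' hb)

/-- the points -/
lemma CI.points (H : CI a δ G g e) : ∃ (M : Finset (Fin N →₀ ℕ)) (z : M → Fin N → ℂ),
    (∀ c : M → ℂ, ∑ m : M, c m • (monomial m.1 1 : MvPolynomial (Fin N) ℂ) ∈
      Ideal.span (Set.range g) → ∀ m, c m = 0) ∧
    ∀ f : MvPolynomial (Fin N) ℂ, f.totalDegree ≤ a + δ → (∀ m, eval (z m) f = 0) →
      pair G f = 0 := by
  classical
  obtain ⟨M, hM1, hM2⟩ := H.basis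
  have hfin := finite_of_zero H.hg (fun k => by have := H.he k; omega) H.zero
  have hreg : RegL (List.ofFn g) := by
    have := RegL_of_zero (List.ofFn g) [] (by simp) (by
      intro r hr
      rw [List.mem_ofFn] at hr
      obtain ⟨k, rfl⟩ := hr
      exact ⟨e k, by have := H.he k; omega, H.hg k⟩) (by
      intro z hz
      exact H.zero z fun k => hz _ (by simp [List.mem_ofFn]))
    simpa using this
  obtain ⟨κ, z, hz, hzκ⟩ := fiber g hfin (fun m : M => (monomial m.1 1 : MvPolynomial (Fin N) ℂ))
    (fun P hP β => indep_of_reg g (RegL.fam g hreg) _ hM1 P hP β)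
  refine ⟨M, z, hM1, ?_⟩
  have hexp := H.expand hM2 (κ := κ) (Z := Set.range z) (by rintro _ ⟨β, rfl⟩ k; exact hzκ β k)
  -- independence on the fiber
  let E : Matrix M M ℂ := fun β m => eval (z β) (monomial m.1 1)
  have hsurj : Function.Surjective E.mulVec := by
    intro y
    choose p hp using separate z hz
    have h1 : ∀ f : MvPolynomial (Fin N) ℂ, ∃ γ : M → ℂ, ∀ β, eval (z β) f = E.mulVec γ β := by
      intro f
      choose γ _ hγ _ using fun k => hexp k (homogeneousComponent k f) (homogeneousComponent_isHomogeneous k f)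
      refine ⟨∑ k ∈ Finset.range (f.totalDegree + 1), γ k, fun β => ?_⟩
      conv_lhs => rw [← sum_homogeneousComponent f]
      rw [map_sum, Matrix.mulVec_sum, Finset.sum_apply]
      refine Finset.sum_congr rfl fun k _ => ?_
      rw [hγ k (z β) ⟨β, rfl⟩, Matrix.mulVec, dotProduct]
      exact Finset.sum_congr rfl fun m _ => mul_comm _ _
    obtain ⟨γ, hγ⟩ := h1 (∑ β, C (y β) * p β)
    refine ⟨γ, ?_⟩
    ext β
    rw [← hγ β]
    simp [hp]
  have hinj : Function.Injective E.mulVec := by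
    have : Function.Surjective E.mulVecLin := hsurj
    exact LinearMap.injective_iff_surjective.2 this
  intro f hdeg hf0
  choose γ hγ1 hγ2 hγ3 using fun k => hexp k (homogeneousComponent k f) (homogeneousComponent_isHomogeneous k f)
  have hsum : ∑ k ∈ Finset.range (f.totalDegree + 1), γ k = 0 := by
    apply hinj
    rw [Matrix.mulVec_zero]
    ext β
    rw [Matrix.mulVec_sum, Finset.sum_apply]
    have := hf0 β
    rw [← sum_homogeneousComponent f, map_sum] at this
    rw [Pi.zero_apply, ← this]
    refine Finset.sum_congr rfl fun k _ => ?_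
    rw [hγ2 k (z β) ⟨β, rfl⟩, Matrix.mulVec, dotProduct]
    exact Finset.sum_congr rfl fun m _ => mul_comm _ _
  rw [pair_homComp H.hG]
  by_cases hδ : f.totalDegree < δ
  · rw [homogeneousComponent_eq_zero _ _ hδ, map_zero]
  have hmem := hγ3 δ (by
    intro m hm
    have h1 := congrFun hsum m
    rw [Finset.sum_apply, Finset.sum_eq_single_of_mem δ (by simp; omega)] at h1
    · exact h1
    · intro k hk hkδ
      by_contra hne
      have hk' := Finset.mem_range.1 hk
      rcases hγ1 k m hne with h | h <;> omega)
  have := (H.hI _).2 hmem 1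
  rwa [mul_one] at this

end fam5

section fam5b
variable {N : ℕ}

lemma coeff_cons_fam (a : ℕ) (G : MvPolynomial (Fin N) ℂ) (i : ℕ) (t : Fin N →₀ ℕ) :
    coeff (Finsupp.cons i t) (X 0 ^ a * rename Fin.succ G) = if i = a then coeff t G else 0 := by
  have h : finSuccEquiv ℂ N (rename Fin.succ G) = Polynomial.C G := by
    induction G using MvPolynomial.induction_on with
    | C r => simp [finSuccEquiv_apply]
    | add p q hp hq => simp [hp, hq]
    | mul_X p j hp => rw [map_mul, map_mul, hp, rename_X, finSuccEquiv_X_succ, map_mul]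
  rw [← finSuccEquiv_coeff_coeff, map_mul, map_pow, finSuccEquiv_X_zero, h,
    Polynomial.coeff_mul_C, Polynomial.coeff_X_pow]
  split_ifs <;> simp

lemma mfac_cons (i : ℕ) (t : Fin N →₀ ℕ) : mfac (Finsupp.cons i t) = i.factorial * mfac t := by
  unfold mfac
  rw [Fin.prod_univ_succ]
  simp

lemma degree_cons (i : ℕ) (t : Fin N →₀ ℕ) : (Finsupp.cons i t).degree = i + t.degree := by
  rw [Finsupp.degree_eq_sum, Finsupp.degree_eq_sum, Fin.sum_univ_succ]
  simp

lemma pair_cons (a : ℕ) (G : MvPolynomial (Fin N) ℂ) (i : ℕ) (t : Fin N →₀ ℕ) :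
    pair (X 0 ^ a * rename Fin.succ G) (monomial (Finsupp.cons i t) 1) =
      if i = a then a.factorial * pair G (monomial t 1) else 0 := by
  rw [pair_monomial, coeff_cons_fam, mfac_cons, pair_monomial]
  split_ifs with h
  · rw [h]; ring
  · simp

lemma monomial_cons (i : ℕ) (t : Fin N →₀ ℕ) :
    (monomial (Finsupp.cons i t) 1 : MvPolynomial (Fin (N+1)) ℂ) =
      X 0 ^ i * rename Fin.succ (monomial t 1) := by
  classical
  rw [rename_monomial, X_pow_eq_monomial, monomial_mul, one_mul]
  have h : Finsupp.cons i t = Finsupp.single 0 i + Finsupp.mapDomain Fin.succ t := ?_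
  · rw [h]
  ext j
  refine Fin.cases ?_ (fun j => ?_) j
  · simp [Finsupp.mapDomain_notin_range]
  · rw [Finsupp.cons_succ, Finsupp.add_apply, Finsupp.mapDomain_apply (Fin.succ_injective N)]
    simp [Finsupp.single_apply, (Fin.succ_ne_zero j).symm]

lemma pair_X0 (a : ℕ) (G : MvPolynomial (Fin N) ℂ) (f : MvPolynomial (Fin (N+1)) ℂ) :
    pair (X 0 ^ a * rename Fin.succ G) (X 0 ^ a * f) = a.factorial * pair G (res Fin.succ f) := by
  have : pair (X 0 ^ a * rename Fin.succ G) ∘ₗ LinearMap.mulLeft ℂ (X 0 ^ a) =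
      (a.factorial : ℂ) • (pair G ∘ₗ (res Fin.succ).toLinearMap) := by
    apply pair_ext
    intro m
    rw [← Finsupp.cons_tail m]
    generalize m 0 = i
    generalize m.tail = t
    simp only [LinearMap.comp_apply, LinearMap.mulLeft_apply, LinearMap.smul_apply, smul_eq_mul,
      AlgHom.toLinearMap_apply]
    rw [monomial_cons, ← mul_assoc, ← pow_add, ← monomial_cons, pair_cons, map_mul, map_pow,
      res_rename (Fin.succ_injective N), res_X_of_notMem (fun j => Fin.succ_ne_zero j)]
    rcases Nat.eq_zero_or_pos i with rfl | hi
    · simp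
    · rw [if_neg (by omega), zero_pow (by omega), zero_mul, map_zero, mul_zero]
  exact congrArg (fun L => L f) this

/-- dehomogenisation -/
def dh : MvPolynomial (Fin (N+1)) ℂ →ₐ[ℂ] MvPolynomial (Fin N) ℂ :=
  aeval (Fin.cons 1 X : Fin (N+1) → MvPolynomial (Fin N) ℂ)

lemma dh_cons (i : ℕ) (t : Fin N →₀ ℕ) : dh (monomial (Finsupp.cons i t) 1) = monomial t 1 := by
  have h : ∀ f : MvPolynomial (Fin N) ℂ, dh (rename Fin.succ f) = f := by
    intro f
    unfold dh
    rw [aeval_rename]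
    have : (Fin.cons 1 X : Fin (N+1) → MvPolynomial (Fin N) ℂ) ∘ Fin.succ = X := by
      ext1 j; simp
    rw [this, aeval_X_left_apply]
  rw [monomial_cons, map_mul, h, map_pow]
  simp [dh]

lemma eval_dh (z : Fin N → ℂ) (f : MvPolynomial (Fin (N+1)) ℂ) :
    eval z (dh f) = eval (Fin.cons 1 z) f := by
  induction f using MvPolynomial.induction_on with
  | C r => simp [dh]
  | add p q hp hq => simp [hp, hq]
  | mul_X p j hp =>
    rw [map_mul, map_mul, map_mul, hp]
    congr 1
    refine Fin.cases ?_ (fun j => ?_) j <;> simp [dh]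

lemma pair_dh {a δ : ℕ} {G : MvPolynomial (Fin N) ℂ} (hG : G.IsHomogeneous δ)
    {f : MvPolynomial (Fin (N+1)) ℂ} (hf : f.IsHomogeneous (a + δ)) :
    pair (X 0 ^ a * rename Fin.succ G) f = a.factorial * pair G (dh f) ∧
      (dh f).totalDegree ≤ a + δ := by
  constructor
  · rw [f.as_sum, map_sum, map_sum, map_sum, Finset.mul_sum]
    refine Finset.sum_congr rfl fun m hm => ?_
    have hdeg := homog_degree hf (mem_support_iff.1 hm)
    have h1 : (monomial m (coeff m f) : MvPolynomial (Fin (N+1)) ℂ) = coeff m f • monomial m 1 := by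
      rw [smul_monomial, smul_eq_mul, mul_one]
    rw [h1]
    generalize coeff m f = r
    rw [← Finsupp.cons_tail m] at hdeg ⊢
    generalize m 0 = i at *
    generalize m.tail = t at *
    rw [map_smul, map_smul, map_smul, pair_cons, dh_cons, degree_cons] at *
    split_ifs with h
    · simp only [smul_eq_mul]; ring
    · rw [pair_of_degree_ne hG (isHomogeneous_monomial 1 rfl) (by omega)]; simp
  · conv_lhs => rw [f.as_sum, map_sum]
    refine totalDegree_finsetSum_le fun m hm => ?_
    have hdeg := homog_degree hf (mem_support_iff.1 hm)
    have h1 : (monomial m (coeff m f) : MvPolynomial (Fin (N+1)) ℂ) = coeff m f • monomial m 1 := by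
      rw [smul_monomial, smul_eq_mul, mul_one]
    rw [h1]
    generalize coeff m f = r
    rw [← Finsupp.cons_tail m] at hdeg ⊢
    generalize m 0 = i at *
    generalize m.tail = t at *
    rw [map_smul, dh_cons, smul_monomial]
    rw [degree_cons] at hdeg
    refine (((isHomogeneous_monomial (r • (1:ℂ)) (rfl : t.degree = _))).totalDegree_le).trans (by omega)

variable {a δ : ℕ} {G : MvPolynomial (Fin N) ℂ} {g : Fin N → MvPolynomial (Fin N) ℂ}
    {e : Fin N → ℕ}

lemma CI.lin_zero (H : CI a δ G g e) {w : Fin (N+1) → ℂ}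
    (hw : Perp (X 0 ^ a * rename Fin.succ G) (X 0 * lin w)) : w = 0 := by
  have ha := H.ha
  have h1 : ∀ q, pair G (lin (w ∘ Fin.succ) * q) = 0 := by
    intro q
    have := hw (X 0 ^ (a-1) * rename Fin.succ q)
    rw [show (X 0 : MvPolynomial (Fin (N+1)) ℂ) * lin w * (X 0 ^ (a-1) * rename Fin.succ q) =
      X 0 ^ a * (lin w * rename Fin.succ q) by
        obtain ⟨c, rfl⟩ : ∃ c, a = c + 1 := ⟨a - 1, by omega⟩
        rw [Nat.add_sub_cancel]; ring, pair_X0, map_mul, res_lin (Fin.succ_injective N),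
      res_rename (Fin.succ_injective N)] at this
    exact (mul_eq_zero.1 this).resolve_left (by exact_mod_cast Nat.factorial_ne_zero a)
  have h2 : lin (w ∘ Fin.succ) = 0 := by
    have h3 := (H.hI _).1 h1
    obtain ⟨h, -, h0, hs⟩ := homog_span H.hg (lin_isHomogeneous _) h3
    rw [hs]
    refine Finset.sum_eq_zero fun k _ => ?_
    rw [h0 k (by have := H.he k; omega), zero_mul]
  have h3 := lin_eq_zero h2
  have h4 : lin w = C (w 0) * X 0 := by
    unfold lin
    rw [Fin.sum_univ_succ, Finset.sum_eq_zero, add_zero]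
    intro j _
    have := congrFun h3 j
    simp only [Function.comp_apply, Pi.zero_apply] at this
    rw [this]; simp
  have h5 : w 0 = 0 := by
    by_contra hne
    apply H.hG0
    apply pair_inj
    intro q
    have := hw (X 0 ^ (a-2) * rename Fin.succ q)
    rw [h4, show (X 0 : MvPolynomial (Fin (N+1)) ℂ) * (C (w 0) * X 0) * (X 0 ^ (a-2) * rename Fin.succ q) =
      w 0 • (X 0 ^ a * rename Fin.succ q) by
        obtain ⟨c, rfl⟩ : ∃ c, a = c + 2 := ⟨a - 2, by omega⟩
        rw [Nat.add_sub_cancel, smul_eq_C_mul]; ring, map_smul, pair_X0,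
      res_rename (Fin.succ_injective N), smul_eq_mul] at this
    rw [pair_zero, LinearMap.zero_apply]
    exact ((mul_eq_zero.1 ((mul_eq_zero.1 this).resolve_left hne))).resolve_left
      (by exact_mod_cast Nat.factorial_ne_zero a)
  ext j
  refine Fin.cases h5 (fun j => ?_) j
  exact congrFun h3 j

lemma CI.hom (H : CI a δ G g e) : (X 0 ^ a * rename Fin.succ G).IsHomogeneous (a + δ) := by
  have h1 : (X 0 ^ a : MvPolynomial (Fin (N+1)) ℂ).IsHomogeneous a := by
    simpa using (isHomogeneous_X ℂ (0 : Fin (N+1))).pow a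
  exact h1.mul (H.hG.rename_isHomogeneous)

lemma CI.cert (H : CI a δ G g e) : Nonempty (Cert (a + δ) (X 0 ^ a * rename Fin.succ G)) := by
  classical
  have ha := H.ha
  obtain ⟨M, z, hM, hp⟩ := H.points
  have hu : lin (Pi.single (0 : Fin (N+1)) (1:ℂ)) = X 0 := lin_single 0
  refine ⟨{
    B := {m : M // 2 ≤ m.1.degree}
    fB := inferInstance
    U := Unit
    fU := inferInstance
    b := fun m => rename Fin.succ (monomial m.1.1 1)
    deg := fun m => m.1.1.degree
    two_le := fun m => m.2
    hom := fun m => (isHomogeneous_monomial 1 rfl).rename_isHomogeneous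
    u := fun _ => Pi.single 0 1
    Lam := ∅
    upper := ?_
    indep := ?_
    K1 := ?_
    R1 := ?_
    R2 := by simp
    R3 := by simp }⟩
  · have h1 : HasWaringDecomp (a + δ) (X 0 ^ a * rename Fin.succ G) (Fintype.card M) := by
      refine hasWaring_of_span (by omega) H.hom
        (fun j => Fin.cons 1 (z ((Fintype.equivFin M).symm j))) fun f hf hv => ?_
      obtain ⟨h1, h2⟩ := pair_dh H.hG hf
      rw [h1, hp (dh f) h2, mul_zero]
      intro m
      rw [eval_dh]
      simpa using hv (Fintype.equivFin M m)
    refine h1.mono (by omega) ?_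
    rw [← Fintype.card_congr (Equiv.sumCompl (fun m : M => 2 ≤ m.1.degree)), Fintype.card_sum, add_comm]
    refine Nat.add_le_add_right ?_ _
    have h2 : Function.Injective (fun m : {m : M // ¬ 2 ≤ m.1.degree} =>
        (if h : ∃ i, m.1.1 = Finsupp.single i 1 then Fin.succ h.choose else 0 : Fin (N+1))) := by
      have hz : ∀ m : {m : M // ¬ 2 ≤ m.1.degree}, (¬ ∃ i, m.1.1 = Finsupp.single i 1) → m.1.1 = 0 := by
        intro m hm
        have h3 := m.2
        by_contra hne
        have h4 : m.1.1.degree ≠ 0 := fun h => hne ((Finsupp.degree_eq_zero_iff _).1 h)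
        exact hm (exists_single_of_degree_one (by omega))
      intro m m' h
      apply Subtype.ext; apply Subtype.ext
      simp only at h
      split_ifs at h with h1 h2 h2
      · have := Fin.succ_injective _ h
        rw [h1.choose_spec, h2.choose_spec, this]
      · exact absurd h (Fin.succ_ne_zero _)
      · exact absurd h.symm (Fin.succ_ne_zero _)
      · rw [hz m h1, hz m' h2]
    exact Fintype.card_le_of_injective _ h2
  · intro α hα D c h k heq hperp β hβ
    have hres := congrArg (res (Fin.succ : Fin N → Fin (N+1))) heq
    rw [map_add, map_mul, Fintype.sum_unique (fun j : Unit => _), lin_smul, hu, map_smul,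
      res_X_of_notMem (fun j => Fin.succ_ne_zero j), smul_zero, zero_mul, add_zero, map_sum] at hres
    have hmem : res Fin.succ h ∈ Ideal.span (Set.range g) := by
      rw [← H.hI]
      intro q
      have := hperp () (X 0 ^ (a-1) * rename Fin.succ q)
      rw [hu, show (X 0 : MvPolynomial (Fin (N+1)) ℂ) * h * (X 0 ^ (a-1) * rename Fin.succ q) =
        X 0 ^ a * (h * rename Fin.succ q) by
          obtain ⟨c, rfl⟩ : ∃ c, a = c + 1 := ⟨a - 1, by omega⟩
          rw [Nat.add_sub_cancel]; ring, pair_X0, map_mul, res_rename (Fin.succ_injective N)] at this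
      exact (mul_eq_zero.1 this).resolve_left (by exact_mod_cast Nat.factorial_ne_zero a)
    rw [← hres] at hmem
    let c' : M → ℂ := fun m => if hm : 2 ≤ m.1.degree then (if m.1.degree = D then c ⟨m, hm⟩ else 0) else 0
    have h3 := hM c' (by
      convert hmem using 1
      rw [← Fintype.sum_subtype_add_sum_subtype (fun m : M => 2 ≤ m.1.degree),
        Finset.sum_eq_zero (s := (Finset.univ : Finset {m : M // ¬ 2 ≤ m.1.degree})), add_zero]
      · refine Finset.sum_congr rfl fun m _ => ?_
        have hm2 := m.2
        by_cases hD : m.1.1.degree = D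
        · rw [if_pos hD, map_smul, res_rename (Fin.succ_injective N)]
          simp only [c', dif_pos hm2, if_pos hD]
        · rw [if_neg hD, map_zero]
          simp only [c', dif_pos hm2, if_neg hD, zero_smul]
      · intro m _
        simp only [c', dif_neg m.2, zero_smul]) β.1
    simp only [c', dif_pos β.2, if_pos hβ] at h3
    exact h3
  · intro w hw
    have := hw ()
    rw [hu] at this
    exact H.lin_zero this
  · intro α hα w hw x _
    rw [Fintype.sum_unique (fun j : Unit => _), lin_smul, hu] at hw
    have h1 := hw.smul (α default)⁻¹
    rw [smul_mul_assoc, smul_smul, inv_mul_cancel₀ (hα _), one_smul] at h1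
    rw [H.lin_zero h1]; rfl

end fam5b

section final

lemma pair_mono_left {σ : Type} [Fintype σ] (D : σ →₀ ℕ) (f : MvPolynomial σ ℂ) :
    pair (monomial D 1) f = mfac D * coeff D f := by
  rw [pair_comm, pair_monomial]

lemma perp_mono {N : ℕ} (D : Fin N →₀ ℕ) (h : MvPolynomial (Fin N) ℂ) :
    Perp (monomial D 1) h ↔
      h ∈ Ideal.span (Set.range fun j => (X j : MvPolynomial (Fin N) ℂ) ^ (D j + 1)) := by
  classical
  have hr : Set.range (fun j => (X j : MvPolynomial (Fin N) ℂ) ^ (D j + 1)) =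
      (fun s => monomial s (1:ℂ)) '' Set.range (fun j => Finsupp.single j (D j + 1)) := by
    rw [← Set.range_comp]
    congr 1
    ext1 j
    rw [X_pow_eq_monomial]; rfl
  constructor
  · intro hp
    rw [hr, mem_ideal_span_monomial_image]
    intro m hm
    by_contra hc
    push Not at hc
    have hle : m ≤ D := by
      intro j
      have := hc _ ⟨j, rfl⟩
      rw [Finsupp.single_le_iff] at this
      omega
    have h1 := hp (monomial (D - m) 1)
    rw [pair_mono_left, coeff_mul_monomial', if_pos tsub_le_self, tsub_tsub_cancel_of_le hle,
      mul_one] at h1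
    exact mem_support_iff.1 hm ((mul_eq_zero.1 h1).resolve_left (mfac_ne D))
  · intro hm
    have : Ideal.span (Set.range fun j => (X j : MvPolynomial (Fin N) ℂ) ^ (D j + 1)) ≤
        perpIdeal (monomial D 1) := by
      rw [Ideal.span_le]
      rintro _ ⟨j, rfl⟩
      change Perp _ _
      intro q
      simp only
      rw [pair_mono_left, X_pow_eq_monomial, coeff_monomial_mul', if_neg, mul_zero]
      rw [Finsupp.single_le_iff]; omega
    exact this hm

lemma cert_fam5 {N d a : ℕ} (ha : 2 ≤ a) {G : MvPolynomial (Fin N) ℂ}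
    (hF : (X 0 ^ a * rename Fin.succ G).IsHomogeneous d) (h0 : X 0 ^ a * rename Fin.succ G ≠ 0)
    (g : Fin N → MvPolynomial (Fin N) ℂ) (hg : ∀ k, ∃ e : ℕ, a + 1 ≤ e ∧ (g k).IsHomogeneous e)
    (hI : ∀ h, Perp G h ↔ h ∈ Ideal.span (Set.range g)) :
    Nonempty (Cert d (X 0 ^ a * rename Fin.succ G)) := by
  have hG0 : G ≠ 0 := by rintro rfl; simp at h0
  choose e he hge using hg
  have hdeg : ∀ t, coeff t G ≠ 0 → a + t.degree = d := by
    intro t ht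
    rw [← degree_cons]
    refine homog_degree hF ?_
    rw [coeff_cons_fam, if_pos rfl]
    exact ht
  obtain ⟨t, ht⟩ := ne_zero_iff.1 hG0
  have hd := hdeg t ht
  have hG : G.IsHomogeneous t.degree := by
    intro m hm
    have := hdeg m hm
    have hw : Finsupp.weight 1 m = m.degree := by
      rw [Finsupp.degree_eq_weight_one]; rfl
    rw [hw]
    omega
  have H : CI a t.degree G g e := ⟨ha, hG, hG0, hge, he, hI⟩
  rw [← hd]
  exact H.cert

lemma cert_mono {N d : ℕ} (ex : Fin (N+1) → ℕ) (h2 : ∀ j, 2 ≤ ex j)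
    (hF : (∏ j, (X j : MvPolynomial (Fin (N+1)) ℂ) ^ ex j).IsHomogeneous d) :
    Nonempty (Cert d (∏ j, (X j : MvPolynomial (Fin (N+1)) ℂ) ^ ex j)) := by
  classical
  obtain ⟨j0, hj0⟩ := Finite.exists_min ex
  let s := Equiv.swap (0 : Fin (N+1)) j0
  have hs : (∏ j, (X j : MvPolynomial (Fin (N+1)) ℂ) ^ ex j) =
      rename s (∏ j, (X j : MvPolynomial (Fin (N+1)) ℂ) ^ ex (s j)) := by
    rw [map_prod, ← Equiv.prod_comp s]
    simp
  let D : Fin N →₀ ℕ := Finsupp.equivFunOnFinite.symm fun j => ex (s j.succ)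
  have hD : (∏ j, (X j : MvPolynomial (Fin (N+1)) ℂ) ^ ex (s j)) =
      X 0 ^ ex j0 * rename Fin.succ (monomial D 1) := by
    rw [Fin.prod_univ_succ, monomial_eq, Finsupp.prod_fintype _ _ (by simp)]
    simp [s, D]
  have hF' : (X 0 ^ ex j0 * rename Fin.succ (monomial D (1:ℂ))).IsHomogeneous d := by
    rw [hs] at hF
    rw [← hD]
    exact (IsHomogeneous.rename_isHomogeneous_iff s.injective).1 hF
  obtain ⟨C⟩ := cert_fam5 (h2 j0) hF' (by
    rw [← hD]
    exact Finset.prod_ne_zero_iff.2 fun j _ => pow_ne_zero _ (X_ne_zero j))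
    (fun j => X j ^ (D j + 1)) (fun k => ⟨D k + 1, by
      have := hj0 (s k.succ)
      simp only [D, Finsupp.equivFunOnFinite_symm_apply_apply]
      omega, by simpa using (isHomogeneous_X ℂ k).pow (D k + 1)⟩) (perp_mono D)
  rw [hs, hD]
  exact ⟨C.transport s⟩

lemma fam34_hom {n a b : ℕ} {κ : ℂ} : (fam34 n a b κ).IsHomogeneous (a + b) := by
  unfold fam34
  refine IsHomogeneous.add (IsHomogeneous.sum _ _ _ fun l _ => ?_) ?_
  · simpa using ((isHomogeneous_X ℂ (0 : Fin (n+2))).pow a).mul ((isHomogeneous_X ℂ l.succ).pow b)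
  · rw [smul_eq_C_mul]
    simpa using (isHomogeneous_C _ κ).mul ((isHomogeneous_X ℂ (0 : Fin (n+2))).pow (a+b))

lemma cert_good {N d : ℕ} (hd : 3 ≤ d) {G : MvPolynomial (Fin (N+1)) ℂ} (h0 : G ≠ 0)
    (hG : G.IsHomogeneous d) (h : IsGoodForm d G) : Nonempty (Cert d G) := by
  classical
  rcases h with ⟨ex, h2, rfl⟩ | ⟨rfl, hN⟩ | ⟨a, b, hb, hN, hab, rfl⟩ | ⟨a, b, hb, hN, hab, rfl⟩ |
    ⟨a, ha, G', rfl, g, hg, hI⟩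
  · exact cert_mono ex h2 hG
  · exact cert_binary hd hG hN
  · obtain ⟨n, rfl⟩ : ∃ n, N = n + 1 := ⟨N - 1, by omega⟩
    have he : (X 0 ^ a * ∑ j ∈ Finset.univ.erase (0 : Fin (n + 1 + 1)), X j ^ b :
        MvPolynomial (Fin (n+2)) ℂ) = fam34 n a b 0 := by
      unfold fam34
      have : Finset.univ.erase (0 : Fin (n+2)) = Finset.univ.image Fin.succ := by
        ext j; refine Fin.cases ?_ (fun j => ?_) j <;> simp
      rw [this, Finset.sum_image (fun x _ y _ h => Fin.succ_injective _ h), Finset.mul_sum,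
        zero_smul, add_zero]
    rw [he] at h0 hG ⊢
    rw [hG.inj_right fam34_hom h0]
    exact ⟨cert34 hb hab (by omega) (Or.inl rfl)⟩
  · obtain ⟨n, rfl⟩ : ∃ n, N = n + 1 := ⟨N - 1, by omega⟩
    have he : (X 0 ^ a * ∑ j : Fin (n + 1 + 1), X j ^ b :
        MvPolynomial (Fin (n+2)) ℂ) = fam34 n a b 1 := by
      unfold fam34
      rw [Fin.sum_univ_succ, mul_add, Finset.mul_sum, one_smul, pow_add]
      exact add_comm _ _
    rw [he] at h0 hG ⊢
    rw [hG.inj_right fam34_hom h0]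
    exact ⟨cert34 hb hab (by omega) (Or.inr rfl)⟩
  · refine cert_fam5 ha hG h0 g hg fun h => ?_
    rw [← hI, contract_eq_zero_iff]

end final

/-- Waring-locus version of Strassen's conjecture for sums of forms in
disjoint sets of variables, each belonging to one of the five good families.  The
variables are indexed by `(i : Fin s) × Fin (n i + 1)`, block `i` corresponding to
`x_{i,0}, …, x_{i,n_i}`; the `i`-th summand is `Gᵢ` written in the `i`-th block of
variables.  Then the Waring locus of `F = ∑ Fᵢ` is the union of the Waring loci of
the `Fᵢ`. -/
theorem waring_locus_strassen_good_families (s : ℕ) (n : Fin s → ℕ) (d : ℕ) (hd : 3 ≤ d)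
    (G : (i : Fin s) → MvPolynomial (Fin (n i + 1)) ℂ)
    (hGne : ∀ i, G i ≠ 0) (hGhom : ∀ i, (G i).IsHomogeneous d)
    (hfam : ∀ i, IsGoodForm d (G i)) :
    ∀ a : ((i : Fin s) × Fin (n i + 1)) → ℂ, a ≠ 0 →
      (InWaringLocus d
          (∑ i, rename (fun j => (⟨i, j⟩ : (k : Fin s) × Fin (n k + 1))) (G i)) a ↔
        ∃ i, (∀ j : (k : Fin s) × Fin (n k + 1), j.1 ≠ i → a j = 0) ∧
          InWaringLocus d
            (rename (fun j => (⟨i, j⟩ : (k : Fin s) × Fin (n k + 1))) (G i)) a) := by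
  intro a _
  exact main_of_cert hd hGhom (fun i => (cert_good hd (hGne i) (hGhom i) (hfam i)).some) a

end
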